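/- Let n ≥ 2 and let E = E(r_1,…,r_n) ⊂ ℝ^{2n} be the open ellipsoid with symplectic half axes 1 = r_1 ≤ … ≤ r_n = R, where at least two of the half axes are different (so R > 1) and R < 2^{1/(2n)}. For ε ∈ (0,1) set U_ε = (1+ε)E \ closure((1−ε)E). Then the function ε ↦ s(U_ε) from (0,1) to [0,∞] is not continuous at ε₀ = (R−1)/(R+1). -/

import Mathlib

open Metric Set MeasureTheory Real Filter Topology Bornology
open scoped ContDiff ENNReal

noncomputable section

/-- `ℝ^{2n}` with the Euclidean structure. -/
abbrev R2n (n : ℕ) := EuclideanSpace ℝ (Fin (2 * n))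

/-- The standard symplectic form `ω_st = Σ dx_i ∧ dy_i` on `ℝ^{2n}`,
evaluated on a pair of (tangent) vectors. -/
def sympForm (n : ℕ) (v w : R2n n) : ℝ :=
  ∑ i : Fin n,
    (v ⟨2 * i.1, by have := i.isLt; omega⟩ * w ⟨2 * i.1 + 1, by have := i.isLt; omega⟩ -
      v ⟨2 * i.1 + 1, by have := i.isLt; omega⟩ * w ⟨2 * i.1, by have := i.isLt; omega⟩)

/-- `φ` is a symplectic embedding of the open set `N ⊆ ℝ^{2n}` into `U ⊆ ℝ^{2n}`:
a smooth injective map on `N` with image in `U` whose derivative preserves `ω_st`. -/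
def IsSympEmbOn (n : ℕ) (N U : Set (R2n n)) (φ : R2n n → R2n n) : Prop :=
  IsOpen N ∧ ContDiffOn ℝ ∞ φ N ∧ InjOn φ N ∧ MapsTo φ N U ∧
    ∀ p ∈ N, ∀ v w : R2n n,
      sympForm n (fderiv ℝ φ p v) (fderiv ℝ φ p w) = sympForm n v w

/-- A symplectic embedding of (a neighbourhood of) an arbitrary set `A ⊆ ℝ^{2n}` into `U`. -/
def SympEmbNbhd (n : ℕ) (A U : Set (R2n n)) : Prop :=
  ∃ N φ, A ⊆ N ∧ IsSympEmbOn n N U φ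

/-- The spherical capacity `s(U)`. -/
def sphericalCap (n : ℕ) (U : Set (R2n n)) : ℝ≥0∞ :=
  sSup {c : ℝ≥0∞ | ∃ r : ℝ, 0 < r ∧ c = ENNReal.ofReal (π * r ^ 2) ∧
    SympEmbNbhd n (sphere (0 : R2n n) r) U}

/-- The quadratic form defining the ellipsoid with symplectic half axes `a i`. -/
def ellQ (n : ℕ) (a : Fin n → ℝ) (z : R2n n) : ℝ :=
  ∑ i : Fin n,
    ((z ⟨2 * i.1, by have := i.isLt; omega⟩) ^ 2 +
      (z ⟨2 * i.1 + 1, by have := i.isLt; omega⟩) ^ 2) / (a i) ^ 2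

/-- The open ellipsoid `E(a 0, …, a (n-1)) ⊆ ℝ^{2n}`. -/
def ellipsoid (n : ℕ) (a : Fin n → ℝ) : Set (R2n n) := {z | ellQ n a z < 1}

/-- The boundary `∂E(a 0, …, a (n-1)) ⊆ ℝ^{2n}` of an ellipsoid. -/
def ellipsoidBdry (n : ℕ) (a : Fin n → ℝ) : Set (R2n n) := {z | ellQ n a z = 1}

/-- The ellipsoidal shell `U_ε = (1+ε)E \ closure((1-ε)E)`. -/
def ellShell (n : ℕ) (a : Fin n → ℝ) (ε : ℝ) : Set (R2n n) :=
  ellipsoid n (fun i => (1 + ε) * a i) \ closure (ellipsoid n (fun i => (1 - ε) * a i))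

/-- The `δ`-shell capacity `c_δ(U)`, defined via embeddings of the closed
shells `r A_δ = closure(B_r) \ B_{r(1-δ)}`. -/
def shellCap (n : ℕ) (δ : ℝ) (U : Set (R2n n)) : ℝ≥0∞ :=
  sSup {c : ℝ≥0∞ | ∃ r : ℝ, 0 < r ∧ c = ENNReal.ofReal (π * r ^ 2) ∧
    SympEmbNbhd n (closedBall (0 : R2n n) r \ ball 0 (r * (1 - δ))) U}

/-- The ellipsoidal capacity `e(U)`: the supremum of `π r₁²` over symplectic embeddings of
boundaries of ellipsoids with half axes `r₁ ≤ … ≤ r_n` (here `r₁ = ⨅ i, a i`). -/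
def ellipsoidalCap (n : ℕ) (U : Set (R2n n)) : ℝ≥0∞ :=
  sSup {c : ℝ≥0∞ | ∃ a : Fin n → ℝ, (∀ i, 0 < a i) ∧ Monotone a ∧
    c = ENNReal.ofReal (π * (⨅ i, a i) ^ 2) ∧ SympEmbNbhd n (ellipsoidBdry n a) U}

/-- The Gromov radius `c_B(U)`. -/
def gromovRadius (n : ℕ) (U : Set (R2n n)) : ℝ≥0∞ :=
  sSup {c : ℝ≥0∞ | ∃ r : ℝ, 0 < r ∧ c = ENNReal.ofReal (π * r ^ 2) ∧
    ∃ φ, IsSympEmbOn n (ball (0 : R2n n) r) U φ}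

/-- The determinant of `1 + A` is a fixed linear combination of the determinants of `1 + t j • A`
at sufficiently many distinct nodes `t j`. -/
theorem exists_det_one_add_eq_sum {Y : Type*} [NormedAddCommGroup Y] [NormedSpace ℝ Y]
    [FiniteDimensional ℝ Y] (t : ℕ → ℝ) (ht : Function.Injective t) :
    ∃ (m : ℕ) (c : ℕ → ℝ), ∀ A : Y →L[ℝ] Y,
      (1 + A).det = ∑ j ∈ Finset.range m, c j * (1 + t j • A).det := by
  classical
  set d := Module.finrank ℝ Y
  let b := Module.finBasis ℝ Y
  refine ⟨d + 1, fun j => (Lagrange.basis (Finset.range (d + 1)) t j).eval 1, fun A => ?_⟩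
  let M : Matrix (Fin d) (Fin d) ℝ := LinearMap.toMatrix b b A
  let q : Polynomial ℝ := Matrix.det ((Polynomial.X : Polynomial ℝ) • M.map Polynomial.C
    + (1 : Matrix (Fin d) (Fin d) ℝ).map Polynomial.C)
  have hq : ∀ s : ℝ, q.eval s = (1 + s • A).det := by
    intro s
    have h1 : (1 + s • A).det = Matrix.det (1 + s • M) := by
      rw [ContinuousLinearMap.det, ← LinearMap.det_toMatrix b]
      congr 1
      simp [M]
    rw [h1, ← Polynomial.coe_evalRingHom, RingHom.map_det]
    congr 1
    ext i j
    by_cases hij : i = j <;> simp [hij, add_comm, mul_comm (M _ _) s]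
  have hdeg : q.degree < (Finset.range (d + 1)).card := by
    rw [Finset.card_range]
    refine (Polynomial.degree_le_natDegree).trans_lt ?_
    have := Polynomial.natDegree_det_X_add_C_le M 1
    rw [Fintype.card_fin] at this
    exact_mod_cast Nat.lt_succ_of_le this
  have := congrArg (Polynomial.eval 1) (Lagrange.eq_interpolate (v := t) ht.injOn hdeg)
  rw [hq, one_smul, Lagrange.interpolate_apply, Polynomial.eval_finsetSum] at this
  rw [this]
  refine Finset.sum_congr rfl fun j _ => ?_
  rw [Polynomial.eval_mul, Polynomial.eval_C, hq, mul_comm]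

/-- A small `C¹` perturbation of the identity of the unit ball which fixes the unit sphere and maps
the ball into itself preserves the ball, hence its volume. -/
theorem integral_det_one_add_smul_eq {Y : Type*} [NormedAddCommGroup Y] [InnerProductSpace ℝ Y]
    [FiniteDimensional ℝ Y] [MeasurableSpace Y] [BorelSpace Y] {G : Y → Y}
    (hG : ContDiff ℝ 1 G) (hsph : ∀ x, ‖x‖ = 1 → G x = 0)
    (hball : ∀ x, ‖x‖ ≤ 1 → ‖x + G x‖ ≤ 1) :
    ∃ δ > 0, ∀ t : ℝ, 0 < t → t < δ →
      ∫ x in ball (0 : Y) 1, (1 + t • fderiv ℝ G x).det = volume.real (ball (0 : Y) 1) := by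
  have hcompact : IsCompact (closedBall (0 : Y) 1) := isCompact_closedBall _ _
  obtain ⟨C, hC⟩ := (hcompact.bddAbove_image
    (f := fun x => ‖fderiv ℝ G x‖) (by fun_prop : Continuous _).continuousOn)
  have hC' : ∀ x ∈ closedBall (0 : Y) 1, ‖fderiv ℝ G x‖ ≤ C := fun x hx =>
    hC ⟨x, hx, rfl⟩
  have hC0 : 0 ≤ C := (norm_nonneg _).trans (hC' 0 (by simp))
  have hlip : ∀ x ∈ closedBall (0 : Y) 1, ∀ y ∈ closedBall (0 : Y) 1,
      ‖G x - G y‖ ≤ C * ‖x - y‖ := fun x hx y hy =>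
    (convex_closedBall (0 : Y) 1).norm_image_sub_le_of_norm_fderiv_le
      (fun z _ => (hG.differentiable one_ne_zero z)) hC' hy hx
  have hopen : IsOpen {B : Y →L[ℝ] Y | 0 < B.det} :=
    isOpen_lt continuous_const ContinuousLinearMap.continuous_det
  obtain ⟨δ₀, hδ₀, hδ₀'⟩ := Metric.isOpen_iff.1 hopen 1
    (by simp [ContinuousLinearMap.det])
  refine ⟨min 1 (min (δ₀ / (C + 1)) (1 / (C + 1))), by positivity, fun t ht0 ht => ?_⟩
  have ht1 : t < 1 := ht.trans_le (min_le_left _ _)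
  have ht2 : t * (C + 1) < δ₀ := by
    have := ht.trans_le ((min_le_right _ _).trans (min_le_left _ _))
    rwa [lt_div_iff₀ (by positivity)] at this
  have ht3 : t * (C + 1) < 1 := by
    have := ht.trans_le ((min_le_right _ _).trans (min_le_right _ _))
    rwa [lt_div_iff₀ (by positivity)] at this
  set f : Y → Y := fun x => x + t • G x with hf
  have hfd : ∀ x, HasFDerivAt f (1 + t • fderiv ℝ G x) x := fun x =>
    (hasFDerivAt_id x).add (((hG.differentiable one_ne_zero x).hasFDerivAt).const_smul t)
  have hpos : ∀ x ∈ ball (0 : Y) 1, 0 < (1 + t • fderiv ℝ G x).det := by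
    intro x hx
    apply hδ₀'
    rw [mem_ball, dist_eq_norm, add_sub_cancel_left, norm_smul, Real.norm_of_nonneg ht0.le]
    have := hC' x (ball_subset_closedBall hx)
    nlinarith
  have happ : ∀ s ⊆ closedBall (0 : Y) 1, ApproximatesLinearOn f
      ((ContinuousLinearEquiv.refl ℝ Y : Y ≃L[ℝ] Y) : Y →L[ℝ] Y) s (t * C).toNNReal := by
    intro s hs x hx y hy
    have h1 : f x - f y - ((ContinuousLinearEquiv.refl ℝ Y : Y ≃L[ℝ] Y) : Y →L[ℝ] Y) (x - y)
        = t • (G x - G y) := by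
      simp only [hf, ContinuousLinearEquiv.coe_refl, ContinuousLinearMap.coe_id', id, smul_sub]
      abel
    rw [h1, norm_smul, Real.norm_of_nonneg ht0.le, Real.coe_toNNReal _ (by positivity), mul_assoc]
    exact mul_le_mul_of_nonneg_left (hlip x (hs hx) y (hs hy)) ht0.le
  have hinj : InjOn f (closedBall (0 : Y) 1) := by
    intro x hx y hy hxy
    by_contra hne
    have h1 : x - y = t • (G y - G x) := by
      have : x + t • G x = y + t • G y := hxy
      rw [smul_sub, sub_eq_sub_iff_add_eq_add, this, add_comm]
    have h2 : ‖x - y‖ ≤ t * (C * ‖x - y‖) := by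
      conv_lhs => rw [h1]
      rw [norm_smul, Real.norm_of_nonneg ht0.le, norm_sub_rev x y]
      exact mul_le_mul_of_nonneg_left (hlip y hy x hx) ht0.le
    have h3 : 0 < ‖x - y‖ := norm_pos_iff.2 (sub_ne_zero.2 hne)
    nlinarith
  have hfC : ∀ x, ‖x‖ ≤ 1 → ‖f x‖ ≤ 1 := by
    intro x hx
    have h1 : f x = (1 - t) • x + t • (x + G x) := by
      simp only [hf, sub_smul, smul_add, one_smul]; abel
    rw [h1]
    refine (norm_add_le _ _).trans ?_
    rw [norm_smul, norm_smul, Real.norm_of_nonneg ht0.le, Real.norm_of_nonneg (by linarith)]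
    have := hball x hx
    nlinarith
  have hfopen : IsOpen (f '' ball (0 : Y) 1) := by
    refine (happ _ ball_subset_closedBall).open_image
      ((ContinuousLinearEquiv.refl ℝ Y).toNonlinearRightInverse) isOpen_ball ?_
    by_cases hs : Subsingleton Y
    · exact Or.inl hs
    · right
      rw [not_subsingleton_iff_nontrivial] at hs
      have h1 : ((ContinuousLinearEquiv.refl ℝ Y).toNonlinearRightInverse).nnnorm = 1 := by
        change ‖((ContinuousLinearEquiv.refl ℝ Y).symm : Y →L[ℝ] Y)‖₊ = 1
        simp
      rw [h1, inv_one, Real.toNNReal_lt_one]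
      nlinarith
  have himage : f '' ball (0 : Y) 1 = ball (0 : Y) 1 := by
    apply Subset.antisymm
    · have : f '' ball (0 : Y) 1 ⊆ closedBall 0 1 := by
        rintro _ ⟨x, hx, rfl⟩
        simpa using hfC x (by simpa using (ball_subset_closedBall hx))
      rcases subsingleton_or_nontrivial Y with h | h
      · intro y _
        simp [Subsingleton.elim y 0]
      · have h2 := interior_maximal this hfopen
        rwa [interior_closedBall _ one_ne_zero] at h2
    · have hconn : IsPreconnected (ball (0 : Y) 1) := (convex_ball _ _).isPreconnected
      have hcl : IsClosed (f '' closedBall (0 : Y) 1) :=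
        (hcompact.image (by have := hG.continuous; fun_prop)).isClosed
      have hsub : ball (0 : Y) 1 ⊆ f '' ball (0 : Y) 1 ∪ (f '' closedBall (0 : Y) 1)ᶜ := by
        intro y hy
        by_cases h : y ∈ f '' closedBall (0 : Y) 1
        · left
          obtain ⟨x, hx, rfl⟩ := h
          rcases (mem_closedBall.1 hx).lt_or_eq with h | h
          · exact ⟨x, h, rfl⟩
          · exfalso
            rw [dist_zero_right] at h
            rw [mem_ball, dist_zero_right] at hy
            simp [hf, hsph x h, h] at hy
        · exact Or.inr h
      refine hconn.subset_left_of_subset_union hfopen hcl.isOpen_compl ?_ hsub ?_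
      · rw [Set.disjoint_left]
        intro y hy hy'
        exact hy' (image_mono ball_subset_closedBall hy)
      · refine ⟨f 0, ?_, ⟨0, by simp, rfl⟩⟩
        have h0 : f 0 ∈ f '' ball (0 : Y) 1 := ⟨0, by simp, rfl⟩
        rcases subsingleton_or_nontrivial Y with h | h
        · simp [Subsingleton.elim (f 0) 0]
        · have : f '' ball (0 : Y) 1 ⊆ closedBall 0 1 := by
            rintro _ ⟨x, hx, rfl⟩
            simpa using hfC x (by simpa using (ball_subset_closedBall hx))
          have h2 := interior_maximal this hfopen
          rw [interior_closedBall _ one_ne_zero] at h2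
          exact h2 h0
  have hcv := integral_image_eq_integral_abs_det_fderiv_smul (volume : Measure Y)
    (measurableSet_ball (x := (0 : Y)) (ε := 1)) (fun x _ => (hfd x).hasFDerivWithinAt)
    (hinj.mono ball_subset_closedBall) (fun _ => (1 : ℝ))
  rw [himage] at hcv
  simp only [integral_const, smul_eq_mul, mul_one, measureReal_restrict_apply_univ] at hcv
  rw [hcv]
  refine setIntegral_congr_fun measurableSet_ball fun x hx => ?_
  exact (abs_of_pos (hpos x hx)).symm

/-- There is no `C¹` retraction of the unit ball onto its boundary. -/
theorem not_exists_contDiff_retraction {Y : Type*} [NormedAddCommGroup Y] [InnerProductSpace ℝ Y]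
    [FiniteDimensional ℝ Y] {g : Y → Y} (hg : ContDiff ℝ 1 g)
    (hsph : ∀ x, ‖x‖ = 1 → g x = x) (hnorm : ∀ x, ‖g x‖ = 1) : False := by
  let _ : MeasurableSpace Y := borel Y
  have _ : BorelSpace Y := ⟨rfl⟩
  set G : Y → Y := fun x => g x - x with hGdef
  have hG : ContDiff ℝ 1 G := hg.sub contDiff_id
  obtain ⟨δ, hδ, hvol⟩ := integral_det_one_add_smul_eq hG
    (fun x hx => by simp [hGdef, hsph x hx]) (fun x _ => by simp [hGdef, hnorm x])
  have htpos : ∀ j : ℕ, 0 < δ / ((j : ℝ) + 2) := fun j => by positivity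
  obtain ⟨m, c, hc⟩ := exists_det_one_add_eq_sum (Y := Y) (fun j : ℕ => δ / ((j : ℝ) + 2)) (by
    intro i j hij
    simp only at hij
    rw [div_eq_div_iff (by positivity) (by positivity)] at hij
    have := mul_left_cancel₀ hδ.ne' hij
    exact_mod_cast (by linarith : (i : ℝ) = j))
  have hzero : ∀ x, (1 + fderiv ℝ G x).det = 0 := by
    intro x
    have h1 : 1 + fderiv ℝ G x = fderiv ℝ g x := by
      have hd : HasFDerivAt G (fderiv ℝ g x - ContinuousLinearMap.id ℝ Y) x :=
        (hg.differentiable one_ne_zero x).hasFDerivAt.sub (hasFDerivAt_id x)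
      rw [hd.fderiv]
      ext v
      simp
    rw [h1]
    by_contra hdet
    have hsurj : Function.Surjective (fderiv ℝ g x) := by
      exact ((LinearEquiv.ofIsUnitDet (f := (fderiv ℝ g x : Y →ₗ[ℝ] Y))
        (v := Module.finBasis ℝ Y) (v' := Module.finBasis ℝ Y)
        (by rw [LinearMap.det_toMatrix]; exact isUnit_iff_ne_zero.2 hdet)).surjective)
    obtain ⟨v, hv⟩ := hsurj (g x)
    have h2 : HasFDerivAt (fun y => ‖g y‖ ^ 2) _ x :=
      (hg.differentiable one_ne_zero x).hasFDerivAt.norm_sq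
    have h3 : (fun y => ‖g y‖ ^ 2) = fun _ => (1 : ℝ) := by
      ext y; simp [hnorm y]
    rw [h3] at h2
    have h4 := h2.unique (hasFDerivAt_const 1 x)
    have h5 := DFunLike.congr_fun h4 v
    simp [hv, hnorm x] at h5
  have hsum : ∑ j ∈ Finset.range m, c j = 1 := by
    have := hc 0
    simpa [ContinuousLinearMap.det] using this.symm
  have hInt : ∫ x in ball (0 : Y) 1, (1 + fderiv ℝ G x).det = volume.real (ball (0 : Y) 1) := by
    rw [integral_congr_ae (Eventually.of_forall fun x => hc (fderiv ℝ G x)), integral_finsetSum]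
    · have h1 : volume.real (ball (0 : Y) 1)
          = ∑ j ∈ Finset.range m, c j * volume.real (ball (0 : Y) 1) := by
        rw [← Finset.sum_mul, hsum, one_mul]
      rw [h1]
      refine Finset.sum_congr rfl fun j _ => ?_
      rw [integral_const_mul, hvol _ (htpos j)]
      · exact div_lt_self hδ (by linarith [(j.cast_nonneg : (0 : ℝ) ≤ j)])
    · intro j _
      have hcont : Continuous fun x => c j * (1 + (δ / ((j : ℝ) + 2)) • fderiv ℝ G x).det := by
        refine continuous_const.mul (ContinuousLinearMap.continuous_det.comp ?_)
        have := hG.continuous_fderiv one_ne_zero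
        fun_prop
      exact (hcont.continuousOn.integrableOn_compact (isCompact_closedBall (0 : Y) 1)).mono_set
        ball_subset_closedBall
  simp only [hzero, integral_zero] at hInt
  have hpos : 0 < volume.real (ball (0 : Y) 1) :=
    ENNReal.toReal_pos (measure_ball_pos _ _ one_pos).ne' measure_ball_lt_top.ne
  exact hpos.ne hInt

/-- A continuous self-map of a Euclidean space that is a translation outside a bounded set has a
zero. -/
theorem exists_eq_zero_of_eq_sub_off_bounded {Y : Type*} [NormedAddCommGroup Y]
    [InnerProductSpace ℝ Y] [FiniteDimensional ℝ Y] {f : Y → Y} (hf : Continuous f) (p : Y)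
    (r : ℝ) (hfr : ∀ y, r ≤ ‖y‖ → f y = y - p) : ∃ y, f y = 0 := by
  by_contra! hne
  set ρ : ℝ := max r 0 + ‖p‖ + 1 with hρ
  have hρpos : 0 < ρ := by positivity
  have hρr : r + ‖p‖ + 1 ≤ ρ := by linarith [le_max_left r 0]
  have hρp : ‖p‖ + 1 ≤ ρ := by linarith [le_max_right r 0]
  -- a uniform lower bound for `f`
  obtain ⟨δ, hδ, hδf⟩ : ∃ δ > 0, ∀ y, δ ≤ ‖f y‖ := by
    have hK : IsCompact (closedBall (0 : Y) ρ) := isCompact_closedBall _ _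
    obtain ⟨y₀, -, hy₀⟩ := hK.exists_isMinOn ⟨0, by simp [hρpos.le]⟩
      (hf.norm.continuousOn (s := closedBall (0 : Y) ρ))
    refine ⟨min ‖f y₀‖ 1, lt_min (norm_pos_iff.2 (hne y₀)) one_pos, fun y => ?_⟩
    by_cases hy : ‖y‖ ≤ ρ
    · exact (min_le_left _ _).trans (hy₀ (by simpa using hy))
    · push Not at hy
      rw [hfr y (by linarith [norm_nonneg p])]
      have := norm_sub_norm_le y p
      exact (min_le_right _ _).trans (by linarith)
  set k : Y → Y := fun y => f y - (y - p) with hk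
  have hkc : Continuous k := by fun_prop
  have hk0 : ∀ y, r ≤ ‖y‖ → k y = 0 := fun y hy => by simp [hk, hfr y hy]
  have hku : UniformContinuous k := by
    refine hkc.uniformContinuous_of_tendsto_cocompact (x := 0) ?_
    refine tendsto_const_nhds.congr' ?_
    filter_upwards [(isCompact_closedBall (0 : Y) r).compl_mem_cocompact] with y hy
    have : r < ‖y‖ := by simpa using hy
    exact (hk0 y this.le).symm
  obtain ⟨η, hη, hηk⟩ := Metric.uniformContinuous_iff.1 hku (δ / 2) (by positivity)
  obtain ⟨q, hq, hqk⟩ := hkc.exists_contDiff_dist_le_of_forall_mem_ball_dist_le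
    (lt_min hη one_pos)
  have hq1 : ∀ y, ‖q y - k y‖ ≤ δ / 2 := fun y => by
    rw [← dist_eq_norm]
    exact hqk y _ fun x hx => (hηk (lt_of_lt_of_le hx (min_le_left _ _))).le
  have hq2 : ∀ y, r + 1 ≤ ‖y‖ → q y = 0 := by
    intro y hy
    have := hqk y 0 fun x hx => by
      have h1 : ‖y‖ - ‖x‖ ≤ ‖y - x‖ := norm_sub_norm_le y x
      have h2 : ‖x - y‖ < 1 := by
        rw [← dist_eq_norm]; exact lt_of_lt_of_le hx (min_le_right _ _)
      rw [norm_sub_rev] at h2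
      rw [hk0 x (by linarith), hk0 y (by linarith), dist_self]
    rw [hk0 y (by linarith)] at this
    simpa using this
  set F : Y → Y := fun y => y - p + q y with hF
  have hFne : ∀ y, F y ≠ 0 := by
    intro y hy
    have h1 : f y = k y - q y + F y := by simp only [hk, hF]; abel
    have h2 := hδf y
    rw [h1, hy, add_zero, norm_sub_rev] at h2
    linarith [hq1 y]
  -- push `F` onto the unit sphere after rescaling
  set g : Y → Y := fun x => ‖F (ρ • x + p)‖⁻¹ • F (ρ • x + p) with hg
  have hFsm : ContDiff ℝ 1 F := by
    have : ContDiff ℝ 1 q := hq.of_le (by exact_mod_cast le_top)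
    fun_prop
  refine not_exists_contDiff_retraction (g := g) ?_ (fun x hx => ?_) (fun x => ?_)
  · have h1 : ContDiff ℝ 1 fun x : Y => F (ρ • x + p) := hFsm.comp (by fun_prop)
    exact (h1.norm ℝ fun x => hFne _).inv (fun x => norm_ne_zero_iff.2 (hFne _)) |>.smul h1
  · have h1 : F (ρ • x + p) = ρ • x := by
      have h2 := norm_sub_le_norm_add (ρ • x) p
      rw [norm_smul, hx, Real.norm_of_nonneg hρpos.le] at h2
      simp only [hF, hq2 (ρ • x + p) (by linarith)]
      abel
    simp only [hg, h1, norm_smul, hx, Real.norm_of_nonneg hρpos.le, mul_one, smul_smul,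
      inv_mul_cancel₀ hρpos.ne', one_smul]
  · rw [hg, norm_smul, norm_inv, norm_norm, inv_mul_cancel₀ (norm_ne_zero_iff.2 (hFne _))]

/-- Quadratic upper bound for a function with Lipschitz gradient. -/
theorem le_add_inner_add_of_lipschitz_gradient {E : Type*} [NormedAddCommGroup E]
    [InnerProductSpace ℝ E] {A : E → ℝ} {g : E → E} {Λ : ℝ}
    (hA : ∀ x, HasFDerivAt A (innerSL ℝ (g x)) x) (hΛ : ∀ x y, ‖g x - g y‖ ≤ Λ * ‖x - y‖)
    (hΛ0 : 0 ≤ Λ) (x v : E) : A (x + v) ≤ A x + inner ℝ (g x) v + Λ * ‖v‖ ^ 2 := by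
  have h := (convex_closedBall x ‖v‖).norm_image_sub_le_of_norm_hasFDerivWithin_le'
    (f := A) (φ := innerSL ℝ (g x)) (C := Λ * ‖v‖) (x := x) (y := x + v)
    (fun y _ => (hA y).hasFDerivWithinAt) (fun y hy => by
      rw [← map_sub, innerSL_apply_norm]
      refine (hΛ y x).trans (mul_le_mul_of_nonneg_left ?_ hΛ0)
      rwa [← dist_eq_norm])
    (by simp) (by simp)
  have h' := (le_abs_self _).trans h
  simp only [add_sub_cancel_left, innerSL_apply_apply] at h'
  nlinarith

/-- A linking theorem for functions with Lipschitz and coercive gradient on a Euclidean space. -/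
theorem exists_critical_point_of_linking {E Y : Type*} [NormedAddCommGroup E]
    [InnerProductSpace ℝ E] [FiniteDimensional ℝ E] [NormedAddCommGroup Y]
    [InnerProductSpace ℝ Y] [FiniteDimensional ℝ Y]
    {A : E → ℝ} {g : E → E} {Λ c₀ M : ℝ}
    (hA : ∀ x, HasFDerivAt A (innerSL ℝ (g x)) x) (hΛ : ∀ x y, ‖g x - g y‖ ≤ Λ * ‖x - y‖)
    (hΛ0 : 0 ≤ Λ) (hc₀ : 0 < c₀) (hcoer : ∀ x, c₀ * ‖x‖ - M ≤ ‖g x‖)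
    {ι : Y → E} (hι : Continuous ι) {Ψ : E → Y} (hΨ : Continuous Ψ) {D : Set Y} (hD : IsClosed D)
    {p : Y} (hp : p ∈ D) (hΨι : ∀ y ∈ D, Ψ (ι y) = y - p) {b b₁ c r : ℝ} (hb : b < b₁)
    (hfront : ∀ y ∈ frontier D, A (ι y) ≤ b) (hout : ∀ y ∈ D, r ≤ ‖y‖ → A (ι y) ≤ b)
    (hsup : ∀ y ∈ D, A (ι y) ≤ c) (hlink : ∀ x, Ψ x = 0 → b₁ ≤ A x) :
    ∃ x, g x = 0 ∧ b₁ ≤ A x ∧ A x ≤ c := by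
  by_contra! hno
  have hgc : Continuous g := by
    have : LipschitzWith Λ.toNNReal g := LipschitzWith.of_dist_le_mul fun x y => by
      rw [dist_eq_norm, dist_eq_norm, Real.coe_toNNReal _ hΛ0]
      exact hΛ x y
    exact this.continuous
  have hAc : Continuous A := continuous_iff_continuousAt.2 fun x => (hA x).continuousAt
  -- uniform lower bound for the gradient
  obtain ⟨μ, hμ, hμg⟩ : ∃ μ > 0, ∀ x, b₁ ≤ A x → A x ≤ c → μ ≤ ‖g x‖ := by
    set K : Set E := closedBall 0 ((M + 1) / c₀) ∩ (A ⁻¹' Icc b₁ c) with hK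
    have hKc : IsCompact K := (isCompact_closedBall _ _).inter_right (isClosed_Icc.preimage hAc)
    have hfar : ∀ x, x ∉ closedBall (0 : E) ((M + 1) / c₀) → 1 ≤ ‖g x‖ := by
      intro x hx
      have : (M + 1) / c₀ < ‖x‖ := by simpa using hx
      rw [div_lt_iff₀ hc₀] at this
      linarith [hcoer x]
    rcases K.eq_empty_or_nonempty with hKe | hKn
    · refine ⟨1, one_pos, fun x h1 h2 => hfar x fun hx => ?_⟩
      have : x ∈ K := ⟨hx, h1, h2⟩
      rw [hKe] at this
      exact this
    · obtain ⟨x₀, hx₀, hmin⟩ := hKc.exists_isMinOn hKn hgc.norm.continuousOn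
      have h0 : 0 < ‖g x₀‖ := norm_pos_iff.2 fun h =>
        (hno x₀ h hx₀.2.1).not_ge hx₀.2.2
      refine ⟨min 1 ‖g x₀‖, lt_min one_pos h0, fun x h1 h2 => ?_⟩
      by_cases hx : x ∈ closedBall (0 : E) ((M + 1) / c₀)
      · exact (min_le_right _ _).trans (hmin ⟨hx, h1, h2⟩)
      · exact (min_le_left _ _).trans (hfar x hx)
  set η : ℝ := 1 / (2 * (Λ + 1)) with hη
  have hη0 : 0 < η := by positivity
  have hηΛ : Λ * η ≤ 1 / 2 := by
    rw [hη, mul_one_div, div_le_div_iff₀ (by positivity) (by positivity)]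
    linarith
  set χ : ℝ → ℝ := fun s => max 0 (min 1 ((s - b) / (b₁ - b))) with hχ
  have hχc : Continuous χ := by fun_prop
  have hχ0 : ∀ s, 0 ≤ χ s := fun s => le_max_left _ _
  have hχ1 : ∀ s, χ s ≤ 1 := fun s => max_le zero_le_one (min_le_left _ _)
  have hχb : ∀ s, s ≤ b → χ s = 0 := fun s hs => by
    have : (s - b) / (b₁ - b) ≤ 0 := div_nonpos_of_nonpos_of_nonneg (by linarith) (by linarith)
    simp only [hχ]
    rw [max_eq_left]
    exact (min_le_right _ _).trans this
  have hχb₁ : ∀ s, b₁ ≤ s → χ s = 1 := fun s hs => by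
    have : 1 ≤ (s - b) / (b₁ - b) := by rw [le_div_iff₀ (by linarith)]; linarith
    simp only [hχ]
    rw [min_eq_left this, max_eq_right zero_le_one]
  set T : E → E := fun x => x + (-(η * χ (A x))) • g x with hT
  have hTc : Continuous T := by fun_prop
  have hdec : ∀ x, A (T x) ≤ A x - η / 2 * χ (A x) * ‖g x‖ ^ 2 := by
    intro x
    have h := le_add_inner_add_of_lipschitz_gradient hA hΛ hΛ0 x ((-(η * χ (A x))) • g x)
    rw [inner_smul_right, real_inner_self_eq_norm_sq, norm_smul, norm_neg,
      Real.norm_of_nonneg (mul_nonneg hη0.le (hχ0 _))] at h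
    refine h.trans ?_
    have h1 : Λ * η * χ (A x) ≤ 1 / 2 := by
      have := mul_le_mul hηΛ (hχ1 (A x)) (hχ0 _) (by norm_num : (0 : ℝ) ≤ 1 / 2)
      linarith
    have h2 : 0 ≤ η * χ (A x) * ‖g x‖ ^ 2 :=
      mul_nonneg (mul_nonneg hη0.le (hχ0 _)) (sq_nonneg _)
    nlinarith
  have hmono : ∀ x, A (T x) ≤ A x := fun x => (hdec x).trans (by
    have : 0 ≤ η / 2 * χ (A x) * ‖g x‖ ^ 2 :=
      mul_nonneg (mul_nonneg (by positivity) (hχ0 _)) (sq_nonneg _)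
    linarith)
  have hiter : ∀ (m : ℕ) (x : E), A x ≤ c → b₁ ≤ A (T^[m] x) →
      A (T^[m] x) ≤ c - m * (η / 2 * μ ^ 2) := by
    intro m x hx
    induction m with
    | zero => intro _; simpa using hx
    | succ m ih =>
      intro h
      rw [Function.iterate_succ_apply'] at h ⊢
      have h1 := h.trans (hmono _)
      have h2 := ih h1
      have h3 := hdec (T^[m] x)
      have hm : 0 ≤ (m : ℝ) * (η / 2 * μ ^ 2) := by positivity
      have h4 := hμg _ h1 (by linarith)
      rw [hχb₁ _ h1, mul_one] at h3
      have h5 : μ ^ 2 ≤ ‖g (T^[m] x)‖ ^ 2 := pow_le_pow_left₀ hμ.le h4 2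
      have h6 := mul_le_mul_of_nonneg_left h5 (by positivity : 0 ≤ η / 2)
      push_cast
      linarith
  obtain ⟨m, hm⟩ := exists_nat_gt ((c - b₁) / (η / 2 * μ ^ 2))
  rw [div_lt_iff₀ (by positivity)] at hm
  have hfix : ∀ x, A x ≤ b → T^[m] x = x := fun x hx =>
    Function.iterate_fixed (by simp [hT, hχb _ hx]) m
  classical
  have hfc : Continuous (D.piecewise (fun y => Ψ (T^[m] (ι y))) fun y => y - p) := by
    refine Continuous.piecewise (fun y hy => ?_) (hΨ.comp ((hTc.iterate m).comp hι))
      (continuous_id.sub continuous_const)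
    rw [hfix _ (hfront y hy), hΨι y (hD.frontier_subset hy)]
  obtain ⟨y, hy⟩ := exists_eq_zero_of_eq_sub_off_bounded hfc p r fun y hy => by
    by_cases hyD : y ∈ D
    · rw [piecewise_eq_of_mem _ _ _ hyD, hfix _ (hout y hyD hy), hΨι y hyD]
    · rw [piecewise_eq_of_notMem _ _ _ hyD]
  by_cases hyD : y ∈ D
  · rw [piecewise_eq_of_mem _ _ _ hyD] at hy
    have h1 := hlink _ hy
    have h2 := hiter m _ (hsup y hyD) h1
    linarith
  · rw [piecewise_eq_of_notMem _ _ _ hyD] at hy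
    exact hyD (by rwa [sub_eq_zero.1 hy])

section Rotation

variable {V : Type*} [NormedAddCommGroup V] [InnerProductSpace ℝ V]

/-- The rotation `cos θ + sin θ J` generated by a complex structure `J`. -/
def rot (J : V →L[ℝ] V) (θ : ℝ) : V →L[ℝ] V := cos θ • ContinuousLinearMap.id ℝ V + sin θ • J

/-- `J` is an orthogonal complex structure. -/
structure IsOrthComplex (J : V →L[ℝ] V) : Prop where
  sq : ∀ v, J (J v) = -v
  skew : ∀ v w, inner ℝ (J v) w = -inner ℝ v (J w)

variable {J : V →L[ℝ] V}

theorem rot_apply (θ : ℝ) (v : V) : rot J θ v = cos θ • v + sin θ • J v := by simp [rot]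

theorem rot_zero (v : V) : rot J 0 v = v := by simp [rot_apply]

theorem rot_two_pi_int (k : ℤ) (v : V) : rot J (2 * π * k) v = v := by
  rw [rot_apply, mul_comm, Real.cos_int_mul_two_pi]
  have : sin ((k : ℝ) * (2 * π)) = 0 := by
    have := Real.sin_add_int_mul_two_pi 0 k
    simpa using this
  simp [this]

theorem rot_rot (hJ : IsOrthComplex J) (a b : ℝ) (v : V) :
    rot J a (rot J b v) = rot J (a + b) v := by
  simp only [rot_apply, map_add, map_smul, hJ.sq, cos_add, sin_add]
  module

theorem inner_rot_left (hJ : IsOrthComplex J) (a : ℝ) (v w : V) :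
    inner ℝ (rot J a v) w = inner ℝ v (rot J (-a) w) := by
  simp only [rot_apply, inner_add_left, inner_add_right, inner_smul_left, inner_smul_right,
    hJ.skew, cos_neg, sin_neg]
  simp

theorem inner_rot_rot (hJ : IsOrthComplex J) (a : ℝ) (v w : V) :
    inner ℝ (rot J a v) (rot J a w) = inner ℝ v w := by
  rw [inner_rot_left hJ, rot_rot hJ, neg_add_cancel, rot_zero]

theorem norm_rot (hJ : IsOrthComplex J) (a : ℝ) (v : V) : ‖rot J a v‖ = ‖v‖ := by
  rw [← sq_eq_sq₀ (norm_nonneg _) (norm_nonneg _), ← real_inner_self_eq_norm_sq,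
    ← real_inner_self_eq_norm_sq, inner_rot_rot hJ]

theorem IsOrthComplex.inner_apply_self (hJ : IsOrthComplex J) (v : V) : inner ℝ (J v) v = 0 := by
  have := hJ.skew v v
  rw [real_inner_comm] at this
  rw [real_inner_comm]
  linarith

theorem IsOrthComplex.norm_apply (hJ : IsOrthComplex J) (v : V) : ‖J v‖ = ‖v‖ := by
  have := norm_rot hJ (π / 2) v
  simpa [rot_apply] using this

theorem rot_comm {K : V →L[ℝ] V} (hK : ∀ v, K (J v) = J (K v)) (a : ℝ) (v : V) :
    K (rot J a v) = rot J a (K v) := by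
  simp [rot_apply, hK]

theorem hasDerivAt_rot (hJ : IsOrthComplex J) (c t : ℝ) (v : V) :
    HasDerivAt (fun t : ℝ => rot J (c * t) v) (c • J (rot J (c * t) v)) t := by
  have h1 : HasDerivAt (fun t : ℝ => c * t) c t := by simpa using (hasDerivAt_id t).const_mul c
  have h := (h1.cos.smul_const v).add (h1.sin.smul_const (J v))
  simp only [rot_apply]
  refine h.congr_deriv ?_
  simp only [map_add, map_smul, hJ.sq]
  module

@[fun_prop]
theorem continuous_rot_comp {X : Type*} [TopologicalSpace X] {a : X → ℝ} {f : X → V}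
    (ha : Continuous a) (hf : Continuous f) : Continuous fun x => rot J (a x) (f x) := by
  simp only [rot_apply]
  fun_prop

theorem integral_rot [CompleteSpace V] (hJ : IsOrthComplex J) (m : ℤ) (v : V) :
    ∫ t in (0 : ℝ)..1, rot J (2 * π * m * t) v = if m = 0 then v else 0 := by
  split_ifs with hm
  · simp [hm, rot_zero]
  · have hc : (2 * π * m : ℝ) ≠ 0 := by
      have : (m : ℝ) ≠ 0 := by exact_mod_cast hm
      positivity
    have h : ∀ t ∈ uIcc (0 : ℝ) 1, HasDerivAt
        (fun t : ℝ => (2 * π * m : ℝ)⁻¹ • rot J (2 * π * m * t) (-J v))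
        (rot J (2 * π * m * t) v) t := fun t _ => by
      refine ((hasDerivAt_rot hJ (2 * π * m) t (-J v)).const_smul _).congr_deriv ?_
      rw [smul_smul, inv_mul_cancel₀ hc, one_smul, rot_comm (K := J) (fun _ => rfl), map_neg,
        hJ.sq, neg_neg]
    rw [intervalIntegral.integral_eq_sub_of_hasDerivAt h
      (Continuous.intervalIntegrable (by fun_prop) _ _)]
    rw [mul_one, mul_zero, rot_two_pi_int, rot_zero, sub_self]

/-- The `k`-th Fourier coefficient of a loop, with respect to the rotations generated by `J`. -/
def coef (J : V →L[ℝ] V) (k : ℤ) (f : ℝ → V) : V :=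
  ∫ t in (0 : ℝ)..1, rot J (-(2 * π * k * t)) (f t)

theorem inner_coef [CompleteSpace V] (hJ : IsOrthComplex J) (k : ℤ) {f : ℝ → V}
    (hf : Continuous f) (u : V) :
    inner ℝ (coef J k f) u = ∫ t in (0 : ℝ)..1, inner ℝ (f t) (rot J (2 * π * k * t) u) := by
  have h := (innerSL ℝ u).intervalIntegral_comp_comm (μ := volume) (a := (0 : ℝ)) (b := 1)
    (f := fun t => rot J (-(2 * π * k * t)) (f t))
    (Continuous.intervalIntegrable (by fun_prop) _ _)
  simp only [innerSL_apply_apply] at h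
  rw [real_inner_comm, coef, ← h]
  refine intervalIntegral.integral_congr fun t _ => ?_
  rw [real_inner_comm, inner_rot_left hJ, neg_neg]

theorem coef_sub [CompleteSpace V] (k : ℤ) {f g : ℝ → V} (hf : Continuous f) (hg : Continuous g) :
    coef J k (fun t => f t - g t) = coef J k f - coef J k g := by
  simp only [coef, map_sub]
  exact intervalIntegral.integral_sub (Continuous.intervalIntegrable (by fun_prop) _ _)
    (Continuous.intervalIntegrable (by fun_prop) _ _)

theorem norm_coef_le (hJ : IsOrthComplex J) (k : ℤ) {f : ℝ → V} {C : ℝ}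
    (hf : ∀ t ∈ Icc (0 : ℝ) 1, ‖f t‖ ≤ C) : ‖coef J k f‖ ≤ C := by
  have := intervalIntegral.norm_integral_le_of_norm_le_const (a := (0 : ℝ)) (b := 1) (C := C)
    (f := fun t => rot J (-(2 * π * k * t)) (f t)) (fun t ht => by
      rw [uIoc_of_le zero_le_one] at ht
      rw [norm_rot hJ]
      exact hf t (Ioc_subset_Icc_self ht))
  simpa [coef] using this

/-- The trigonometric loop with given coefficients. -/
def trig (J : V →L[ℝ] V) {S : Finset ℤ} (v : S → V) (t : ℝ) : V :=
  ∑ k : S, rot J (2 * π * (k : ℤ) * t) (v k)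

variable {S : Finset ℤ}

@[fun_prop]
theorem continuous_trig (v : S → V) : Continuous (trig J v) := by
  unfold trig
  fun_prop

theorem trig_add (v w : S → V) (t : ℝ) : trig J (v + w) t = trig J v t + trig J w t := by
  simp [trig, Finset.sum_add_distrib]

theorem trig_sub (v w : S → V) (t : ℝ) : trig J (v - w) t = trig J v t - trig J w t := by
  simp [trig, Finset.sum_sub_distrib]

theorem trig_comm {K : V →L[ℝ] V} (hK : ∀ v, K (J v) = J (K v)) (v : S → V) (t : ℝ) :
    K (trig J v t) = trig J (fun k => K (v k)) t := by
  simp [trig, rot_comm hK]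

theorem norm_trig_le (hJ : IsOrthComplex J) (v : S → V) (t : ℝ) :
    ‖trig J v t‖ ≤ ∑ k, ‖v k‖ :=
  (norm_sum_le _ _).trans (by simp [norm_rot hJ])

theorem trig_one (v : S → V) : trig J v 1 = trig J v 0 := by
  simp [trig, rot_two_pi_int, rot_zero]

theorem hasDerivAt_trig (hJ : IsOrthComplex J) (v : S → V) (t : ℝ) :
    HasDerivAt (trig J v) (J (trig J (fun k : S => (2 * π * (k : ℤ) : ℝ) • v k) t)) t := by
  unfold trig
  refine (HasDerivAt.fun_sum fun (k : S) _ => hasDerivAt_rot hJ (2 * π * (k : ℤ))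
    t (v k)).congr_deriv ?_
  simp

theorem sum_inner_coef [CompleteSpace V] (hJ : IsOrthComplex J) {f : ℝ → V} (hf : Continuous f)
    (w : S → V) :
    ∑ k : S, inner ℝ (coef J k f) (w k) = ∫ t in (0 : ℝ)..1, inner ℝ (f t) (trig J w t) := by
  simp only [inner_coef hJ _ hf, trig, inner_sum]
  rw [intervalIntegral.integral_finsetSum]
  exact fun k _ => Continuous.intervalIntegrable (by fun_prop) _ _

theorem coef_trig [CompleteSpace V] (hJ : IsOrthComplex J) (v : S → V) (k : S) :
    coef J k (trig J v) = v k := by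
  simp only [coef, trig, map_sum, rot_rot hJ]
  rw [intervalIntegral.integral_finsetSum
    (fun i _ => Continuous.intervalIntegrable (by fun_prop) _ _)]
  have h : ∀ i : S, ∫ t in (0 : ℝ)..1,
      rot J (-(2 * π * (k : ℤ) * t) + 2 * π * (i : ℤ) * t) (v i) = if i = k then v i else 0 := by
    intro i
    have h1 := integral_rot hJ ((i : ℤ) - k) (v i)
    simp only [sub_eq_zero, Subtype.coe_inj] at h1
    rw [← h1]
    refine intervalIntegral.integral_congr fun t _ => ?_
    congr 2
    push_cast
    ring
  simp [h]

theorem integral_inner_trig [CompleteSpace V] (hJ : IsOrthComplex J) (v w : S → V) :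
    ∫ t in (0 : ℝ)..1, inner ℝ (trig J v t) (trig J w t) = ∑ k, inner ℝ (v k) (w k) := by
  rw [← sum_inner_coef hJ (continuous_trig v)]
  simp only [coef_trig hJ]

theorem integral_norm_sq_trig [CompleteSpace V] (hJ : IsOrthComplex J) (v : S → V) :
    ∫ t in (0 : ℝ)..1, ‖trig J v t‖ ^ 2 = ∑ k, ‖v k‖ ^ 2 := by
  simp only [← real_inner_self_eq_norm_sq]
  exact integral_inner_trig hJ v v

theorem sum_norm_sq_coef_le [CompleteSpace V] (hJ : IsOrthComplex J) {f : ℝ → V}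
    (hf : Continuous f) (S : Finset ℤ) :
    ∑ k : S, ‖coef J k f‖ ^ 2 ≤ ∫ t in (0 : ℝ)..1, ‖f t‖ ^ 2 := by
  set u : S → V := fun k => coef J k f
  have h1 := sum_inner_coef hJ hf u
  have h2 := integral_norm_sq_trig hJ u
  have h3 : 0 ≤ ∫ t in (0 : ℝ)..1, ‖f t - trig J u t‖ ^ 2 :=
    intervalIntegral.integral_nonneg zero_le_one fun t _ => sq_nonneg _
  simp only [norm_sub_sq_real] at h3
  rw [intervalIntegral.integral_add, intervalIntegral.integral_sub,
    intervalIntegral.integral_const_mul, ← h1, h2] at h3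
  · simp only [u, real_inner_self_eq_norm_sq] at h3 ⊢
    linarith
  all_goals exact Continuous.intervalIntegrable (by fun_prop) _ _

end Rotation

section Galerkin

variable {V : Type*} [NormedAddCommGroup V] [InnerProductSpace ℝ V]

/-- The Hamiltonian `H` has Lipschitz gradient `G`, which is a bounded perturbation of a
nonresonant linear unitary map `2 K`. -/
structure IsNonresonant (J K : V →L[ℝ] V) (H : V → ℝ) (G : V → V) (Λ B c : ℝ) : Prop where
  complex : IsOrthComplex J
  hasFDerivAt : ∀ z, HasFDerivAt H (innerSL ℝ (G z)) z
  lipschitz : ∀ z w, ‖G z - G w‖ ≤ Λ * ‖z - w‖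
  nonneg : 0 ≤ Λ
  comm : ∀ v, K (J v) = J (K v)
  bounded : ∀ z, ‖G z - (2 : ℝ) • K z‖ ≤ B
  pos : 0 < c
  nonresonant : ∀ (k : ℤ) v,
    c * (1 + |(k : ℝ)|) * ‖v‖ ≤ ‖(2 * π * k : ℝ) • v - (2 : ℝ) • K v‖

/-- The space of loops with Fourier modes in `S`. -/
abbrev FourierLoop (V : Type*) (S : Finset ℤ) := PiLp 2 fun _ : S => V

/-- The Hamiltonian action functional on `FourierLoop V S`. -/
def galA (J : V →L[ℝ] V) (H : V → ℝ) (S : Finset ℤ) (v : FourierLoop V S) : ℝ :=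
  ∑ k : S, π * (k : ℤ) * ‖v k‖ ^ 2 - ∫ t in (0 : ℝ)..1, H (trig J v.ofLp t)

/-- The gradient of the Hamiltonian action functional on `FourierLoop V S`. -/
def galG (J : V →L[ℝ] V) (G : V → V) (S : Finset ℤ) (v : FourierLoop V S) : FourierLoop V S :=
  WithLp.toLp 2 fun k : S =>
    (2 * π * (k : ℤ) : ℝ) • v k - coef J k fun t => G (trig J v.ofLp t)

theorem FourierLoop.norm_le_sum {V : Type*} [NormedAddCommGroup V] {S : Finset ℤ}
    (v : FourierLoop V S) : ‖v‖ ≤ ∑ k, ‖v k‖ := by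
  rw [← sq_le_sq₀ (norm_nonneg _) (Finset.sum_nonneg fun _ _ => norm_nonneg _),
    PiLp.norm_sq_eq_of_L2]
  exact Finset.sum_sq_le_sq_sum_of_nonneg fun _ _ => norm_nonneg _

theorem hasFDerivAt_of_sq_bound {E : Type*} [NormedAddCommGroup E] [InnerProductSpace ℝ E]
    {f : E → ℝ} {x g : E} {C : ℝ}
    (h : ∀ w, |f (x + w) - f x - inner ℝ g w| ≤ C * ‖w‖ ^ 2) :
    HasFDerivAt f (innerSL ℝ g) x := by
  rw [hasFDerivAt_iff_isLittleO_nhds_zero]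
  refine Asymptotics.IsBigO.trans_isLittleO (g := fun w : E => ‖w‖ ^ 2)
    (Asymptotics.IsBigO.of_bound C (Eventually.of_forall fun w => ?_))
    (Asymptotics.IsLittleO.of_norm_right ?_)
  · rw [Real.norm_eq_abs, Real.norm_of_nonneg (sq_nonneg _)]
    exact h w
  · have := Asymptotics.isLittleO_pow_id (𝕜 := ℝ) (n := 2) (by norm_num)
    exact this.comp_tendsto (tendsto_norm_zero (E := E))

variable {J K : V →L[ℝ] V} {H : V → ℝ} {G : V → V} {Λ B c : ℝ} {S : Finset ℤ}

theorem IsNonresonant.continuous_G (h : IsNonresonant J K H G Λ B c) : Continuous G := by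
  have : LipschitzWith Λ.toNNReal G := LipschitzWith.of_dist_le_mul fun x y => by
    rw [dist_eq_norm, dist_eq_norm, Real.coe_toNNReal _ h.nonneg]
    exact h.lipschitz x y
  exact this.continuous

theorem IsNonresonant.continuous_H (h : IsNonresonant J K H G Λ B c) : Continuous H :=
  continuous_iff_continuousAt.2 fun x => (h.hasFDerivAt x).continuousAt

theorem IsNonresonant.abs_sub_sub_le (h : IsNonresonant J K H G Λ B c) (x v : V) :
    |H (x + v) - H x - inner ℝ (G x) v| ≤ Λ * ‖v‖ ^ 2 := by
  have h1 := le_add_inner_add_of_lipschitz_gradient h.hasFDerivAt h.lipschitz h.nonneg x v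
  have h2 := le_add_inner_add_of_lipschitz_gradient (A := fun x => -H x) (g := fun x => -G x)
    (fun z => by rw [map_neg]; exact (h.hasFDerivAt z).fun_neg) (fun z w => by
      rw [← neg_sub', norm_neg]; exact h.lipschitz z w) h.nonneg x v
  rw [inner_neg_left] at h2
  rw [abs_le]
  constructor <;> linarith

theorem norm_trig_le_card (hJ : IsOrthComplex J) (v : FourierLoop V S) (t : ℝ) :
    ‖trig J v.ofLp t‖ ≤ S.card * ‖v‖ := by
  refine (norm_trig_le hJ _ t).trans ?_
  refine (Finset.sum_le_sum fun k _ => PiLp.norm_apply_le v k).trans ?_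
  simp

theorem hasFDerivAt_galA [CompleteSpace V] (h : IsNonresonant J K H G Λ B c)
    (v : FourierLoop V S) : HasFDerivAt (galA J H S) (innerSL ℝ (galG J G S v)) v := by
  have hHc := h.continuous_H
  have hGc := h.continuous_G
  refine hasFDerivAt_of_sq_bound (C := ∑ k : S, |π * (k : ℤ)| + Λ) fun w => ?_
  set x := trig J v.ofLp
  set y := trig J w.ofLp
  have hxc : Continuous x := continuous_trig _
  have hyc : Continuous y := continuous_trig _
  have hxy : ∀ t, trig J (v + w).ofLp t = x t + y t := fun t => trig_add _ _ t
  have h1 := sum_inner_coef h.complex (f := fun t => G (x t)) (hGc.comp hxc) w.ofLp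
  have h2 : galA J H S (v + w) - galA J H S v - inner ℝ (galG J G S v) w
      = ∑ k : S, π * (k : ℤ) * ‖w k‖ ^ 2
        - ∫ t in (0 : ℝ)..1, (H (x t + y t) - H (x t) - inner ℝ (G (x t)) (y t)) := by
    rw [intervalIntegral.integral_sub, intervalIntegral.integral_sub, ← h1]
    · simp only [galA, galG, hxy, PiLp.inner_apply, PiLp.add_apply, inner_sub_left,
        Finset.sum_sub_distrib, norm_add_sq_real, mul_add, Finset.sum_add_distrib,
        inner_smul_left, conj_trivial]
      have : ∀ k : S, π * ((k : ℤ) : ℝ) * (2 * inner ℝ (v k) (w k))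
          = 2 * π * ((k : ℤ) : ℝ) * inner ℝ (v k) (w k) := fun k => by ring
      simp only [this]
      ring
    all_goals exact Continuous.intervalIntegrable (by fun_prop) _ _
  rw [h2, add_mul]
  refine (abs_sub _ _).trans (add_le_add ?_ ?_)
  · rw [Finset.sum_mul]
    refine (Finset.abs_sum_le_sum_abs _ _).trans (Finset.sum_le_sum fun k _ => ?_)
    rw [abs_mul, abs_of_nonneg (sq_nonneg ‖w k‖)]
    exact mul_le_mul_of_nonneg_left
      (pow_le_pow_left₀ (norm_nonneg _) (PiLp.norm_apply_le w k) 2) (abs_nonneg _)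
  · rw [PiLp.norm_sq_eq_of_L2, ← integral_norm_sq_trig h.complex,
      ← intervalIntegral.integral_const_mul, ← Real.norm_eq_abs]
    exact intervalIntegral.norm_integral_le_of_norm_le zero_le_one
      (Eventually.of_forall fun t _ => h.abs_sub_sub_le _ _)
      (Continuous.intervalIntegrable (by fun_prop) _ _)

theorem exists_lipschitz_galG [CompleteSpace V] (h : IsNonresonant J K H G Λ B c) :
    ∃ L, 0 ≤ L ∧ ∀ v w : FourierLoop V S, ‖galG J G S v - galG J G S w‖ ≤ L * ‖v - w‖ := by
  have hGc := h.continuous_G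
  have hΛ := h.nonneg
  refine ⟨∑ k : S, (|2 * π * (k : ℤ)| + Λ * S.card), by positivity, fun v w => ?_⟩
  refine (FourierLoop.norm_le_sum _).trans ?_
  rw [Finset.sum_mul]
  refine Finset.sum_le_sum fun k _ => ?_
  have h1 : (galG J G S v - galG J G S w) k = (2 * π * (k : ℤ) : ℝ) • (v - w) k
      - coef J k (fun t => G (trig J v.ofLp t) - G (trig J w.ofLp t)) := by
    rw [coef_sub k (by fun_prop) (by fun_prop)]
    simp only [galG, PiLp.sub_apply, smul_sub]
    abel
  rw [h1, add_mul]
  refine (norm_sub_le _ _).trans (add_le_add ?_ ?_)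
  · rw [norm_smul, Real.norm_eq_abs]
    exact mul_le_mul_of_nonneg_left (PiLp.norm_apply_le (v - w) k) (abs_nonneg _)
  · refine norm_coef_le h.complex _ fun t _ => (h.lipschitz _ _).trans ?_
    rw [← trig_sub, mul_assoc]
    exact mul_le_mul_of_nonneg_left (norm_trig_le_card h.complex (v - w) t) h.nonneg

theorem galG_apply [CompleteSpace V] (h : IsNonresonant J K H G Λ B c) (v : FourierLoop V S)
    (k : S) : galG J G S v k = ((2 * π * (k : ℤ) : ℝ) • v k - (2 : ℝ) • K (v k))
      - coef J k fun t => G (trig J v.ofLp t) - (2 : ℝ) • K (trig J v.ofLp t) := by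
  have hGc := h.continuous_G
  rw [coef_sub k (by fun_prop) (by fun_prop)]
  have h1 : (coef J k fun t => (2 : ℝ) • K (trig J v.ofLp t)) = (2 : ℝ) • K (v k) := by
    have h2 : (fun t => (2 : ℝ) • K (trig J v.ofLp t))
        = trig J (fun k : S => ((2 : ℝ) • K) (v k)) := by
      ext1 t
      rw [← trig_comm (K := (2 : ℝ) • K) (by simp [h.comm])]
      rfl
    rw [h2, coef_trig h.complex]
    rfl
  rw [h1]
  simp only [galG]
  abel

theorem sum_norm_sq_coef_bounded_le [CompleteSpace V] (h : IsNonresonant J K H G Λ B c)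
    {x : ℝ → V} (hx : Continuous x) :
    ∑ k : S, ‖coef J k fun t => G (x t) - (2 : ℝ) • K (x t)‖ ^ 2 ≤ B ^ 2 := by
  have hGc := h.continuous_G
  refine (sum_norm_sq_coef_le h.complex (by fun_prop) S).trans ?_
  have : ∫ t in (0 : ℝ)..1, ‖G (x t) - (2 : ℝ) • K (x t)‖ ^ 2 ≤ ∫ _ in (0 : ℝ)..1, B ^ 2 :=
    intervalIntegral.integral_mono_on zero_le_one
      (Continuous.intervalIntegrable (by fun_prop) _ _) intervalIntegrable_const
      fun t _ => pow_le_pow_left₀ (norm_nonneg _) (h.bounded _) 2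
  simpa using this

theorem exists_coercive_galG [CompleteSpace V] (h : IsNonresonant J K H G Λ B c) :
    ∀ v : FourierLoop V S, c * ‖v‖ - B ≤ ‖galG J G S v‖ := by
  intro v
  set u : FourierLoop V S := WithLp.toLp 2 fun k : S =>
    coef J k fun t => G (trig J v.ofLp t) - (2 : ℝ) • K (trig J v.ofLp t)
  set d : FourierLoop V S := WithLp.toLp 2 fun k : S =>
    (2 * π * (k : ℤ) : ℝ) • v k - (2 : ℝ) • K (v k)
  have hB : 0 ≤ B := (norm_nonneg _).trans (h.bounded 0)
  have h1 : galG J G S v = d - u := by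
    ext1 k
    exact galG_apply h v k
  have h2 : ‖u‖ ≤ B := by
    rw [← sq_le_sq₀ (norm_nonneg _) hB, PiLp.norm_sq_eq_of_L2]
    exact sum_norm_sq_coef_bounded_le h (continuous_trig _)
  have h3 : c * ‖v‖ ≤ ‖d‖ := by
    rw [← sq_le_sq₀ (mul_nonneg h.pos.le (norm_nonneg _)) (norm_nonneg _), mul_pow,
      PiLp.norm_sq_eq_of_L2, PiLp.norm_sq_eq_of_L2, Finset.mul_sum]
    refine Finset.sum_le_sum fun k _ => ?_
    rw [← mul_pow]
    refine pow_le_pow_left₀ (mul_nonneg h.pos.le (norm_nonneg _)) ?_ 2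
    refine le_trans ?_ (h.nonresonant k (v k))
    have h4 : 0 ≤ |((k : ℤ) : ℝ)| * (c * ‖v k‖) :=
      mul_nonneg (abs_nonneg _) (mul_nonneg h.pos.le (norm_nonneg _))
    linarith
  rw [h1]
  have := norm_sub_norm_le d u
  linarith

/-- Uniform `H¹` bounds for critical points of the action. -/
theorem sum_norm_sq_le_of_galG_eq_zero [CompleteSpace V] (h : IsNonresonant J K H G Λ B c)
    {v : FourierLoop V S} (hv : galG J G S v = 0) :
    ∑ k : S, (1 + |((k : ℤ) : ℝ)|) ^ 2 * ‖v k‖ ^ 2 ≤ (B / c) ^ 2 := by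
  have hc := h.pos
  rw [div_pow, le_div_iff₀ (by positivity), Finset.sum_mul]
  refine le_trans ?_ (sum_norm_sq_coef_bounded_le (S := S) h
    (continuous_trig (J := J) v.ofLp))
  refine Finset.sum_le_sum fun k _ => ?_
  have h1 := galG_apply h v k
  rw [hv] at h1
  rw [← sub_eq_zero.1 h1.symm, ← mul_pow, ← mul_pow]
  refine pow_le_pow_left₀ (by positivity) ?_ 2
  rw [mul_comm, ← mul_assoc]
  exact h.nonresonant k (v k)

theorem coef_G_of_galG_eq_zero {v : FourierLoop V S} (hv : galG J G S v = 0) (k : S) :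
    (coef J k fun t => G (trig J v.ofLp t)) = (2 * π * (k : ℤ) : ℝ) • v k := by
  have h1 : galG J G S v k = 0 := by rw [hv]; rfl
  exact (sub_eq_zero.1 h1).symm

theorem galA_of_galG_eq_zero [CompleteSpace V] (h : IsNonresonant J K H G Λ B c)
    {v : FourierLoop V S} (hv : galG J G S v = 0) :
    galA J H S v = ∫ t in (0 : ℝ)..1, (1 / 2 * inner ℝ (G (trig J v.ofLp t)) (trig J v.ofLp t)
      - H (trig J v.ofLp t)) := by
  have hGc := h.continuous_G
  have hHc := h.continuous_H
  rw [intervalIntegral.integral_sub, intervalIntegral.integral_const_mul,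
    ← sum_inner_coef h.complex (by fun_prop), galA]
  · simp only [coef_G_of_galG_eq_zero hv, inner_smul_left, real_inner_self_eq_norm_sq,
      conj_trivial]
    rw [Finset.mul_sum]
    congr 1
    exact Finset.sum_congr rfl fun k _ => by ring
  all_goals exact Continuous.intervalIntegrable (by fun_prop) _ _

/-- If the gradient is linear and nonresonant near the origin, the only critical point whose loop
stays near the origin is the origin. -/
theorem eq_zero_of_galG_eq_zero [CompleteSpace V] (hJ : IsOrthComplex J)
    {K₀ : V →L[ℝ] V} (hK₀ : ∀ v, K₀ (J v) = J (K₀ v)) {δ : ℝ}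
    (hG : ∀ z, ‖z‖ ≤ δ → G z = (2 : ℝ) • K₀ z)
    (hres : ∀ (k : ℤ) v, (2 * π * k : ℝ) • v = (2 : ℝ) • K₀ v → v = 0)
    {v : FourierLoop V S} (hv : galG J G S v = 0)
    (hsmall : ∀ t ∈ Icc (0 : ℝ) 1, ‖trig J v.ofLp t‖ ≤ δ) : v = 0 := by
  ext1 k
  refine hres k (v k) ?_
  rw [← coef_G_of_galG_eq_zero hv k]
  have h1 : (coef J k fun t => G (trig J v.ofLp t))
      = coef J k (trig J (fun k : S => ((2 : ℝ) • K₀) (v k))) := by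
    refine intervalIntegral.integral_congr fun t ht => ?_
    rw [uIcc_of_le zero_le_one] at ht
    simp only
    rw [hG _ (hsmall t ht), ← trig_comm (K := (2 : ℝ) • K₀) (by simp [hK₀])]
    rfl
  rw [h1, coef_trig hJ]
  rfl

end Galerkin

section FourierUniqueness

theorem eq_of_forall_integral_cos_sin_eq_zero {f : ℝ → ℝ} (hf : Continuous f) (h01 : f 0 = f 1)
    (hc : ∀ k : ℤ, k ≠ 0 → ∫ t in (0 : ℝ)..1, f t * cos (2 * π * k * t) = 0)
    (hs : ∀ k : ℤ, k ≠ 0 → ∫ t in (0 : ℝ)..1, f t * sin (2 * π * k * t) = 0)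
    {t : ℝ} (ht : t ∈ Icc (0 : ℝ) 1) : f t = f 0 := by
  have _ : Fact ((0 : ℝ) < 1) := ⟨one_pos⟩
  let F : ℝ → ℂ := fun t => (f t : ℂ)
  have hF : Continuous F := Complex.continuous_ofReal.comp hf
  let g : C(AddCircle (1 : ℝ), ℂ) := ⟨AddCircle.liftIco 1 0 F,
    AddCircle.liftIco_zero_continuous (by simp [F, h01]) hF.continuousOn⟩
  have hg : ∀ k : ℤ, k ≠ 0 → fourierCoeff g k = 0 := fun k hk => by
    change fourierCoeff (AddCircle.liftIco 1 0 F) k = 0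
    rw [fourierCoeff_liftIco_eq, fourierCoeffOn_eq_integral]
    have h1 : ∀ x : ℝ, (fourier (-k) : AddCircle ((0 : ℝ) + 1 - 0) → ℂ) x • F x
        = ((f x * cos (2 * π * k * x) : ℝ) : ℂ)
          - Complex.I * ((f x * sin (2 * π * k * x) : ℝ) : ℂ) := fun x => by
      rw [fourier_coe_apply]
      have : (2 * π * Complex.I * ((-k : ℤ) : ℂ) * x / (((0 : ℝ) + 1 - 0 : ℝ) : ℂ))
          = ((-(2 * π * k * x) : ℝ) : ℂ) * Complex.I := by
        push_cast
        ring
      rw [this, Complex.exp_mul_I, ← Complex.ofReal_cos, ← Complex.ofReal_sin, cos_neg, sin_neg,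
        smul_eq_mul]
      push_cast
      ring
    simp only [h1]
    rw [zero_add, intervalIntegral.integral_sub, intervalIntegral.integral_const_mul,
      intervalIntegral.integral_ofReal, intervalIntegral.integral_ofReal, hc k hk, hs k hk]
    · simp
    all_goals exact Continuous.intervalIntegrable (by fun_prop) _ _
  have hsum : Summable (fourierCoeff g) :=
    (hasSum_single 0 fun k hk => hg k hk).summable
  have hval : ∀ x, g x = fourierCoeff g 0 := fun x => by
    have h1 := has_pointwise_sum_fourier_series_of_summable hsum x
    have h2 := hasSum_single (f := fun i => fourierCoeff g i • (fourier i x : ℂ)) 0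
      fun k hk => by simp [hg k hk]
    simpa using h1.unique h2
  have hIco : ∀ s ∈ Ico (0 : ℝ) 1, f s = f 0 := fun s hs => by
    have h1 : g (s : AddCircle (1 : ℝ)) = F s :=
      AddCircle.liftIco_zero_coe_apply (f := F) hs
    have h2 : g ((0 : ℝ) : AddCircle (1 : ℝ)) = F 0 :=
      AddCircle.liftIco_zero_coe_apply (f := F) (by simp)
    rw [hval] at h1 h2
    exact Complex.ofReal_injective (h1.symm.trans h2)
  rcases eq_or_lt_of_le ht.2 with h | h
  · rw [h, h01]
  · exact hIco t ⟨ht.1, h⟩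

variable {V : Type*} [NormedAddCommGroup V] [InnerProductSpace ℝ V] [CompleteSpace V]
  {J : V →L[ℝ] V}

theorem eq_of_forall_coef_eq_zero (hJ : IsOrthComplex J) {f : ℝ → V} (hf : Continuous f)
    (h01 : f 0 = f 1) (h : ∀ k : ℤ, k ≠ 0 → coef J k f = 0) {t : ℝ} (ht : t ∈ Icc (0 : ℝ) 1) :
    f t = f 0 := by
  have key : ∀ (u : V) (k : ℤ), k ≠ 0 →
      (∫ t in (0 : ℝ)..1, inner ℝ (f t) u * cos (2 * π * k * t))
        + ∫ t in (0 : ℝ)..1, inner ℝ (f t) (J u) * sin (2 * π * k * t) = 0 := fun u k hk => by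
    rw [← intervalIntegral.integral_add (Continuous.intervalIntegrable (by fun_prop) _ _)
      (Continuous.intervalIntegrable (by fun_prop) _ _)]
    have h1 := inner_coef hJ k hf u
    rw [h k hk, inner_zero_left] at h1
    refine Eq.trans (intervalIntegral.integral_congr fun t _ => ?_) h1.symm
    rw [rot_apply, inner_add_right, inner_smul_right, inner_smul_right]
    ring
  have key2 : ∀ (u : V) (k : ℤ), k ≠ 0 →
      (∫ t in (0 : ℝ)..1, inner ℝ (f t) u * cos (2 * π * k * t)) = 0 ∧
        ∫ t in (0 : ℝ)..1, inner ℝ (f t) (J u) * sin (2 * π * k * t) = 0 := fun u k hk => by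
    have h1 := key u k hk
    have h2 := key u (-k) (neg_ne_zero.2 hk)
    have e : ∀ t : ℝ, 2 * π * ((-k : ℤ) : ℝ) * t = -(2 * π * k * t) := fun t => by
      push_cast; ring
    simp only [e, cos_neg, sin_neg, mul_neg, intervalIntegral.integral_neg] at h2
    constructor <;> linarith
  refine ext_inner_right ℝ fun u => ?_
  refine eq_of_forall_integral_cos_sin_eq_zero (f := fun t => inner ℝ (f t) u) (by fun_prop)
    (by rw [h01]) (fun k hk => (key2 u k hk).1) (fun k hk => ?_) ht
  have := (key2 (-J u) k hk).2
  simpa [hJ.sq] using this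

theorem eq_add_integral_of_coef_eq (hJ : IsOrthComplex J) {x f : ℝ → V} (hx : Continuous x)
    (hf : Continuous f) (h01 : x 0 = x 1)
    (h : ∀ k : ℤ, coef J k f = (2 * π * k : ℝ) • coef J k x) {t : ℝ} (ht : t ∈ Icc (0 : ℝ) 1) :
    x t = x 0 + ∫ s in (0 : ℝ)..t, J (f s) := by
  set W : ℝ → V := fun t => ∫ s in (0 : ℝ)..t, J (f s) with hW
  have hWd : ∀ t, HasDerivAt W (J (f t)) t := fun t =>
    (show Continuous fun s => J (f s) by fun_prop).integral_hasStrictDerivAt 0 t |>.hasDerivAt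
  have hWc : Continuous W := continuous_iff_continuousAt.2 fun t => (hWd t).continuousAt
  have hW0 : W 0 = 0 := by simp [hW]
  have hW1 : W 1 = 0 := by
    have h0 := h 0
    simp only [coef, Int.cast_zero, mul_zero, zero_mul, neg_zero, rot_zero, zero_smul] at h0
    rw [hW]
    simp only
    rw [J.intervalIntegral_comp_comm (hf.intervalIntegrable _ _), h0, map_zero]
  have hWk : ∀ k : ℤ, coef J k f = (2 * π * k : ℝ) • coef J k W := fun k => by
    have hd : ∀ t, HasDerivAt (fun t => rot J (-(2 * π * k) * t) (W t))
        (J (rot J (-(2 * π * k * t)) (f t)) - (2 * π * k : ℝ) • J (rot J (-(2 * π * k * t)) (W t)))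
        t := fun t => by
      have h1 : HasDerivAt (fun t : ℝ => -(2 * π * k) * t) (-(2 * π * k)) t := by
        simpa using (hasDerivAt_id t).const_mul (-(2 * π * k))
      have h2 := (h1.cos.fun_smul (hWd t)).add (h1.sin.fun_smul
        (J.hasFDerivAt.comp_hasDerivAt t (hWd t)))
      simp only [rot_apply]
      refine h2.congr_deriv ?_
      have e : -(2 * π * k) * t = -(2 * π * k * t) := by ring
      simp only [map_add, map_smul, hJ.sq, Function.comp_apply, e]
      module
    have h2 := intervalIntegral.integral_eq_sub_of_hasDerivAt (a := 0) (b := 1)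
      (fun t _ => hd t) (Continuous.intervalIntegrable (by fun_prop) _ _)
    rw [hW0, hW1, map_zero, map_zero, sub_zero, intervalIntegral.integral_sub
      (Continuous.intervalIntegrable (by fun_prop) _ _)
      (Continuous.intervalIntegrable (by fun_prop) _ _), intervalIntegral.integral_smul,
      J.intervalIntegral_comp_comm (Continuous.intervalIntegrable (by fun_prop) _ _),
      J.intervalIntegral_comp_comm (Continuous.intervalIntegrable (by fun_prop) _ _)] at h2
    have h3 := congrArg J (sub_eq_zero.1 h2)
    rw [map_smul, hJ.sq, hJ.sq, smul_neg, neg_inj] at h3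
    exact h3
  have hz := eq_of_forall_coef_eq_zero hJ (f := fun t => x t - W t) (by fun_prop)
    (by simp [hW0, hW1, h01]) (fun k hk => by
      have hk' : (2 * π * k : ℝ) ≠ 0 := by
        have : (k : ℝ) ≠ 0 := by exact_mod_cast hk
        positivity
      rw [coef_sub k hx hWc, sub_eq_zero]
      exact smul_right_injective V hk' ((h k).symm.trans (hWk k))) ht
  rw [hW0, sub_zero, sub_eq_iff_eq_add] at hz
  exact hz

theorem norm_sub_le_sqrt_of_integral_norm_sq_le {x y : ℝ → V} (hx : ∀ t, HasDerivAt x (y t) t)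
    (hy : Continuous y) {C : ℝ} (hC : ∫ t in (0 : ℝ)..1, ‖y t‖ ^ 2 ≤ C) {s t : ℝ}
    (hs : s ∈ Icc (0 : ℝ) 1) (ht : t ∈ Icc (0 : ℝ) 1) :
    ‖x t - x s‖ ≤ (C + 1) / 2 * √|t - s| := by
  wlog hst : s ≤ t generalizing s t
  · rw [norm_sub_rev, abs_sub_comm]
    exact this ht hs (le_of_not_ge hst)
  rcases eq_or_lt_of_le hst with rfl | hlt
  · simp
  rw [abs_of_pos (sub_pos.2 hlt)]
  set l := √(t - s) with hl
  have hl0 : 0 < l := Real.sqrt_pos.2 (sub_pos.2 hlt)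
  have hl2 : t - s = l ^ 2 := (Real.sq_sqrt (sub_pos.2 hlt).le).symm
  rw [← intervalIntegral.integral_eq_sub_of_hasDerivAt (fun t _ => hx t)
    (hy.intervalIntegrable _ _)]
  refine (intervalIntegral.norm_integral_le_integral_norm hst).trans ?_
  have h1 : ∫ r in s..t, ‖y r‖ ≤ ∫ r in s..t, (l / 2 * ‖y r‖ ^ 2 + 1 / (2 * l)) := by
    refine intervalIntegral.integral_mono_on hst (Continuous.intervalIntegrable (by fun_prop) _ _)
      (Continuous.intervalIntegrable (by fun_prop) _ _) fun r _ => ?_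
    have : l / 2 * ‖y r‖ ^ 2 + 1 / (2 * l) - ‖y r‖ = (l * ‖y r‖ - 1) ^ 2 / (2 * l) := by
      field_simp
      ring
    have h2 : 0 ≤ (l * ‖y r‖ - 1) ^ 2 / (2 * l) := by positivity
    linarith
  refine h1.trans ?_
  rw [intervalIntegral.integral_add (Continuous.intervalIntegrable (by fun_prop) _ _)
    (Continuous.intervalIntegrable (by fun_prop) _ _), intervalIntegral.integral_const_mul,
    intervalIntegral.integral_const, smul_eq_mul, hl2]
  have h3 : ∫ r in s..t, ‖y r‖ ^ 2 ≤ C := by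
    refine le_trans ?_ hC
    refine intervalIntegral.integral_mono_interval hs.1 hst ht.2
      (ae_of_all _ fun _ => by positivity) (Continuous.intervalIntegrable (by fun_prop) _ _)
  have h4 : l ^ 2 * (1 / (2 * l)) = l / 2 := by field_simp
  rw [h4]
  nlinarith

end FourierUniqueness

section Compactness

variable {V : Type*} [NormedAddCommGroup V] [InnerProductSpace ℝ V]

theorem tendsto_integral_comp_of_bounded [FiniteDimensional ℝ V] {W : Type*} [NormedAddCommGroup W]
    [NormedSpace ℝ W] {x : ℕ → ℝ → V} {X : ℝ → V} (hx : ∀ m, Continuous (x m))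
    {M : ℝ} (hM : ∀ m, ∀ t ∈ Icc (0 : ℝ) 1, ‖x m t‖ ≤ M)
    (hlim : ∀ t ∈ Icc (0 : ℝ) 1, Tendsto (fun m => x m t) atTop (𝓝 (X t)))
    {Ψ : ℝ → V → W} (hΨ : Continuous (Function.uncurry Ψ)) :
    Tendsto (fun m => ∫ t in (0 : ℝ)..1, Ψ t (x m t)) atTop
      (𝓝 (∫ t in (0 : ℝ)..1, Ψ t (X t))) := by
  have hIoc : ∀ t ∈ uIoc (0 : ℝ) 1, t ∈ Icc (0 : ℝ) 1 := fun t ht => by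
    rw [uIoc_of_le zero_le_one] at ht
    exact Ioc_subset_Icc_self ht
  obtain ⟨C, hC⟩ := ((isCompact_Icc (a := (0 : ℝ)) (b := 1)).prod
    (isCompact_closedBall (0 : V) M)).exists_bound_of_continuousOn hΨ.continuousOn
  refine intervalIntegral.tendsto_integral_filter_of_dominated_convergence (fun _ => C)
    (Eventually.of_forall fun m => ?_) (Eventually.of_forall fun m => ae_of_all _ fun t ht => ?_)
    (Continuous.intervalIntegrable (by fun_prop) _ _) (ae_of_all _ fun t ht => ?_)
  · have := hx m
    exact (hΨ.comp (continuous_id.prodMk this)).aestronglyMeasurable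
  · exact hC (t, x m t) ⟨hIoc t ht, by simpa using hM m t (hIoc t ht)⟩
  · exact ((hΨ.tendsto (t, X t)).comp (tendsto_const_nhds.prodMk_nhds (hlim t (hIoc t ht))))

variable {J K : V →L[ℝ] V} {H : V → ℝ} {G : V → V} {Λ B c : ℝ}

/-- Critical points of the action functional on finite dimensional loop spaces, with modes from `-N`
to `N + 1` and with uniformly bounded action, converge to a periodic orbit. -/
theorem exists_periodic_orbit_of_galerkin [FiniteDimensional ℝ V]
    (h : IsNonresonant J K H G Λ B c)
    {K₀ : V →L[ℝ] V} (hK₀ : ∀ v, K₀ (J v) = J (K₀ v)) {δ : ℝ} (hδ : 0 < δ)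
    (hG : ∀ z, ‖z‖ ≤ δ → G z = (2 : ℝ) • K₀ z)
    (hres : ∀ (k : ℤ) v, (2 * π * k : ℝ) • v = (2 : ℝ) • K₀ v → v = 0) {C : ℝ}
    (hcrit : ∀ N : ℕ, ∃ v : FourierLoop V (Finset.Icc (-N : ℤ) (N + 1)),
      galG J G _ v = 0 ∧ -H 0 < galA J H _ v ∧ galA J H _ v ≤ C) :
    ∃ x : ℝ → V, Continuous x ∧ (∃ t ∈ Icc (0 : ℝ) 1, x t ≠ 0) ∧ x 0 = x 1 ∧
      (∀ t ∈ Icc (0 : ℝ) 1, x t = x 0 + ∫ s in (0 : ℝ)..t, J (G (x s))) ∧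
      -H 0 ≤ (∫ t in (0 : ℝ)..1, (1 / 2 * inner ℝ (G (x t)) (x t) - H (x t))) ∧
      (∫ t in (0 : ℝ)..1, (1 / 2 * inner ℝ (G (x t)) (x t) - H (x t))) ≤ C := by
  have hJ := h.complex
  have hGc := h.continuous_G
  have hHc := h.continuous_H
  choose v hv hv1 hv2 using hcrit
  set x : ℕ → ℝ → V := fun N => trig J (v N).ofLp with hxdef
  have hxc : ∀ N, Continuous (x N) := fun N => continuous_trig _
  set D : ℝ := B / c
  set C₁ : ℝ := (2 * π) ^ 2 * D ^ 2 with hC₁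
  have hsum := fun N => sum_norm_sq_le_of_galG_eq_zero h (hv N)
  have hmod : ∀ N, ∀ s ∈ Icc (0 : ℝ) 1, ∀ t ∈ Icc (0 : ℝ) 1,
      ‖x N t - x N s‖ ≤ (C₁ + 1) / 2 * √|t - s| := fun N s hs t ht => by
    refine norm_sub_le_sqrt_of_integral_norm_sq_le (fun t => hasDerivAt_trig hJ _ t) (by fun_prop)
      ?_ hs ht
    simp only [hJ.norm_apply]
    rw [integral_norm_sq_trig hJ]
    refine le_trans ?_ (mul_le_mul_of_nonneg_left (hsum N) (by positivity : 0 ≤ (2 * π) ^ 2))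
    rw [Finset.mul_sum]
    refine Finset.sum_le_sum fun k _ => ?_
    rw [norm_smul, mul_pow, ← mul_assoc, Real.norm_eq_abs, sq_abs, mul_pow]
    gcongr ?_ * _
    gcongr ?_ * ?_
    rw [← sq_abs]
    gcongr
    linarith
  set M : ℝ := |D| + (C₁ + 1) / 2
  have hM : ∀ N, ∀ t ∈ Icc (0 : ℝ) 1, ‖x N t‖ ≤ M := fun N t ht => by
    have h0 : (0 : ℤ) ∈ Finset.Icc (-N : ℤ) (N + 1) := by
      rw [Finset.mem_Icc]; omega
    have h1 : ‖(v N) ⟨0, h0⟩‖ ≤ |D| := by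
      rw [← abs_of_nonneg (norm_nonneg ((v N) ⟨0, h0⟩)), ← sq_le_sq]
      refine le_trans ?_ (hsum N)
      refine le_trans (le_of_eq ?_) (Finset.single_le_sum (fun k _ => by positivity)
        (Finset.mem_univ (⟨0, h0⟩ : Finset.Icc (-N : ℤ) (N + 1))))
      simp
    have h2 : coef J 0 (fun s => x N t - x N s) = x N t - (v N) ⟨0, h0⟩ := by
      rw [coef_sub 0 (by fun_prop) (hxc N), ← coef_trig hJ (v N).ofLp ⟨0, h0⟩]
      congr 1
      simp [coef, rot_zero]
    have h3 : ‖coef J 0 (fun s => x N t - x N s)‖ ≤ (C₁ + 1) / 2 :=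
      norm_coef_le hJ 0 fun s hs => by
        refine (hmod N s hs t ht).trans ?_
        have : √|t - s| ≤ 1 := by
          rw [Real.sqrt_le_one, abs_le]
          constructor <;> linarith [hs.1, hs.2, ht.1, ht.2]
        exact mul_le_of_le_one_right (by positivity) this
    rw [h2] at h3
    calc ‖x N t‖ = ‖(v N) ⟨0, h0⟩ + (x N t - (v N) ⟨0, h0⟩)‖ := by congr 1; abel
      _ ≤ _ := (norm_add_le _ _).trans (add_le_add h1 h3)
  set F : ℕ → BoundedContinuousFunction (Icc (0 : ℝ) 1) V := fun N =>
    BoundedContinuousFunction.mkOfCompact ⟨fun t => x N t, (hxc N).comp continuous_subtype_val⟩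
  have hFx : ∀ N (t : Icc (0 : ℝ) 1), F N t = x N t := fun N t => rfl
  have hcpt : IsCompact (closure (range F)) := by
    refine BoundedContinuousFunction.arzela_ascoli (closedBall (0 : V) M)
      (isCompact_closedBall _ _) _ ?_ ?_
    · rintro _ t ⟨N, rfl⟩
      rw [mem_closedBall_zero_iff, hFx]
      exact hM N t t.2
    · refine equicontinuous_of_continuity_modulus (fun d => (C₁ + 1) / 2 * √|d|) ?_ _ ?_
      · have : Continuous fun d : ℝ => (C₁ + 1) / 2 * √|d| := by fun_prop
        simpa using this.tendsto 0
      · rintro s t ⟨_, N, rfl⟩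
        rw [dist_eq_norm, abs_of_nonneg dist_nonneg, Subtype.dist_eq, Real.dist_eq]
        exact hmod N t t.2 s s.2
  obtain ⟨a, -, σ, hσ, hσlim⟩ := hcpt.tendsto_subseq fun N => subset_closure (mem_range_self N)
  set X : ℝ → V := IccExtend zero_le_one a with hX
  have hXc : Continuous X := a.continuous.Icc_extend'
  have hdist : ∀ m, ∀ t ∈ Icc (0 : ℝ) 1, ‖x (σ m) t - X t‖ ≤ dist (F (σ m)) a := fun m t ht => by
    rw [hX, IccExtend_of_mem _ _ ht, ← dist_eq_norm]
    exact BoundedContinuousFunction.dist_coe_le_dist (f := F (σ m)) (g := a) ⟨t, ht⟩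
  have hdist0 : Tendsto (fun m => dist (F (σ m)) a) atTop (𝓝 0) :=
    tendsto_iff_dist_tendsto_zero.1 hσlim
  have hlim : ∀ t ∈ Icc (0 : ℝ) 1, Tendsto (fun m => x (σ m) t) atTop (𝓝 (X t)) := fun t ht =>
    tendsto_iff_norm_sub_tendsto_zero.2 (squeeze_zero (fun _ => norm_nonneg _)
      (fun m => hdist m t ht) hdist0)
  have hX01 : X 0 = X 1 := tendsto_nhds_unique (hlim 0 (by simp))
    ((hlim 1 (by simp)).congr fun m => trig_one _)
  have hact := tendsto_integral_comp_of_bounded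
    (Ψ := fun _ z => 1 / 2 * inner ℝ (G z) z - H z) (fun m => hxc (σ m)) (fun m => hM (σ m)) hlim
    (by fun_prop)
  have hact' : ∀ m, (∫ t in (0 : ℝ)..1, (1 / 2 * inner ℝ (G (x (σ m) t)) (x (σ m) t)
      - H (x (σ m) t))) = galA J H _ (v (σ m)) := fun m =>
    (galA_of_galG_eq_zero h (hv (σ m))).symm
  refine ⟨X, hXc, ?_, hX01, fun t ht => ?_, ?_, ?_⟩
  · by_contra! hcon
    obtain ⟨m, hm⟩ := (hdist0.eventually (gt_mem_nhds hδ)).exists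
    have h0 := eq_zero_of_galG_eq_zero hJ hK₀ hG hres (hv (σ m)) fun t ht => by
      have := hdist m t ht
      rw [hcon t ht, sub_zero] at this
      exact this.trans hm.le
    have := hv1 (σ m)
    rw [h0] at this
    simp [galA, trig] at this
  · refine eq_add_integral_of_coef_eq hJ hXc (by fun_prop) hX01 (fun k => ?_) ht
    have h1 := tendsto_integral_comp_of_bounded
      (Ψ := fun t z => rot J (-(2 * π * k * t)) (G z)) (fun m => hxc (σ m)) (fun m => hM (σ m)) hlim
      (by fun_prop)
    have h2 := tendsto_integral_comp_of_bounded
      (Ψ := fun t z => rot J (-(2 * π * k * t)) z) (fun m => hxc (σ m)) (fun m => hM (σ m)) hlim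
      (by fun_prop)
    refine tendsto_nhds_unique h1 ((h2.const_smul (2 * π * k : ℝ)).congr' ?_)
    filter_upwards [eventually_ge_atTop k.natAbs] with m hm
    have hk : k ∈ Finset.Icc (-(σ m) : ℤ) (σ m + 1) := by
      have := hσ.le_apply (x := m)
      rw [Finset.mem_Icc]
      omega
    have h3 := coef_G_of_galG_eq_zero (hv (σ m)) ⟨k, hk⟩
    have h4 := coef_trig hJ (v (σ m)).ofLp ⟨k, hk⟩
    rw [← h4] at h3
    exact h3.symm
  · exact ge_of_tendsto' hact fun m => (hact' m).symm ▸ (hv1 _).le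
  · exact le_of_tendsto' hact fun m => (hact' m).symm ▸ hv2 _

end Compactness

section Linking

variable {V : Type*} [NormedAddCommGroup V] [InnerProductSpace ℝ V]
  {J K : V →L[ℝ] V} {H : V → ℝ} {G : V → V} {Λ B c : ℝ} {S : Finset ℤ}

theorem integral_inner_comm_trig [CompleteSpace V] (hJ : IsOrthComplex J) {L : V →L[ℝ] V}
    (hL : ∀ v, L (J v) = J (L v)) (v : FourierLoop V S) :
    ∫ t in (0 : ℝ)..1, inner ℝ (L (trig J v.ofLp t)) (trig J v.ofLp t)
      = ∑ k, inner ℝ (L (v k)) (v k) := by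
  simp only [trig_comm hL]
  exact integral_inner_trig hJ _ _

theorem galA_le_of_quadratic_le [CompleteSpace V] (hJ : IsOrthComplex J) (hH : Continuous H)
    {L : V →L[ℝ] V} (hL : ∀ v, L (J v) = J (L v)) {C : ℝ} (hlow : ∀ z, inner ℝ (L z) z - C ≤ H z)
    (v : FourierLoop V S) :
    galA J H S v ≤ ∑ k : S, (π * (k : ℤ) * ‖v k‖ ^ 2 - inner ℝ (L (v k)) (v k)) + C := by
  rw [Finset.sum_sub_distrib, ← integral_inner_comm_trig hJ hL v, galA]
  have hT : Continuous (trig J v.ofLp) := continuous_trig _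
  have hc : Continuous fun t => inner ℝ (L (trig J v.ofLp t)) (trig J v.ofLp t) :=
    (L.continuous.comp hT).inner hT
  have h1 : ∫ t in (0 : ℝ)..1, (inner ℝ (L (trig J v.ofLp t)) (trig J v.ofLp t) - C)
      ≤ ∫ t in (0 : ℝ)..1, H (trig J v.ofLp t) :=
    intervalIntegral.integral_mono_on zero_le_one
      ((hc.sub continuous_const).intervalIntegrable _ _) ((hH.comp hT).intervalIntegrable _ _)
      fun t _ => hlow _
  rw [intervalIntegral.integral_sub (hc.intervalIntegrable _ _)
    (continuous_const.intervalIntegrable _ _), intervalIntegral.integral_const] at h1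
  simp only [sub_zero, one_smul] at h1
  linarith

theorem le_galA_of_le_quadratic [CompleteSpace V] (hJ : IsOrthComplex J) (hH : Continuous H)
    {L : V →L[ℝ] V} (hL : ∀ v, L (J v) = J (L v)) {C : ℝ} (v : FourierLoop V S)
    (hup : ∀ t ∈ Icc (0 : ℝ) 1, H (trig J v.ofLp t)
      ≤ C + inner ℝ (L (trig J v.ofLp t)) (trig J v.ofLp t)) :
    ∑ k : S, (π * (k : ℤ) * ‖v k‖ ^ 2 - inner ℝ (L (v k)) (v k)) - C ≤ galA J H S v := by
  rw [Finset.sum_sub_distrib, ← integral_inner_comm_trig hJ hL v, galA]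
  have hT : Continuous (trig J v.ofLp) := continuous_trig _
  have hc : Continuous fun t => inner ℝ (L (trig J v.ofLp t)) (trig J v.ofLp t) :=
    (L.continuous.comp hT).inner hT
  have h1 : ∫ t in (0 : ℝ)..1, H (trig J v.ofLp t)
      ≤ ∫ t in (0 : ℝ)..1, (C + inner ℝ (L (trig J v.ofLp t)) (trig J v.ofLp t)) :=
    intervalIntegral.integral_mono_on zero_le_one
      ((hH.comp hT).intervalIntegrable _ _) ((continuous_const.add hc).intervalIntegrable _ _) hup
  rw [intervalIntegral.integral_add (continuous_const.intervalIntegrable _ _)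
    (hc.intervalIntegrable _ _), intervalIntegral.integral_const] at h1
  simp only [sub_zero, one_smul] at h1
  linarith

theorem exists_forall_sub_mul_sq_le {m : ℝ} (a b : ℝ) (hm : 0 < m) : ∃ r : ℝ, ∀ x, r ≤ x →
    a - m * x ^ 2 ≤ b := by
  refine ⟨|a - b| / m + 1, fun x hx => ?_⟩
  have h0 : 0 ≤ |a - b| / m := by positivity
  have h1 : |a - b| / m ≤ x ^ 2 := by nlinarith
  rw [div_le_iff₀ hm] at h1
  linarith [le_abs_self (a - b)]

theorem galA_le_sub_mul_norm_sq [CompleteSpace V] (hJ : IsOrthComplex J) (hH : Continuous H)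
    {L : V →L[ℝ] V} (hL : ∀ v, L (J v) = J (L v)) {C : ℝ} (hlow : ∀ z, inner ℝ (L z) z - C ≤ H z)
    {m : ℝ} {v : FourierLoop V S}
    (hv : ∀ k : S, π * (k : ℤ) * ‖v k‖ ^ 2 + m * ‖v k‖ ^ 2 ≤ inner ℝ (L (v k)) (v k)) :
    galA J H S v ≤ C - m * ‖v‖ ^ 2 := by
  have h1 := galA_le_of_quadratic_le hJ hH hL hlow v
  have h2 : ∑ k : S, (π * (k : ℤ) * ‖v k‖ ^ 2 - inner ℝ (L (v k)) (v k))
      ≤ ∑ k : S, -(m * ‖v k‖ ^ 2) := Finset.sum_le_sum fun k _ => by linarith [hv k]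
  rw [Finset.sum_neg_distrib, ← Finset.mul_sum, ← PiLp.norm_sq_eq_of_L2] at h2
  linarith

theorem add_mul_norm_sq_le_galA [CompleteSpace V] (hJ : IsOrthComplex J) (hH : Continuous H)
    {L : V →L[ℝ] V} (hL : ∀ v, L (J v) = J (L v)) {C : ℝ} {m : ℝ} {v : FourierLoop V S}
    (hup : ∀ t ∈ Icc (0 : ℝ) 1, H (trig J v.ofLp t)
      ≤ C + inner ℝ (L (trig J v.ofLp t)) (trig J v.ofLp t))
    (hv : ∀ k : S, inner ℝ (L (v k)) (v k) + m * ‖v k‖ ^ 2 ≤ π * (k : ℤ) * ‖v k‖ ^ 2) :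
    -C + m * ‖v‖ ^ 2 ≤ galA J H S v := by
  have h1 := le_galA_of_le_quadratic hJ hH hL v hup
  have h2 : ∑ k : S, m * ‖v k‖ ^ 2
      ≤ ∑ k : S, (π * (k : ℤ) * ‖v k‖ ^ 2 - inner ℝ (L (v k)) (v k)) :=
    Finset.sum_le_sum fun k _ => by linarith [hv k]
  rw [← Finset.mul_sum, ← PiLp.norm_sq_eq_of_L2] at h2
  linarith

theorem galA_le_of_le [CompleteSpace V] (hH : Continuous H) {C : ℝ} (hmin : ∀ z, C ≤ H z)
    {v : FourierLoop V S} (hv : ∀ k : S, π * (k : ℤ) * ‖v k‖ ^ 2 ≤ 0) : galA J H S v ≤ -C := by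
  have h1 : ∫ _ in (0 : ℝ)..1, C ≤ ∫ t in (0 : ℝ)..1, H (trig J v.ofLp t) :=
    intervalIntegral.integral_mono_on zero_le_one (Continuous.intervalIntegrable (by fun_prop) _ _)
      (Continuous.intervalIntegrable (by fun_prop) _ _) fun t _ => hmin _
  have h2 : ∑ k : S, π * (k : ℤ) * ‖v k‖ ^ 2 ≤ 0 := Finset.sum_nonpos fun k _ => hv k
  rw [intervalIntegral.integral_const] at h1
  simp only [sub_zero, one_smul] at h1
  rw [galA]
  linarith

/-- The part of a Fourier loop with modes at least `j`. -/
def FourierLoop.tail (j : ℤ) (v : FourierLoop V S) : FourierLoop V S :=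
  WithLp.toLp 2 fun k : S => if j ≤ k then v k else 0

theorem FourierLoop.continuous_tail {V : Type*} [NormedAddCommGroup V] {S : Finset ℤ} (j : ℤ) :
    Continuous (FourierLoop.tail j : FourierLoop V S → FourierLoop V S) := by
  unfold FourierLoop.tail
  refine (PiLp.continuous_toLp 2 _).comp (continuous_pi fun k => ?_)
  split_ifs <;> fun_prop

variable (S) in
/-- Fourier loops with modes at most `1`, whose first mode is a multiple of `e`. -/
def directionSubspace (e : V) : Submodule ℝ (FourierLoop V S) where
  carrier := {x | ∀ k : S, (1 < (k : ℤ) → x k = 0) ∧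
    ((k : ℤ) = 1 → x k = (inner ℝ (x k) e : ℝ) • e)}
  add_mem' := fun {x y} hx hy k => by
    refine ⟨fun hk => ?_, fun hk => ?_⟩
    · rw [PiLp.add_apply, (hx k).1 hk, (hy k).1 hk, add_zero]
    · rw [PiLp.add_apply, inner_add_left, add_smul, ← (hx k).2 hk, ← (hy k).2 hk]
  zero_mem' := fun k => by simp
  smul_mem' := fun a x hx k => by
    refine ⟨fun hk => ?_, fun hk => ?_⟩
    · rw [PiLp.smul_apply, (hx k).1 hk, smul_zero]
    · rw [PiLp.smul_apply, real_inner_smul_left, mul_smul, ← (hx k).2 hk]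

variable (V S) in
/-- Fourier loops with modes at most `1`. -/
def lowSubspace : Submodule ℝ (FourierLoop V S) where
  carrier := {x | ∀ k : S, 1 < (k : ℤ) → x k = 0}
  add_mem' := fun {x y} hx hy k hk => by rw [PiLp.add_apply, hx k hk, hy k hk, add_zero]
  zero_mem' := fun k _ => rfl
  smul_mem' := fun a x hx k hk => by rw [PiLp.smul_apply, hx k hk, smul_zero]

/-- The part of a Fourier loop with nonpositive modes, plus `s` times the loop with first mode
`e`. -/
def FourierLoop.lowAdd (e : V) (s : ℝ) (x : FourierLoop V S) : FourierLoop V S :=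
  WithLp.toLp 2 fun k : S => if (k : ℤ) ≤ 0 then x k else if (k : ℤ) = 1 then s • e else 0

theorem FourierLoop.lowAdd_mem {e : V} (he : ‖e‖ = 1) (s : ℝ) (x : FourierLoop V S) :
    x.lowAdd e s ∈ directionSubspace S e := fun k => by
  refine ⟨fun hk => ?_, fun hk => ?_⟩
  · simp [lowAdd, hk.ne', (zero_lt_one.trans hk).not_ge]
  · simp [lowAdd, hk, real_inner_smul_left, he]

theorem FourierLoop.continuous_lowAdd (e : V) {s : FourierLoop V S → ℝ} (hs : Continuous s) :
    Continuous fun x : FourierLoop V S => x.lowAdd e (s x) := by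
  unfold FourierLoop.lowAdd
  refine (PiLp.continuous_toLp 2 _).comp (continuous_pi fun k => ?_)
  split_ifs <;> fun_prop

theorem FourierLoop.norm_tail_of_mem {e : V} (he : ‖e‖ = 1) (h1 : (1 : ℤ) ∈ S)
    {y : FourierLoop V S} (hy : y ∈ directionSubspace S e) (h0 : 0 ≤ inner ℝ (y ⟨1, h1⟩) e) :
    ‖y.tail 1‖ = inner ℝ (y ⟨1, h1⟩) e := by
  rw [← sq_eq_sq₀ (norm_nonneg _) h0, PiLp.norm_sq_eq_of_L2, Finset.sum_eq_single ⟨1, h1⟩]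
  · have := (hy ⟨1, h1⟩).2 rfl
    simp only [tail, le_refl, if_true]
    rw [this, norm_smul, he, mul_one, Real.norm_eq_abs, sq_abs, ← this]
  · intro k _ hk
    have hk' : (k : ℤ) ≠ 1 := fun h => hk (Subtype.ext h)
    by_cases h2 : 1 ≤ (k : ℤ)
    · simp [tail, h2, (hy k).1 (lt_of_le_of_ne h2 hk'.symm)]
    · simp [tail, h2]
  · simp

theorem exists_galG_eq_zero_of_linking [FiniteDimensional ℝ V] (h : IsNonresonant J K H G Λ B c)
    {Y : Submodule ℝ (FourierLoop V S)} {Ψ : FourierLoop V S → Y} (hΨ : Continuous Ψ) {D : Set Y}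
    (hD : IsClosed D) {p : Y} (hp : p ∈ D) (hΨι : ∀ y ∈ D, Ψ y = y - p) {b b₁ C m : ℝ}
    (hb : b < b₁) (hfront : ∀ y ∈ frontier D, galA J H S y ≤ b) (hm : 0 < m)
    (hbound : ∀ y : Y, galA J H S y ≤ C - m * ‖y‖ ^ 2)
    (hlink : ∀ x, Ψ x = 0 → b₁ ≤ galA J H S x) :
    ∃ v : FourierLoop V S, galG J G S v = 0 ∧ b < galA J H S v ∧ galA J H S v ≤ C := by
  obtain ⟨L, hL0, hL⟩ := exists_lipschitz_galG (S := S) h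
  obtain ⟨r, hr⟩ := exists_forall_sub_mul_sq_le C b hm
  have hsup : ∀ y : Y, galA J H S y ≤ C := fun y =>
    (hbound y).trans (sub_le_self _ (by positivity))
  obtain ⟨v, hv0, hv1, hv2⟩ := exists_critical_point_of_linking (hasFDerivAt_galA h) hL hL0 h.pos
    (exists_coercive_galG h) continuous_subtype_val hΨ hD hp hΨι hb hfront
    (fun y _ hy => (hbound y).trans (hr _ hy)) (fun y _ => hsup y) hlink
  exact ⟨v, hv0, hb.trans_le hv1, hv2⟩

theorem exists_galG_eq_zero_of_direction [FiniteDimensional ℝ V]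
    (h : IsNonresonant J K H G Λ B c) (h1 : (1 : ℤ) ∈ S) {e : V} (he : ‖e‖ = 1) {C κ₀ : ℝ}
    (hκ₀ : 0 < κ₀) (hK : ∀ v, κ₀ * ‖v‖ ^ 2 ≤ inner ℝ (K v) v) (hKe : π < inner ℝ (K e) e)
    (hlow : ∀ z, inner ℝ (K z) z - C ≤ H z) (hmin : ∀ z, H 0 ≤ H z)
    {K₀ : V →L[ℝ] V} (hK₀c : ∀ v, K₀ (J v) = J (K₀ v)) {δ μ : ℝ} (hδ : 0 < δ)
    (hloc : ∀ z, ‖z‖ ≤ δ → H z = H 0 + inner ℝ (K₀ z) z) (hμ : μ < π)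
    (hK₀ : ∀ v, inner ℝ (K₀ v) v ≤ μ * ‖v‖ ^ 2) :
    ∃ v : FourierLoop V S, galG J G S v = 0 ∧ -H 0 < galA J H S v ∧ galA J H S v ≤ C := by
  have hHc := h.continuous_H
  set f : directionSubspace S e → ℝ := fun y => inner ℝ ((y : FourierLoop V S) ⟨1, h1⟩) e
  have hf : Continuous f :=
    ((PiLp.continuous_apply 2 _ _).comp continuous_subtype_val).inner continuous_const
  set m : ℝ := min (inner ℝ (K e) e - π) κ₀
  have hm : 0 < m := lt_min (by linarith) hκ₀
  set β : ℝ := δ / (S.card + 1)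
  have hβ : 0 < β := by positivity
  have hβδ : S.card * β ≤ δ := by
    have : (S.card + 1) * β = δ := by simp only [β]; field_simp
    nlinarith
  have hb : 0 < (π - μ) * β ^ 2 := mul_pos (by linarith) (by positivity)
  have hbound : ∀ y : directionSubspace S e, galA J H S y ≤ C - m * ‖y‖ ^ 2 := fun y => by
    refine galA_le_sub_mul_norm_sq h.complex hHc h.comm hlow fun k => ?_
    rcases lt_trichotomy (k : ℤ) 1 with hk | hk | hk
    · have h2 : π * (k : ℤ) * ‖(y : FourierLoop V S) k‖ ^ 2 ≤ 0 :=
        mul_nonpos_of_nonpos_of_nonneg (mul_nonpos_of_nonneg_of_nonpos pi_pos.le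
          (by exact_mod_cast Int.lt_add_one_iff.1 hk)) (sq_nonneg _)
      have h3 := mul_le_mul_of_nonneg_right (min_le_right (inner ℝ (K e) e - π) κ₀)
        (sq_nonneg ‖(y : FourierLoop V S) k‖)
      linarith [hK ((y : FourierLoop V S) k)]
    · rw [(y.2 k).2 hk, hk]
      set s : ℝ := inner ℝ ((y : FourierLoop V S) k) e
      rw [map_smul, real_inner_smul_left, real_inner_smul_right, norm_smul, he, mul_one,
        Real.norm_eq_abs, sq_abs, ← mul_assoc, ← sq, Int.cast_one, mul_one]
      have h3 := mul_le_mul_of_nonneg_right (min_le_left (inner ℝ (K e) e - π) κ₀) (sq_nonneg s)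
      linarith
    · simp [(y.2 k).1 hk]
  set p : directionSubspace S e := ⟨(0 : FourierLoop V S).lowAdd e β, FourierLoop.lowAdd_mem he _ _⟩
  set Ψ : FourierLoop V S → directionSubspace S e := fun x =>
    ⟨x.lowAdd e (‖x.tail 1‖ - β), x.lowAdd_mem he _⟩
  have hΨ : Continuous Ψ := (FourierLoop.continuous_lowAdd e
      ((FourierLoop.continuous_tail 1).norm.sub continuous_const)).subtype_mk _
  have hp : 0 ≤ f p := by
    simp [f, p, FourierLoop.lowAdd, real_inner_smul_left, he, hβ.le]
  have hΨι : ∀ y : directionSubspace S e, 0 ≤ f y → Ψ y = y - p := fun y hy => by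
    ext1
    change (y : FourierLoop V S).lowAdd e (‖(y : FourierLoop V S).tail 1‖ - β)
      = (y : FourierLoop V S) - (0 : FourierLoop V S).lowAdd e β
    rw [FourierLoop.norm_tail_of_mem he h1 y.2 hy]
    ext1 k
    rw [PiLp.sub_apply]
    rcases lt_trichotomy (k : ℤ) 1 with hk | hk | hk
    · simp [FourierLoop.lowAdd, show (k : ℤ) ≤ 0 by omega]
    · have h2 := (y.2 k).2 hk
      obtain rfl : k = ⟨1, h1⟩ := Subtype.ext hk
      simp [FourierLoop.lowAdd, sub_smul, ← h2]
    · simp [FourierLoop.lowAdd, (y.2 k).1 hk, hk.ne']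
  have hfront : ∀ y : directionSubspace S e, 0 = f y → galA J H S y ≤ -H 0 := fun y hfy => by
    refine galA_le_of_le hHc hmin fun k => ?_
    rcases lt_trichotomy (k : ℤ) 1 with hk | hk | hk
    · exact mul_nonpos_of_nonpos_of_nonneg (mul_nonpos_of_nonneg_of_nonpos pi_pos.le
        (by exact_mod_cast Int.lt_add_one_iff.1 hk)) (sq_nonneg _)
    · obtain rfl : k = ⟨1, h1⟩ := Subtype.ext hk
      rw [(y.2 _).2 rfl]
      change π * _ * ‖f y • e‖ ^ 2 ≤ 0
      simp [← hfy]
    · simp [(y.2 k).1 hk]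
  have hlink : ∀ x : FourierLoop V S, Ψ x = 0 → -H 0 + (π - μ) * β ^ 2 ≤ galA J H S x :=
      fun x hx => by
    have hx' : x.lowAdd e (‖x.tail 1‖ - β) = 0 := congrArg Subtype.val hx
    have hx0 : ∀ k : S, (k : ℤ) ≤ 0 → x k = 0 := fun k hk => by
      have := congrArg (fun z : FourierLoop V S => z k) hx'
      simpa [FourierLoop.lowAdd, hk] using this
    have hxβ : ‖x‖ = β := by
      have h2 : x.tail 1 = x := by
        ext1 k
        by_cases hk : 1 ≤ (k : ℤ)
        · simp [FourierLoop.tail, hk]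
        · simp [FourierLoop.tail, hk, hx0 k (by omega)]
      have h3 := congrArg (fun z : FourierLoop V S => z ⟨1, h1⟩) hx'
      have he0 : e ≠ 0 := fun h => by simp [h] at he
      rw [h2] at h3
      simpa [FourierLoop.lowAdd, he0, sub_eq_zero] using h3
    rw [← hxβ]
    refine add_mul_norm_sq_le_galA h.complex hHc hK₀c (fun t _ => (hloc _ ?_).le) fun k => ?_
    · refine (norm_trig_le_card h.complex x t).trans ?_
      rw [hxβ]
      exact hβδ
    · by_cases hk : (k : ℤ) ≤ 0
      · simp [hx0 k hk]
      · have hk1 : (1 : ℝ) ≤ (k : ℤ) := by exact_mod_cast Int.not_le.1 hk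
        have h2 : π * ‖x k‖ ^ 2 ≤ π * (k : ℤ) * ‖x k‖ ^ 2 := by
          gcongr
          exact le_mul_of_one_le_right pi_pos.le hk1
        linarith [hK₀ (x k)]
  exact exists_galG_eq_zero_of_linking h hΨ (isClosed_le continuous_const hf) hp hΨι
    (by linarith : -H 0 < -H 0 + (π - μ) * β ^ 2)
    (fun y hy => hfront y (frontier_le_subset_eq continuous_const hf hy)) hm hbound hlink

end Linking

section LowLinking

variable {V : Type*} [NormedAddCommGroup V] [InnerProductSpace ℝ V]
  {J K : V →L[ℝ] V} {H : V → ℝ} {G : V → V} {Λ B c : ℝ} {S : Finset ℤ}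

/-- The part of a Fourier loop with modes at most `1`, minus `s` times the loop with first mode
`e`. -/
def FourierLoop.lowSub (e : V) (s : ℝ) (x : FourierLoop V S) : FourierLoop V S :=
  WithLp.toLp 2 fun k : S => if (k : ℤ) ≤ 0 then x k else if (k : ℤ) = 1 then x k - s • e else 0

theorem FourierLoop.lowSub_mem (e : V) (s : ℝ) (x : FourierLoop V S) :
    x.lowSub e s ∈ lowSubspace V S := fun k hk => by
  simp [lowSub, hk.ne', (zero_lt_one.trans hk).not_ge]

theorem FourierLoop.continuous_lowSub (e : V) {s : FourierLoop V S → ℝ} (hs : Continuous s) :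
    Continuous fun x : FourierLoop V S => x.lowSub e (s x) := by
  unfold FourierLoop.lowSub
  refine (PiLp.continuous_toLp 2 _).comp (continuous_pi fun k => ?_)
  split_ifs <;> fun_prop

theorem FourierLoop.norm_sq_eq_add_norm_tail_sq {V : Type*} [NormedAddCommGroup V]
    {S : Finset ℤ} (h1 : (1 : ℤ) ∈ S) {x : FourierLoop V S}
    (hx : ∀ k : S, (k : ℤ) ≤ 0 → x k = 0) : ‖x‖ ^ 2 = ‖x ⟨1, h1⟩‖ ^ 2 + ‖x.tail 2‖ ^ 2 := by
  rw [← sub_eq_iff_eq_add, PiLp.norm_sq_eq_of_L2, PiLp.norm_sq_eq_of_L2,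
    ← Finset.sum_sub_distrib, Finset.sum_eq_single ⟨1, h1⟩]
  · simp [tail]
  · intro k _ hk
    have hk' : (k : ℤ) ≠ 1 := fun h => hk (Subtype.ext h)
    by_cases h2 : 2 ≤ (k : ℤ)
    · simp [tail, h2]
    · simp [tail, h2, hx k (by omega)]
  · simp

theorem exists_galG_eq_zero_of_low [FiniteDimensional ℝ V]
    (h : IsNonresonant J K H G Λ B c) (h1 : (1 : ℤ) ∈ S) {e : V} (he : ‖e‖ = 1) {C κ : ℝ}
    (hκ : π < κ) (hK : ∀ v, κ * ‖v‖ ^ 2 ≤ inner ℝ (K v) v)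
    (hlow : ∀ z, inner ℝ (K z) z - C ≤ H z)
    {K₀ : V →L[ℝ] V} (hK₀c : ∀ v, K₀ (J v) = J (K₀ v)) {δ μ : ℝ} (hδ : 0 < δ)
    (hloc : ∀ z, ‖z‖ ≤ δ → H z = H 0 + inner ℝ (K₀ z) z) (hμ : μ < 2 * π)
    (hK₀ : ∀ v, inner ℝ (K₀ v) v ≤ μ * ‖v‖ ^ 2) (hK₀e : inner ℝ (K₀ e) e < π)
    (hup : ∀ z, H z ≤ H 0 + μ * ‖z‖ ^ 2) :
    ∃ v : FourierLoop V S, galG J G S v = 0 ∧ -H 0 < galA J H S v ∧ galA J H S v ≤ C := by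
  have hHc := h.continuous_H
  set m : ℝ := min (π - inner ℝ (K₀ e) e) (2 * π - μ)
  have hm : 0 < m := lt_min (by linarith) (by linarith)
  set β : ℝ := δ / (S.card + 1)
  have hβ : 0 < β := by positivity
  have hβδ : S.card * β ≤ δ := by
    have : (S.card + 1) * β = δ := by simp only [β]; field_simp
    nlinarith
  have hb : 0 < m * β ^ 2 := by positivity
  have he0 : e ≠ 0 := fun h => by simp [h] at he
  have hbound : ∀ y : lowSubspace V S, galA J H S y ≤ C - (κ - π) * ‖y‖ ^ 2 := fun y => by
    refine galA_le_sub_mul_norm_sq h.complex hHc h.comm hlow fun k => ?_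
    by_cases hk : (k : ℤ) ≤ 1
    · have hk1 : ((k : ℤ) : ℝ) ≤ 1 := by exact_mod_cast hk
      have h2 : π * (k : ℤ) * ‖(y : FourierLoop V S) k‖ ^ 2
          ≤ π * ‖(y : FourierLoop V S) k‖ ^ 2 := by
        gcongr
        exact mul_le_of_le_one_right pi_pos.le hk1
      linarith [hK ((y : FourierLoop V S) k)]
    · simp [y.2 k (not_le.1 hk)]
  set s : FourierLoop V S → ℝ := fun x => √(max 0 (β ^ 2 - ‖x.tail 2‖ ^ 2))
  have hs : Continuous s := Real.continuous_sqrt.comp (continuous_const.max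
    (continuous_const.sub ((FourierLoop.continuous_tail 2).norm.pow 2)))
  set p : lowSubspace V S := ⟨(0 : FourierLoop V S).lowSub e (-β), FourierLoop.lowSub_mem _ _ _⟩
  set Ψ : FourierLoop V S → lowSubspace V S := fun x => ⟨x.lowSub e (s x), x.lowSub_mem _ _⟩
  have hΨ : Continuous Ψ := (FourierLoop.continuous_lowSub e hs).subtype_mk _
  have hΨι : ∀ y : lowSubspace V S, Ψ y = y - p := fun y => by
    ext1
    change (y : FourierLoop V S).lowSub e (s y)
      = (y : FourierLoop V S) - (0 : FourierLoop V S).lowSub e (-β)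
    have hty : (y : FourierLoop V S).tail 2 = 0 := by
      ext1 k
      by_cases hk : 2 ≤ (k : ℤ)
      · simp [FourierLoop.tail, y.2 k (by omega)]
      · simp [FourierLoop.tail, hk]
    have hsy : s y = β := by
      simp only [s, hty, norm_zero]
      rw [zero_pow two_ne_zero, sub_zero, max_eq_right (by positivity), Real.sqrt_sq hβ.le]
    rw [hsy]
    ext1 k
    rw [PiLp.sub_apply]
    rcases lt_trichotomy (k : ℤ) 1 with hk | hk | hk
    · simp [FourierLoop.lowSub, show (k : ℤ) ≤ 0 by omega]
    · simp [FourierLoop.lowSub, hk]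
    · simp [FourierLoop.lowSub, y.2 k hk, hk.ne', show ¬ (k : ℤ) ≤ 0 by omega]
  have hlink : ∀ x : FourierLoop V S, Ψ x = 0 → -H 0 + m * β ^ 2 ≤ galA J H S x :=
      fun x hx => by
    have hx' : x.lowSub e (s x) = 0 := congrArg Subtype.val hx
    have hx0 : ∀ k : S, (k : ℤ) ≤ 0 → x k = 0 := fun k hk => by
      have := congrArg (fun z : FourierLoop V S => z k) hx'
      simpa [FourierLoop.lowSub, hk] using this
    have hx1 : x ⟨1, h1⟩ = s x • e := by
      have h3 := congrArg (fun z : FourierLoop V S => z ⟨1, h1⟩) hx'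
      simpa [FourierLoop.lowSub, sub_eq_zero] using h3
    have hnorm := FourierLoop.norm_sq_eq_add_norm_tail_sq h1 hx0
    have hx2 : ∀ k : S, 2 ≤ (k : ℤ) → μ * ‖x k‖ ^ 2 + (2 * π - μ) * ‖x k‖ ^ 2
        ≤ π * (k : ℤ) * ‖x k‖ ^ 2 := fun k hk => by
      have hk2 : (2 : ℝ) ≤ (k : ℤ) := by exact_mod_cast hk
      have : 2 * π * ‖x k‖ ^ 2 ≤ π * (k : ℤ) * ‖x k‖ ^ 2 := by
        rw [mul_comm 2 π]
        gcongr
      linarith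
    rcases le_total β ‖x.tail 2‖ with hT | hT
    · have hs0 : s x = 0 := by
        simp only [s]
        rw [max_eq_left (by nlinarith), Real.sqrt_zero]
      rw [hs0, zero_smul] at hx1
      have h4 : -H 0 + (2 * π - μ) * ‖x‖ ^ 2 ≤ galA J H S x := by
        refine add_mul_norm_sq_le_galA (L := μ • ContinuousLinearMap.id ℝ V) h.complex hHc
          (by simp) (fun t _ => ?_) fun k => ?_
        · simpa [real_inner_smul_left, real_inner_self_eq_norm_sq] using hup _
        · simp only [smul_apply, ContinuousLinearMap.id_apply,
            real_inner_smul_left, real_inner_self_eq_norm_sq]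
          rcases lt_trichotomy (k : ℤ) 1 with hk | hk | hk
          · simp [hx0 k (by omega)]
          · obtain rfl : k = ⟨1, h1⟩ := Subtype.ext hk
            simp [hx1]
          · exact hx2 k hk
      refine le_trans ?_ h4
      have h5 : β ^ 2 ≤ ‖x‖ ^ 2 := by
        rw [hnorm]
        nlinarith [sq_nonneg ‖x ⟨1, h1⟩‖]
      have h6 : m * β ^ 2 ≤ (2 * π - μ) * ‖x‖ ^ 2 :=
        mul_le_mul (min_le_right _ _) h5 (by positivity) (by linarith)
      linarith
    · have hss : s x ^ 2 = β ^ 2 - ‖x.tail 2‖ ^ 2 := by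
        simp only [s]
        rw [Real.sq_sqrt (le_max_left _ _), max_eq_right]
        nlinarith [norm_nonneg (x.tail 2)]
      have hxβ : ‖x‖ = β := by
        rw [← sq_eq_sq₀ (norm_nonneg _) hβ.le, hnorm, hx1, norm_smul, he, mul_one,
          Real.norm_eq_abs, sq_abs, hss]
        ring
      rw [← hxβ]
      refine add_mul_norm_sq_le_galA h.complex hHc hK₀c (fun t _ => (hloc _ ?_).le) fun k => ?_
      · refine (norm_trig_le_card h.complex x t).trans ?_
        rw [hxβ]
        exact hβδ
      · rcases lt_trichotomy (k : ℤ) 1 with hk | hk | hk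
        · simp [hx0 k (by omega)]
        · obtain rfl : k = ⟨1, h1⟩ := Subtype.ext hk
          rw [hx1, map_smul, real_inner_smul_left, real_inner_smul_right, norm_smul, he, mul_one,
            Real.norm_eq_abs, sq_abs, ← mul_assoc, ← sq, Int.cast_one, mul_one]
          have h3 := mul_le_mul_of_nonneg_right
            (min_le_left (π - inner ℝ (K₀ e) e) (2 * π - μ)) (sq_nonneg (s x))
          linarith
        · have h3 := mul_le_mul_of_nonneg_right
            (min_le_right (π - inner ℝ (K₀ e) e) (2 * π - μ)) (sq_nonneg ‖x k‖)
          linarith [hx2 k hk, hK₀ (x k)]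
  exact exists_galG_eq_zero_of_linking h hΨ (D := univ) isClosed_univ (mem_univ p)
    (fun y _ => hΨι y) (by linarith : -H 0 < -H 0 + m * β ^ 2)
    (fun y hy => by simp at hy) (sub_pos.2 hκ) hbound hlink

end LowLinking

section Ramp

/-- A smoothed version of the function `max 0 s`. -/
def ramp (s : ℝ) : ℝ := ∫ t in (0 : ℝ)..s, smoothTransition t

theorem hasDerivAt_ramp (s : ℝ) : HasDerivAt ramp (smoothTransition s) s :=
  (smoothTransition.continuous.integral_hasStrictDerivAt 0 s).hasDerivAt

theorem contDiff_ramp : ContDiff ℝ ∞ ramp := by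
  rw [contDiff_infty_iff_deriv]
  refine ⟨fun s => (hasDerivAt_ramp s).differentiableAt, ?_⟩
  rw [show deriv ramp = smoothTransition from funext fun s => (hasDerivAt_ramp s).deriv]
  exact smoothTransition.contDiff

theorem monotone_smoothTransition : Monotone smoothTransition := by
  have h : Monotone expNegInvGlue := by
    intro x y hxy
    rcases le_or_gt x 0 with hx | hx
    · rw [expNegInvGlue.zero_of_nonpos hx]
      exact expNegInvGlue.nonneg y
    · have hy := hx.trans_le hxy
      simp only [expNegInvGlue, hx.not_ge, hy.not_ge, if_false]
      gcongr
  intro x y hxy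
  simp only [smoothTransition]
  rw [div_le_div_iff₀ (smoothTransition.pos_denom x) (smoothTransition.pos_denom y)]
  have h1 := h hxy
  have h2 : expNegInvGlue (1 - y) ≤ expNegInvGlue (1 - x) := h (by linarith)
  nlinarith [expNegInvGlue.nonneg x, expNegInvGlue.nonneg (1 - y)]

/-- A smoothed version of the function `max 0 s`, with smoothing on an interval of length `η`. -/
def rampScaled (η s : ℝ) : ℝ := η * ramp (s / η)

variable {η : ℝ}

theorem contDiff_rampScaled : ContDiff ℝ ∞ (rampScaled η) :=
  contDiff_const.mul (contDiff_ramp.comp (contDiff_id.div_const η))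

/-- The derivative of `rampScaled`. -/
def rampSlope (η s : ℝ) : ℝ := smoothTransition (s / η)

theorem hasDerivAt_rampScaled (hη : 0 < η) (s : ℝ) :
    HasDerivAt (rampScaled η) (rampSlope η s) s := by
  have h := ((hasDerivAt_ramp (s / η)).comp s ((hasDerivAt_id s).div_const η)).const_mul η
  refine h.congr_deriv ?_
  rw [rampSlope]
  field_simp

theorem contDiff_rampSlope : ContDiff ℝ ∞ (rampSlope η) :=
  smoothTransition.contDiff.comp (contDiff_id.div_const η)

theorem rampSlope_nonneg (s : ℝ) : 0 ≤ rampSlope η s := smoothTransition.nonneg _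

theorem rampSlope_le_one (s : ℝ) : rampSlope η s ≤ 1 := smoothTransition.le_one _

theorem rampSlope_of_nonpos (hη : 0 < η) {s : ℝ} (hs : s ≤ 0) : rampSlope η s = 0 :=
  smoothTransition.zero_of_nonpos (div_nonpos_of_nonpos_of_nonneg hs hη.le)

theorem rampSlope_of_le (hη : 0 < η) {s : ℝ} (hs : η ≤ s) : rampSlope η s = 1 :=
  smoothTransition.one_of_one_le ((one_le_div hη).2 hs)

theorem monotone_rampSlope (hη : 0 < η) : Monotone (rampSlope η) := fun x y hxy =>
  monotone_smoothTransition (by gcongr)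

theorem rampScaled_zero : rampScaled η 0 = 0 := by simp [rampScaled, ramp]

theorem rampScaled_sub_le (hη : 0 < η) {a b : ℝ} (hab : a ≤ b) :
    rampScaled η b - rampScaled η a ≤ rampSlope η b * (b - a) := by
  have hd := hasDerivAt_rampScaled hη
  refine (convex_Icc a b).image_sub_le_mul_sub_of_deriv_le
    (fun s _ => (hd s).continuousAt.continuousWithinAt)
    (fun s _ => (hd s).differentiableAt.differentiableWithinAt) (fun s hs => ?_) a
    (left_mem_Icc.2 hab) b (right_mem_Icc.2 hab) hab
  rw [(hd s).deriv]
  rw [interior_Icc] at hs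
  exact monotone_rampSlope hη hs.2.le

theorem le_rampScaled_sub (hη : 0 < η) {a b : ℝ} (hab : a ≤ b) :
    rampSlope η a * (b - a) ≤ rampScaled η b - rampScaled η a := by
  have hd := hasDerivAt_rampScaled hη
  refine (convex_Icc a b).mul_sub_le_image_sub_of_le_deriv
    (fun s _ => (hd s).continuousAt.continuousWithinAt)
    (fun s _ => (hd s).differentiableAt.differentiableWithinAt) (fun s hs => ?_) a
    (left_mem_Icc.2 hab) b (right_mem_Icc.2 hab) hab
  rw [(hd s).deriv]
  rw [interior_Icc] at hs
  exact monotone_rampSlope hη hs.1.le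

theorem monotone_rampScaled (hη : 0 < η) : Monotone (rampScaled η) := fun a b hab => by
  have := le_rampScaled_sub hη hab
  nlinarith [mul_nonneg (rampSlope_nonneg (η := η) a) (sub_nonneg.2 hab)]

theorem rampScaled_of_nonpos (hη : 0 < η) {s : ℝ} (hs : s ≤ 0) : rampScaled η s = 0 := by
  have h1 := rampScaled_sub_le hη hs
  rw [rampSlope_of_nonpos hη le_rfl, rampScaled_zero] at h1
  have h2 := monotone_rampScaled hη hs
  rw [rampScaled_zero] at h2
  linarith

theorem rampScaled_nonneg (hη : 0 < η) (s : ℝ) : 0 ≤ rampScaled η s := by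
  rcases le_total s 0 with h | h
  · rw [rampScaled_of_nonpos hη h]
  · have := monotone_rampScaled hη h
    rwa [rampScaled_zero] at this

theorem rampScaled_sub_of_le (hη : 0 < η) {s : ℝ} (hs : η ≤ s) :
    rampScaled η s = rampScaled η η + (s - η) := by
  have h1 := rampScaled_sub_le hη hs
  have h2 := le_rampScaled_sub hη hs
  rw [rampSlope_of_le hη le_rfl] at h2
  rw [rampSlope_of_le hη hs] at h1
  linarith

theorem rampScaled_le (hη : 0 < η) {s : ℝ} (hs : 0 ≤ s) : rampScaled η s ≤ s := by
  have h1 := rampScaled_sub_le hη hs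
  rw [rampScaled_zero] at h1
  nlinarith [rampSlope_le_one (η := η) s]

theorem sub_le_rampScaled (hη : 0 < η) (s : ℝ) : s - η ≤ rampScaled η s := by
  rcases le_total η s with h | h
  · rw [rampScaled_sub_of_le hη h]
    linarith [rampScaled_nonneg hη η]
  · linarith [rampScaled_nonneg hη s]

theorem rampSlope_mul_add_lt (hη : 0 < η) (hη1 : η < 1) {s : ℝ} (hs : rampSlope η s < 1) :
    rampSlope η s * (1 - s) + rampScaled η s < rampScaled η 1 := by
  have hsη : s < η := by
    by_contra! h
    rw [rampSlope_of_le hη h] at hs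
    exact lt_irrefl _ hs
  have h1 := le_rampScaled_sub hη hsη.le
  have h2 := rampScaled_sub_of_le hη hη1.le
  nlinarith

theorem rampSlope_mul_sub_le (hη : 0 < η) {s : ℝ} (hs : 0 ≤ s) :
    rampSlope η s * s - rampScaled η s ≤ η := by
  have h1 := sub_le_rampScaled hη s
  nlinarith [rampSlope_le_one (η := η) s]

/-- A smooth monotone function equal to `0` for `s ≤ s₁` and to `1` for `s ≥ s₂ + η`, with
constant slope `1 / (s₂ - s₁)` between `s₁ + η` and `s₂`. -/
def cutoff (η s₁ s₂ s : ℝ) : ℝ :=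
  (rampScaled η (s - s₁) - rampScaled η (s - s₂)) / (s₂ - s₁)

/-- The derivative of `cutoff`. -/
def cutoffSlope (η s₁ s₂ s : ℝ) : ℝ :=
  (rampSlope η (s - s₁) - rampSlope η (s - s₂)) / (s₂ - s₁)

variable {s₁ s₂ : ℝ}

theorem contDiff_cutoff : ContDiff ℝ ∞ (cutoff η s₁ s₂) :=
  ((contDiff_rampScaled.comp (contDiff_id.sub contDiff_const)).sub
    (contDiff_rampScaled.comp (contDiff_id.sub contDiff_const))).div_const _

theorem hasDerivAt_cutoff (hη : 0 < η) (s : ℝ) :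
    HasDerivAt (cutoff η s₁ s₂) (cutoffSlope η s₁ s₂ s) s := by
  have h := fun a => (hasDerivAt_rampScaled hη (s - a)).comp s ((hasDerivAt_id s).sub_const a)
  refine (((h s₁).sub (h s₂)).div_const (s₂ - s₁)).congr_deriv ?_
  rw [cutoffSlope, mul_one, mul_one]

theorem cutoffSlope_nonneg (hη : 0 < η) (h : s₁ < s₂) (s : ℝ) : 0 ≤ cutoffSlope η s₁ s₂ s :=
  div_nonneg (sub_nonneg.2 (monotone_rampSlope hη (by linarith))) (by linarith)

theorem monotone_cutoff (hη : 0 < η) (h : s₁ < s₂) : Monotone (cutoff η s₁ s₂) :=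
  monotone_of_deriv_nonneg (fun s => (hasDerivAt_cutoff hη s).differentiableAt) fun s => by
    rw [(hasDerivAt_cutoff hη s).deriv]
    exact cutoffSlope_nonneg hη h s

theorem cutoff_of_le (hη : 0 < η) (h : s₁ < s₂) {s : ℝ} (hs : s ≤ s₁) : cutoff η s₁ s₂ s = 0 := by
  rw [cutoff, rampScaled_of_nonpos hη (by linarith), rampScaled_of_nonpos hη (by linarith),
    sub_zero, zero_div]

theorem cutoff_of_ge (hη : 0 < η) (h : s₁ < s₂) {s : ℝ} (hs : s₂ + η ≤ s) :
    cutoff η s₁ s₂ s = 1 := by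
  rw [cutoff, rampScaled_sub_of_le hη (by linarith),
    rampScaled_sub_of_le hη (by linarith : η ≤ s - s₂), div_eq_one_iff_eq (by linarith)]
  ring

theorem cutoff_nonneg (hη : 0 < η) (h : s₁ < s₂) (s : ℝ) : 0 ≤ cutoff η s₁ s₂ s := by
  rcases le_total s s₁ with hs | hs
  · rw [cutoff_of_le hη h hs]
  · rw [← cutoff_of_le hη h le_rfl]
    exact monotone_cutoff hη h hs

theorem cutoff_le_one (hη : 0 < η) (h : s₁ < s₂) (s : ℝ) : cutoff η s₁ s₂ s ≤ 1 := by
  rcases le_total s (s₂ + η) with hs | hs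
  · rw [← cutoff_of_ge hη h le_rfl]
    exact monotone_cutoff hη h hs
  · rw [cutoff_of_ge hη h hs]

theorem cutoffSlope_of_le (hη : 0 < η) (h : s₁ < s₂) {s : ℝ} (hs : s ≤ s₁) :
    cutoffSlope η s₁ s₂ s = 0 := by
  rw [cutoffSlope, rampSlope_of_nonpos hη (by linarith), rampSlope_of_nonpos hη (by linarith),
    sub_zero, zero_div]

theorem cutoffSlope_of_ge (hη : 0 < η) (h : s₁ < s₂) {s : ℝ} (hs : s₂ + η ≤ s) :
    cutoffSlope η s₁ s₂ s = 0 := by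
  rw [cutoffSlope, rampSlope_of_le hη (by linarith),
    rampSlope_of_le hη (by linarith : η ≤ s - s₂), sub_self, zero_div]

theorem cutoff_trichotomy (hη : 0 < η) (h : s₁ < s₂) (s : ℝ) :
    cutoff η s₁ s₂ s ≤ η / (s₂ - s₁) ∨ 1 - η / (s₂ - s₁) ≤ cutoff η s₁ s₂ s ∨
      cutoffSlope η s₁ s₂ s = 1 / (s₂ - s₁) := by
  have h0 : 0 < s₂ - s₁ := by linarith
  rcases le_total s (s₁ + η) with h1 | h1
  · left
    rw [cutoff]
    gcongr
    have h2 := monotone_rampScaled hη (show s - s₁ ≤ η by linarith)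
    linarith [rampScaled_le hη hη.le, rampScaled_nonneg hη (s - s₂)]
  · rcases le_total s₂ s with h2 | h2
    · right; left
      refine le_trans ?_ (monotone_cutoff hη h h2)
      rw [cutoff, sub_self, rampScaled_zero, sub_zero, one_sub_div h0.ne']
      gcongr
      exact sub_le_rampScaled hη _
    · right; right
      rw [cutoffSlope, rampSlope_of_le hη (by linarith), rampSlope_of_nonpos hη (by linarith),
        sub_zero]

end Ramp

section LinearFlow

variable {V : Type*} [NormedAddCommGroup V] [InnerProductSpace ℝ V] {J K : V →L[ℝ] V}

theorem eq_zero_of_linear_periodic [CompleteSpace V] (hJ : IsOrthComplex J)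
    (hK : ∀ v, K (J v) = J (K v))
    (hres : ∀ (k : ℤ) v, (2 * π * k : ℝ) • v = (2 : ℝ) • K v → v = 0) {y : ℝ → V}
    (hy : ∀ t, HasDerivAt y (J ((2 : ℝ) • K (y t))) t) (h01 : y 0 = y 1) : y 0 = 0 := by
  have hyc : Continuous y := continuous_iff_continuousAt.2 fun t => (hy t).continuousAt
  have hcoef : ∀ k : ℤ, coef J k y = 0 := fun k => by
    refine hres k _ ?_
    have hd : ∀ t ∈ uIcc (0 : ℝ) 1, HasDerivAt (fun t => rot J (-(2 * π * k) * t) (y t))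
        ((2 : ℝ) • J (K (rot J (-(2 * π * k * t)) (y t)))
          - (2 * π * k : ℝ) • J (rot J (-(2 * π * k * t)) (y t))) t := fun t _ => by
      have h1 : HasDerivAt (fun t : ℝ => -(2 * π * k) * t) (-(2 * π * k)) t := by
        simpa using (hasDerivAt_id t).const_mul (-(2 * π * k) : ℝ)
      have h2 := (h1.cos.smul (hy t)).add (h1.sin.smul (J.hasFDerivAt.comp_hasDerivAt t (hy t)))
      simp only [rot_apply]
      refine h2.congr_deriv ?_
      simp only [map_add, map_smul, hJ.sq, hK, neg_mul, Function.comp_apply]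
      module
    have hi := intervalIntegral.integral_eq_sub_of_hasDerivAt hd
      (Continuous.intervalIntegrable (by fun_prop) _ _)
    have h1 : rot J (-(2 * π * k) * 1) (y 1) = rot J (-(2 * π * k) * 0) (y 0) := by
      rw [← h01, mul_zero, rot_zero, mul_one]
      have := rot_two_pi_int (J := J) (-k) (y 0)
      rwa [Int.cast_neg, mul_neg] at this
    have hJi : ∫ t in (0 : ℝ)..1, J (rot J (-(2 * π * k * t)) (y t)) = J (coef J k y) :=
      J.intervalIntegral_comp_comm (Continuous.intervalIntegrable (by fun_prop) _ _)
    have hKi : ∫ t in (0 : ℝ)..1, J (K (rot J (-(2 * π * k * t)) (y t))) = J (K (coef J k y)) :=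
      (J.comp K).intervalIntegral_comp_comm (Continuous.intervalIntegrable (by fun_prop) _ _)
    rw [h1, sub_self, intervalIntegral.integral_sub
      (Continuous.intervalIntegrable (by fun_prop) _ _)
      (Continuous.intervalIntegrable (by fun_prop) _ _), intervalIntegral.integral_smul,
      intervalIntegral.integral_smul, hJi, hKi] at hi
    have h2 := congrArg J hi
    rw [map_sub, map_smul, map_smul, hJ.sq, hJ.sq, map_zero] at h2
    rw [← sub_eq_zero, ← h2]
    module
  have h0 := hcoef 0
  have hconst := fun t (ht : t ∈ Icc (0 : ℝ) 1) =>
    eq_of_forall_coef_eq_zero hJ hyc h01 (fun k _ => hcoef k) ht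
  have : coef J 0 y = y 0 := by
    have h3 : coef J 0 y = ∫ _ in (0 : ℝ)..1, y 0 := by
      refine intervalIntegral.integral_congr fun t ht => ?_
      rw [uIcc_of_le zero_le_one] at ht
      simp [rot_zero, hconst t ht]
    simpa using h3
  rw [← this, h0]

theorem exists_linear_flow [CompleteSpace V] (hJ : IsOrthComplex J)
    (hK : ∀ v w, inner ℝ (K v) w = inner ℝ v (K w)) (c : ℝ) (v : V) : ∃ y : ℝ → V,
      y 0 = v ∧ (∀ t, HasDerivAt y (J ((2 * c : ℝ) • K (y t))) t) ∧
      ∀ t, inner ℝ (K (y t)) (y t) = inner ℝ (K v) v := by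
  set A : V →L[ℝ] V := (2 * c : ℝ) • J.comp K
  set y : ℝ → V := fun t => NormedSpace.exp (t • A) v
  have hy0 : y 0 = v := by simp [y]
  have hy : ∀ t, HasDerivAt y (J ((2 * c : ℝ) • K (y t))) t := fun t => by
    have h := (hasDerivAt_exp_smul_const' A t).clm_apply (hasDerivAt_const t v)
    refine h.congr_deriv ?_
    simp [A, y]
  refine ⟨y, hy0, hy, fun t => ?_⟩
  have hd : ∀ t, HasDerivAt (fun t => inner ℝ (K (y t)) (y t)) 0 t := fun t => by
    have h := (K.hasFDerivAt.comp_hasDerivAt t (hy t)).inner ℝ (hy t)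
    refine h.congr_deriv ?_
    rw [Function.comp_apply, hK (J _), real_inner_comm, ← two_mul, map_smul,
      real_inner_smul_left, hJ.inner_apply_self]
    simp
  have := is_const_of_deriv_eq_zero (fun t => (hd t).differentiableAt) (fun t => (hd t).deriv) t 0
  rw [this, hy0]

/-- Uniqueness for the integral equation of a Hamiltonian vector field. -/
theorem eqOn_of_integral_eq [CompleteSpace V] {F : V → V} {Λ : ℝ} (hΛ : 0 ≤ Λ)
    (hF : ∀ z w, ‖F z - F w‖ ≤ Λ * ‖z - w‖) {x y : ℝ → V} (hx : Continuous x)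
    (hxe : ∀ t ∈ Icc (0 : ℝ) 1, x t = x 0 + ∫ s in (0 : ℝ)..t, F (x s)) (h0 : y 0 = x 0)
    (hy : ∀ t, HasDerivAt y (F (y t)) t) {t : ℝ} (ht : t ∈ Icc (0 : ℝ) 1) : x t = y t := by
  have hL : LipschitzWith Λ.toNNReal F := LipschitzWith.of_dist_le_mul fun z w => by
    rw [dist_eq_norm, dist_eq_norm, Real.coe_toNNReal _ hΛ]
    exact hF z w
  have hFx : Continuous fun s => F (x s) := hL.continuous.comp hx
  refine ODE_solution_unique_of_mem_Icc_right (v := fun _ => F) (s := fun _ => univ)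
    (fun t _ => hL.lipschitzOnWith) hx.continuousOn (fun t ht => ?_) (fun _ _ => mem_univ _)
    (fun t _ => (hy t).continuousAt.continuousWithinAt)
    (fun t _ => (hy t).hasDerivWithinAt) (fun _ _ => mem_univ _) h0.symm ht
  have hd : HasDerivAt (fun t => x 0 + ∫ s in (0 : ℝ)..t, F (x s)) (F (x t)) t :=
    (hFx.integral_hasStrictDerivAt 0 t).hasDerivAt.const_add _
  refine hd.hasDerivWithinAt.congr_of_eventuallyEq ?_ (hxe t ⟨ht.1, ht.2.le⟩)
  filter_upwards [Ico_mem_nhdsGE ht.2] with s hs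
  exact hxe s ⟨ht.1.trans hs.1, hs.2.le⟩

end LinearFlow

section Action

variable {V : Type*} [NormedAddCommGroup V] [InnerProductSpace ℝ V] {J : V →L[ℝ] V}

/-- The pullback under `Z` of the form `⟨J z, dz⟩`, a primitive of twice the symplectic form. -/
def liouville {E : Type*} [NormedAddCommGroup E] [NormedSpace ℝ E] (J : V →L[ℝ] V) (Z : E → V)
    (q : E) : E →L[ℝ] ℝ := (innerSL ℝ (J (Z q))).comp (fderiv ℝ Z q)

theorem liouville_apply {E : Type*} [NormedAddCommGroup E] [NormedSpace ℝ E] (Z : E → V) (q b : E) :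
    liouville J Z q b = inner ℝ (J (Z q)) (fderiv ℝ Z q b) := rfl

theorem differentiableAt_liouville {E : Type*} [NormedAddCommGroup E] [NormedSpace ℝ E] {Z : E → V}
    {q : E} (hZ : ContDiffAt ℝ 2 Z q) : DifferentiableAt ℝ (liouville J Z) q := by
  have h1 : DifferentiableAt ℝ (fderiv ℝ Z) q :=
    (hZ.fderiv_right (m := 1) le_rfl).differentiableAt one_ne_zero
  have h2 : DifferentiableAt ℝ (fun q => innerSL ℝ (J (Z q))) q :=
    ((innerSL ℝ).comp J).differentiableAt.comp q (hZ.differentiableAt two_ne_zero)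
  exact h2.clm_comp h1

theorem fderiv_liouville_sub (hJ : IsOrthComplex J) {E : Type*} [NormedAddCommGroup E]
    [NormedSpace ℝ E] {Z : E → V} {q : E} (hZ : ContDiffAt ℝ 2 Z q) (a b : E) :
    fderiv ℝ (liouville J Z) q a b - fderiv ℝ (liouville J Z) q b a
      = 2 * inner ℝ (J (fderiv ℝ Z q a)) (fderiv ℝ Z q b) := by
  have h1 : DifferentiableAt ℝ (fderiv ℝ Z) q :=
    (hZ.fderiv_right (m := 1) le_rfl).differentiableAt one_ne_zero
  have hd := (differentiableAt_liouville (J := J) hZ).hasFDerivAt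
  have key : ∀ a b : E, fderiv ℝ (liouville J Z) q a b
      = inner ℝ (J (Z q)) (fderiv ℝ (fderiv ℝ Z) q a b)
        + inner ℝ (J (fderiv ℝ Z q a)) (fderiv ℝ Z q b) := fun a b => by
    have h2 : HasFDerivAt (fun q => liouville J Z q b)
        ((ContinuousLinearMap.apply ℝ ℝ b).comp (fderiv ℝ (liouville J Z) q)) q :=
      (ContinuousLinearMap.apply ℝ ℝ b).hasFDerivAt.comp q hd
    have h3 := (J.hasFDerivAt.comp q (hZ.differentiableAt two_ne_zero).hasFDerivAt).inner ℝ
      ((ContinuousLinearMap.apply ℝ V b).hasFDerivAt.comp q h1.hasFDerivAt)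
    have h4 := congrArg (fun L : E →L[ℝ] ℝ => L a) (h2.unique h3)
    simpa using h4
  have hsymm := (hZ.isSymmSndFDerivAt (by simp)).eq a b
  rw [key a b, key b a, hsymm, hJ.skew (fderiv ℝ Z q b), real_inner_comm (J _)]
  ring

theorem exists_orthogonal_vector [FiniteDimensional ℝ V] (hd : 2 < Module.finrank ℝ V) (w : V) :
    ∃ u : V, ‖u‖ = ‖w‖ ∧ inner ℝ w u = 0 ∧ inner ℝ (J w) u = 0 := by
  set S : Submodule ℝ V := Submodule.span ℝ {w, J w}
  have h1 : Module.finrank ℝ S ≤ 2 :=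
    by
    have h2 : ({w, J w} : Set V) = range ![w, J w] := by
      rw [Matrix.range_cons, Matrix.range_cons, Matrix.range_empty, union_empty, singleton_union]
    have h3 := finrank_range_le_card (R := ℝ) ![w, J w]
    rwa [← h2, Fintype.card_fin] at h3
  have h2 := S.finrank_add_finrank_orthogonal
  obtain ⟨u, hu, hu0⟩ := Submodule.exists_mem_ne_zero_of_ne_bot
    (p := Sᗮ) (fun h => by rw [h, finrank_bot] at h2; omega)
  have hu' := (Submodule.mem_orthogonal S u).1 hu
  refine ⟨(‖w‖ / ‖u‖) • u, ?_, ?_, ?_⟩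
  · rw [norm_smul, norm_div, norm_norm, norm_norm, div_mul_cancel₀ _ (norm_ne_zero_iff.2 hu0)]
  · rw [inner_smul_right, hu' w (Submodule.subset_span (by simp)), mul_zero]
  · rw [inner_smul_right, hu' (J w) (Submodule.subset_span (by simp)), mul_zero]

/-- A symplectic map defined near a sphere preserves the action of the Hopf circles. -/
theorem integral_action_hopf_circle [FiniteDimensional ℝ V] (hJ : IsOrthComplex J)
    (hd : 2 < Module.finrank ℝ V) {f : V → V} {w : V}
    (hf : ∀ v, ‖v‖ = ‖w‖ → ContDiffAt ℝ 2 f v)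
    (hsymp : ∀ v, ‖v‖ = ‖w‖ → ∀ a b, inner ℝ (J (fderiv ℝ f v a)) (fderiv ℝ f v b)
      = inner ℝ (J a) b) (k : ℤ) :
    ∫ t in (0 : ℝ)..1, inner ℝ (J (f (rot J (2 * π * k * t) w)))
      (fderiv ℝ f (rot J (2 * π * k * t) w) ((2 * π * k : ℝ) • J (rot J (2 * π * k * t) w)))
      = 2 * π * k * ‖w‖ ^ 2 := by
  obtain ⟨u, hu, hwu, hJwu⟩ := exists_orthogonal_vector (J := J) hd w
  set Y : ℝ × ℝ → V := fun q => cos q.1 • rot J (2 * π * k * q.2) w + sin q.1 • u with hY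
  have hYs : ContDiff ℝ 2 Y := by
    simp only [hY, rot_apply]
    fun_prop
  have hYn : ∀ q, ‖Y q‖ = ‖w‖ := fun q => by
    have h0 : inner ℝ (rot J (2 * π * k * q.2) w) u = 0 := by
      rw [rot_apply, inner_add_left, real_inner_smul_left, real_inner_smul_left, hwu, hJwu]
      simp
    rw [← sq_eq_sq₀ (norm_nonneg _) (norm_nonneg _), hY, norm_add_sq_real, real_inner_smul_left,
      real_inner_smul_right, h0, norm_smul, norm_smul, norm_rot hJ, hu, mul_pow, mul_pow,
      Real.norm_eq_abs, Real.norm_eq_abs, sq_abs, sq_abs]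
    linear_combination ‖w‖ ^ 2 * cos_sq_add_sin_sq q.1
  set Z : ℝ × ℝ → V := f ∘ Y
  have hZs : ContDiff ℝ 2 Z := contDiff_iff_contDiffAt.2 fun q =>
    (hf _ (hYn q)).comp q hYs.contDiffAt
  have hZd : ∀ q, fderiv ℝ Z q = (fderiv ℝ f (Y q)).comp (fderiv ℝ Y q) := fun q =>
    fderiv_comp q ((hf _ (hYn q)).differentiableAt two_ne_zero)
      (hYs.differentiable two_ne_zero q)
  have hdiffω : DifferentiableOn ℝ (fun q => liouville J Z q - liouville J Y q) univ :=
    fun q _ => ((differentiableAt_liouville hZs.contDiffAt).sub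
      (differentiableAt_liouville hYs.contDiffAt)).differentiableWithinAt
  obtain ⟨g, hg⟩ := convex_univ.exists_forall_hasFDerivAt_of_fderiv_symmetric isOpen_univ
    hdiffω fun q _ a b => by
    rw [fderiv_fun_sub (differentiableAt_liouville hZs.contDiffAt)
      (differentiableAt_liouville hYs.contDiffAt)]
    have h1 := fderiv_liouville_sub hJ hZs.contDiffAt (q := q) a b
    have h2 := fderiv_liouville_sub hJ hYs.contDiffAt (q := q) a b
    rw [hZd, ContinuousLinearMap.comp_apply, ContinuousLinearMap.comp_apply,
      hsymp _ (hYn q)] at h1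
    simp only [sub_apply]
    linarith
  have hYp : ∀ q : ℝ × ℝ, Y (q + (0, 1)) = Y q := fun q => by
    simp only [hY, Prod.fst_add, Prod.snd_add, add_zero, mul_add, mul_one]
    rw [← rot_rot hJ, rot_two_pi_int]
  have hper : ∀ q : ℝ × ℝ, liouville J Z (q + (0, 1)) - liouville J Y (q + (0, 1))
      = liouville J Z q - liouville J Y q := fun q => by
    have h1 : fderiv ℝ Y (q + (0, 1)) = fderiv ℝ Y q := by
      rw [← fderiv_comp_add_right]
      simp only [hYp]
    simp only [liouville, hZd, h1, hYp, Z, Function.comp_apply]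
  have hpath : ∀ (c : ℝ → ℝ × ℝ) (c' : ℝ × ℝ) (t : ℝ), HasDerivAt c c' t →
      HasDerivAt (fun t => g (c t)) ((liouville J Z (c t) - liouville J Y (c t)) c') t :=
    fun c c' t hc => (hg (c t) (mem_univ _)).comp_hasDerivAt t hc
  have hs : ∀ s θ : ℝ, HasDerivAt (fun s : ℝ => (s, θ)) ((1, 0) : ℝ × ℝ) s := fun s θ =>
    (hasDerivAt_id s).prodMk (hasDerivAt_const s θ)
  have ht : ∀ s t : ℝ, HasDerivAt (fun t : ℝ => (s, t)) ((0, 1) : ℝ × ℝ) t := fun s t =>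
    (hasDerivAt_const t s).prodMk (hasDerivAt_id t)
  have hYt : ∀ q, fderiv ℝ Y q (0, 1) = cos q.1 • (2 * π * k : ℝ) • J (rot J (2 * π * k * q.2) w) :=
    fun q => by
      have h1 := (hYs.differentiable two_ne_zero q).hasFDerivAt.comp_hasDerivAt q.2 (ht q.1 q.2)
      refine h1.unique ?_
      exact ((hasDerivAt_rot hJ (2 * π * k) q.2 w).const_smul (cos q.1)).add_const (sin q.1 • u)
  have hdiff : g (0, 1) - g (0, 0) = g (π / 2, 1) - g (π / 2, 0) := by
    have hd0 : ∀ s, HasDerivAt (fun s => g (s, 1) - g (s, 0)) 0 s := fun s => by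
      refine ((hpath _ _ s (hs s 1)).sub (hpath _ _ s (hs s 0))).congr_deriv ?_
      have := hper (s, 0)
      rw [Prod.mk_add_mk, add_zero, zero_add] at this
      rw [this, sub_self]
    exact is_const_of_deriv_eq_zero (fun t => (hd0 t).differentiableAt) (fun t => (hd0 t).deriv) _ _
  have hend : g (π / 2, 1) = g (π / 2, 0) := by
    have hd0 : ∀ t, HasDerivAt (fun t => g (π / 2, t)) 0 t := fun t => by
      refine (hpath _ _ t (ht (π / 2) t)).congr_deriv ?_
      rw [sub_apply, liouville_apply, liouville_apply, hZd,
        ContinuousLinearMap.comp_apply, hYt]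
      simp
    exact is_const_of_deriv_eq_zero (fun t => (hd0 t).differentiableAt) (fun t => (hd0 t).deriv) _ _
  have hY0 : ∀ t, Y (0, t) = rot J (2 * π * k * t) w := fun t => by simp [hY]
  have hF : ∀ t, (liouville J Z (0, t) - liouville J Y (0, t)) (0, 1)
      = inner ℝ (J (f (rot J (2 * π * k * t) w)))
      (fderiv ℝ f (rot J (2 * π * k * t) w) ((2 * π * k : ℝ) • J (rot J (2 * π * k * t) w)))
      - 2 * π * k * ‖w‖ ^ 2 := fun t => by
    rw [sub_apply, liouville_apply, liouville_apply, hZd, ContinuousLinearMap.comp_apply, hYt]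
    simp only [Z, Function.comp_apply, hY0, cos_zero, one_smul]
    rw [real_inner_smul_right, real_inner_self_eq_norm_sq, hJ.norm_apply, norm_rot hJ]
  have hFc : Continuous fun t => (liouville J Z (0, t) - liouville J Y (0, t)) (0, 1) := by
    simp only [sub_apply, liouville_apply]
    have h1 := hZs.continuous_fderiv two_ne_zero
    have h2 := hYs.continuous_fderiv two_ne_zero
    have h3 := hZs.continuous
    have h4 := hYs.continuous
    fun_prop
  have hi := intervalIntegral.integral_eq_sub_of_hasDerivAt (a := 0) (b := 1)
    (fun t _ => hpath _ _ t (ht 0 t)) (hFc.intervalIntegrable _ _)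
  rw [hdiff, hend, sub_self] at hi
  have hFc' := hFc.congr hF
  rw [intervalIntegral.integral_congr fun t _ => hF t] at hi
  have hc2 := (hFc'.add (continuous_const (y := 2 * π * k * ‖w‖ ^ 2))).congr
    fun t => sub_add_cancel _ _
  rw [intervalIntegral.integral_sub (hc2.intervalIntegrable _ _)
    (continuous_const.intervalIntegrable _ _), intervalIntegral.integral_const] at hi
  simp only [sub_zero, one_smul] at hi
  linarith

end Action

section Symplectic

variable {V : Type*} [NormedAddCommGroup V] [InnerProductSpace ℝ V] {J : V →L[ℝ] V}

/-- A smooth injective map on the open set `N` preserving the form `⟨J v, w⟩`. -/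
structure IsSymplecticOn (J : V →L[ℝ] V) (f : V → V) (N : Set V) : Prop where
  isOpen : IsOpen N
  contDiffOn : ContDiffOn ℝ ∞ f N
  injOn : InjOn f N
  symp : ∀ p ∈ N, ∀ v w, inner ℝ (J (fderiv ℝ f p v)) (fderiv ℝ f p w) = inner ℝ (J v) w

theorem IsOrthComplex.inner_apply_apply (hJ : IsOrthComplex J) (v w : V) :
    inner ℝ (J v) (J w) = inner ℝ v w := by
  rw [hJ.skew, hJ.sq, inner_neg_right, neg_neg]

theorem injective_of_symplectic (hJ : IsOrthComplex J) {A : V →L[ℝ] V}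
    (hA : ∀ v w, inner ℝ (J (A v)) (A w) = inner ℝ (J v) w) : Function.Injective A := by
  refine (injective_iff_map_eq_zero A).2 fun v hv => ?_
  have h := hA v (J v)
  rwa [hv, map_zero, inner_zero_left, hJ.inner_apply_apply, eq_comm, inner_self_eq_zero] at h

theorem abs_det_of_symplectic [FiniteDimensional ℝ V] (hJ : IsOrthComplex J) {A : V →L[ℝ] V}
    (hA : ∀ v w, inner ℝ (J (A v)) (A w) = inner ℝ (J v) w) : |A.det| = 1 := by
  have h1 : LinearMap.adjoint (A : V →ₗ[ℝ] V) ∘ₗ (J : V →ₗ[ℝ] V) ∘ₗ (A : V →ₗ[ℝ] V)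
      = (J : V →ₗ[ℝ] V) := by
    ext v
    refine ext_inner_right ℝ fun w => ?_
    rw [LinearMap.comp_apply, LinearMap.adjoint_inner_left]
    exact hA v w
  have h2 : LinearMap.det (LinearMap.adjoint (A : V →ₗ[ℝ] V)) = A.det := by
    let b := stdOrthonormalBasis ℝ V
    rw [← LinearMap.det_toMatrix b.toBasis, LinearMap.toMatrix_adjoint, Matrix.det_conjTranspose,
      LinearMap.det_toMatrix]
    rfl
  have hJd : LinearMap.det (J : V →ₗ[ℝ] V) ≠ 0 := by
    have h : (-J : V →ₗ[ℝ] V) ∘ₗ (J : V →ₗ[ℝ] V) = LinearMap.id := by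
      ext v
      simp [hJ.sq]
    have h' := congrArg LinearMap.det h
    rw [LinearMap.det_comp, LinearMap.det_id] at h'
    exact right_ne_zero_of_mul_eq_one h'
  have h3 := congrArg LinearMap.det h1
  rw [LinearMap.det_comp, LinearMap.det_comp, h2] at h3
  have h4 : A.det * A.det = 1 := by
    refine mul_left_cancel₀ hJd ?_
    rw [mul_one]
    linear_combination h3
  rwa [← abs_mul_abs_self, mul_self_eq_one_iff, or_iff_left] at h4
  linarith [abs_nonneg A.det]

theorem IsSymplecticOn.exists_inverse [FiniteDimensional ℝ V] (hJ : IsOrthComplex J) {f : V → V}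
    {N : Set V} (h : IsSymplecticOn J f N) : ∃ g : V → V, (∀ p ∈ N, g (f p) = p) ∧
      ContDiffOn ℝ ∞ g (f '' N) ∧ ∀ S ⊆ N, IsOpen S → IsOpen (f '' S) := by
  have hca : ∀ p ∈ N, ContDiffAt ℝ ∞ f p := fun p hp => h.contDiffOn.contDiffAt
    (h.isOpen.mem_nhds hp)
  have hd : ∀ p ∈ N, ∃ A : V ≃L[ℝ] V, HasStrictFDerivAt f (A : V →L[ℝ] V) p := fun p hp => by
    have hi := injective_of_symplectic hJ (h.symp p hp)
    refine ⟨(LinearEquiv.ofInjectiveEndo (fderiv ℝ f p : V →ₗ[ℝ] V) hi).toContinuousLinearEquiv, ?_⟩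
    exact ((hca p hp).hasStrictFDerivAt (by simp))
  have hopen : ∀ S ⊆ N, IsOpen S → IsOpen (f '' S) := fun S hS hSo => by
    rw [isOpen_iff_mem_nhds]
    rintro _ ⟨p, hp, rfl⟩
    obtain ⟨A, hA⟩ := hd p (hS hp)
    rw [← hA.map_nhds_eq_of_equiv]
    exact image_mem_map (hSo.mem_nhds hp)
  let e := OpenPartialHomeomorph.ofContinuousOpenRestrict (h.injOn.toPartialEquiv f N)
    h.contDiffOn.continuousOn (by
      intro s hs
      obtain ⟨t, ht, rfl⟩ := isOpen_induced_iff.1 hs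
      have hst := hopen (N ∩ t) inter_subset_left (h.isOpen.inter ht)
      rwa [← Subtype.image_preimage_coe, image_image] at hst) h.isOpen
  refine ⟨e.symm, fun p hp => e.left_inv hp, ?_, hopen⟩
  rintro _ ⟨p, hp, rfl⟩
  obtain ⟨A, hA⟩ := hd p hp
  have hl : e.symm (f p) = p := e.left_inv hp
  refine (e.contDiffAt_symm (f₀' := A) (e.map_source hp) ?_ ?_).contDiffWithinAt
  · exact (congrArg (HasFDerivAt f (A : V →L[ℝ] V)) hl).mpr hA.hasFDerivAt
  · exact (congrArg (ContDiffAt ℝ ∞ f) hl).mpr (hca p hp)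

end Symplectic

section Collar

variable {V : Type*} [NormedAddCommGroup V] [InnerProductSpace ℝ V] {J : V →L[ℝ] V}

/-- A function which is `0` or `1` near the ends of a shell can be transported by a symplectic
map to the image of the shell, and extended by locally constant values. -/
theorem IsSymplecticOn.exists_collar [FiniteDimensional ℝ V] (hJ : IsOrthComplex J) {f : V → V}
    {N S K : Set V} (h : IsSymplecticOn J f N) (hSN : S ⊆ N) (hS : IsOpen S)
    (hSc : IsPreconnected S) (hK : IsCompact K) (hKne : K.Nonempty) (hKS : K ⊆ S) {ρ : V → ℝ}
    (hρ : ContDiff ℝ ∞ ρ) (hρv : ∀ w ∈ S \ K, ρ w = 0 ∨ ρ w = 1)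
    (hρd : ∀ w ∈ S \ K, fderiv ℝ ρ w = 0) :
    ∃ u : V → ℝ, ContDiff ℝ ∞ u ∧ (∀ w ∈ S, u (f w) = ρ w) ∧
      (∀ z ∉ f '' K, fderiv ℝ u z = 0) ∧ ∀ z ∉ f '' K, u z = 0 ∨ u z = 1 := by
  obtain ⟨g, hgf, hgs, hopen⟩ := h.exists_inverse hJ
  have hfS : IsOpen (f '' S) := hopen S hSN hS
  have hfK : IsCompact (f '' K) := hK.image_of_continuousOn
    (h.contDiffOn.continuousOn.mono (hKS.trans hSN))
  have hb : ∀ z ∈ f '' S, ContDiffAt ℝ ∞ (ρ ∘ g) z := fun z hz =>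
    hρ.contDiffAt.comp z ((hgs.mono (image_mono hSN)).contDiffAt (hfS.mem_nhds hz))
  set β : V → V →L[ℝ] ℝ := (f '' S).indicator (fderiv ℝ (ρ ∘ g)) with hβ
  have hβS : ∀ z ∈ f '' S, β =ᶠ[𝓝 z] fderiv ℝ (ρ ∘ g) := fun z hz => by
    filter_upwards [hfS.mem_nhds hz] with y hy
    exact indicator_of_mem hy _
  have hβ0 : ∀ z ∉ f '' K, β z = 0 := fun z hz => by
    by_cases hzS : z ∈ f '' S
    · rw [hβ, indicator_of_mem hzS]
      obtain ⟨w, hw, rfl⟩ := hzS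
      have hwK : w ∉ K := fun hwK => hz (mem_image_of_mem f hwK)
      have hgd : DifferentiableAt ℝ g (f w) :=
        ((hgs.contDiffAt ((hopen N subset_rfl h.isOpen).mem_nhds
          (mem_image_of_mem f (hSN hw)))).differentiableAt (by simp))
      rw [fderiv_comp _ (hρ.differentiable (by simp) _) hgd, hgf w (hSN hw), hρd w ⟨hw, hwK⟩,
        ContinuousLinearMap.zero_comp]
    · exact indicator_of_notMem hzS _
  have hβK : ∀ z ∉ f '' K, β =ᶠ[𝓝 z] fun _ => 0 := fun z hz => by
    filter_upwards [hfK.isClosed.isOpen_compl.mem_nhds hz] with y hy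
    exact hβ0 y hy
  have hβs : ContDiff ℝ ∞ β := contDiff_iff_contDiffAt.2 fun z => by
    by_cases hz : z ∈ f '' S
    · exact ((hb z hz).fderiv_right (m := ∞) (by simp)).congr_of_eventuallyEq (hβS z hz)
    · exact contDiffAt_const.congr_of_eventuallyEq (hβK z fun h => hz (image_mono hKS h))
  have hβd : DifferentiableOn ℝ β univ := (hβs.differentiable (by simp)).differentiableOn
  obtain ⟨u, hu⟩ := convex_univ.exists_forall_hasFDerivAt_of_fderiv_symmetric isOpen_univ hβd
    fun z _ a b => by
      by_cases hz : z ∈ f '' S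
      · rw [(hβS z hz).fderiv_eq]
        exact ((hb z hz).isSymmSndFDerivAt (by
          simpa using WithTop.coe_le_coe.2 (le_top : (2 : ℕ∞) ≤ ⊤))).eq a b
      · rw [(hβK z fun h => hz (image_mono hKS h)).fderiv_eq]
        simp
  have hud : ∀ z, fderiv ℝ u z = β z := fun z => (hu z (mem_univ _)).fderiv
  have hus : ContDiff ℝ ∞ u := contDiff_infty_iff_fderiv.2
    ⟨fun z => (hu z (mem_univ _)).differentiableAt, by rwa [funext hud]⟩
  obtain ⟨c₀, hc₀⟩ := hfS.exists_is_const_of_fderiv_eq_zero (𝕜 := ℝ)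
    (f := fun z => u z - (ρ ∘ g) z)
    (hSc.image f (h.contDiffOn.continuousOn.mono hSN))
    (fun z hz => ((hu z (mem_univ _)).differentiableAt.sub
      ((hb z hz).differentiableAt (by simp))).differentiableWithinAt)
    fun z hz => by
      rw [fderiv_fun_sub (hu z (mem_univ _)).differentiableAt
        ((hb z hz).differentiableAt (by simp)), hud, (hβS z hz).eq_of_nhds, sub_self]
      rfl
  have huf : ∀ w ∈ S, u (f w) - c₀ = ρ w := fun w hw => by
    have := hc₀ (f w) (mem_image_of_mem f hw)
    rw [Function.comp_apply, hgf w (hSN hw)] at this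
    linarith
  refine ⟨fun z => u z - c₀, hus.sub contDiff_const, huf, fun z hz => ?_, fun z hz => ?_⟩
  · rw [fderiv_sub_const, hud, hβ0 z hz]
  obtain ⟨p, hp⟩ := hKne.image f
  set γ : ℝ → V := fun t => z + t • (p - z) with hγ
  have hγc : Continuous γ := by fun_prop
  have hT : IsCompact (Icc (0 : ℝ) 1 ∩ γ ⁻¹' (f '' K)) :=
    isCompact_Icc.inter_right (hfK.isClosed.preimage hγc)
  obtain ⟨t₀, ⟨ht₀, ht₀K⟩, hmin⟩ := hT.exists_isLeast ⟨1, by simp, by simpa [hγ] using hp⟩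
  have h0 : 0 < t₀ := ht₀.1.lt_of_ne fun h0 => hz (by
    rw [mem_preimage, ← h0] at ht₀K
    simpa [hγ] using ht₀K)
  have hbelow : ∀ t, 0 ≤ t → t < t₀ → γ t ∉ f '' K := fun t h1 h2 hK =>
    h2.not_ge (hmin ⟨⟨h1, h2.le.trans ht₀.2⟩, hK⟩)
  have hconst : ∀ t ∈ Icc 0 t₀, u (γ t) = u (γ 0) := constant_of_has_deriv_right_zero
    (hus.continuous.comp hγc).continuousOn fun t ht => by
      have h1 : HasDerivAt γ (p - z) t := by
        simpa [hγ] using (((hasDerivAt_id t).smul_const (p - z)).const_add z)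
      have h2 := (hu (γ t) (mem_univ _)).comp_hasDerivAt t h1
      rw [hβ0 _ (hbelow t ht.1 ht.2)] at h2
      exact h2.hasDerivWithinAt
  have hev : ∀ᶠ t in 𝓝[<] t₀, γ t ∈ f '' S ∧ 0 < t ∧ t < t₀ :=
    ((hγc.continuousAt.eventually_mem
      (hfS.mem_nhds (image_mono hKS ht₀K))).filter_mono nhdsWithin_le_nhds).and
      (((lt_mem_nhds h0).filter_mono nhdsWithin_le_nhds).and self_mem_nhdsWithin)
  obtain ⟨t, ⟨w, hw, hwt⟩, ht0, htt⟩ := hev.exists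
  have hz0 : γ 0 = z := by simp [hγ]
  have hwK : w ∉ K := fun hwK => hbelow t ht0.le htt (hwt ▸ mem_image_of_mem f hwK)
  have h3 : u z - c₀ = ρ w := by
    rw [← huf w hw, hwt, hconst t ⟨ht0.le, htt.le⟩, hz0]
  simp only [h3]
  exact hρv w ⟨hw, hwK⟩

end Collar

section Volume

variable {V : Type*} [NormedAddCommGroup V] [InnerProductSpace ℝ V] {J : V →L[ℝ] V}

theorem integral_fderiv_apply_self [FiniteDimensional ℝ V] [MeasurableSpace V] [BorelSpace V]
    {v : V → ℝ} (hv : ContDiff ℝ ∞ v) (hc : HasCompactSupport v) :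
    ∫ z, fderiv ℝ v z z = -(Module.finrank ℝ V * ∫ z, v z) := by
  let b := stdOrthonormalBasis ℝ V
  have hvc : Continuous v := hv.continuous
  have hdc : Continuous (fderiv ℝ v) := hv.continuous_fderiv (by simp)
  have hfc : ∀ i, HasCompactSupport fun z => fderiv ℝ v z (b i) := fun i =>
    (hc.fderiv ℝ).comp_left (g := fun L : V →L[ℝ] ℝ => L (b i)) rfl
  have hInt : ∀ i, Integrable fun z => inner ℝ (b i) z * fderiv ℝ v z (b i) := fun i =>
    Continuous.integrable_of_hasCompactSupport (by fun_prop) ((hfc i).mul_left)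
  have hd : ∀ i z, HasFDerivAt (fun z => inner ℝ (b i) z) (innerSL ℝ (b i)) z := fun i z =>
    (innerSL ℝ (b i)).hasFDerivAt
  have hpart : ∀ i, ∫ z, inner ℝ (b i) z * fderiv ℝ v z (b i) = -∫ z, v z := fun i => by
    have h1 : ∀ z, fderiv ℝ (fun z => inner ℝ (b i) z) z (b i) = 1 := fun z => by
      rw [(hd i z).fderiv, innerSL_apply_apply, real_inner_self_eq_norm_sq, b.norm_eq_one, one_pow]
    rw [integral_mul_fderiv_eq_neg_fderiv_mul_of_integrable]
    · simp only [h1, one_mul]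
    · simp only [h1, one_mul]
      exact hvc.integrable_of_hasCompactSupport hc
    · exact hInt i
    · exact Continuous.integrable_of_hasCompactSupport (by fun_prop) hc.mul_left
    · exact fun z _ => (hd i z).differentiableAt
    · exact fun z _ => hv.differentiable (by simp) z
  have hsum : ∀ z, fderiv ℝ v z z = ∑ i, inner ℝ (b i) z * fderiv ℝ v z (b i) := fun z => by
    have h1 := congrArg (fderiv ℝ v z) (b.sum_repr' z)
    rw [← h1, map_sum]
    simp only [map_smul, smul_eq_mul]
  rw [integral_congr_ae (ae_of_all _ hsum), integral_finsetSum _ fun i _ => hInt i]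
  simp [hpart]

theorem integral_eq_integral_average_rot [FiniteDimensional ℝ V] [MeasurableSpace V] [BorelSpace V]
    (hJ : IsOrthComplex J) {F : V → ℝ} (hF : Continuous F) {r : ℝ} (hr : ∀ w, r < ‖w‖ → F w = 0)
    (c : ℝ) : ∫ w, F w = ∫ w, ∫ t in (0 : ℝ)..1, F (rot J (c * t) w) := by
  have hrot : ∀ θ, ∫ w, F (rot J θ w) = ∫ w, F w := fun θ => by
    let e : V ≃ₗᵢ[ℝ] V := LinearIsometry.toLinearIsometryEquiv
      (⟨(rot J θ : V →ₗ[ℝ] V), norm_rot hJ θ⟩ : V →ₗᵢ[ℝ] V) rfl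
    exact e.measurePreserving.integral_comp' (f := e.toMeasurableEquiv) F
  have hc : Continuous fun p : V × ℝ => F (rot J (c * p.2) p.1) := by
    refine hF.comp ?_
    simp only [rot_apply]
    fun_prop
  have hI : Integrable (fun p : V × ℝ => F (rot J (c * p.2) p.1))
      ((volume : Measure V).prod (volume.restrict (Ioc (0 : ℝ) 1))) := by
    rw [← Measure.restrict_univ (μ := (volume : Measure V)), Measure.prod_restrict]
    have h1 : IntegrableOn (fun p : V × ℝ => F (rot J (c * p.2) p.1))
        (closedBall 0 r ×ˢ Icc (0 : ℝ) 1) ((volume : Measure V).prod volume) :=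
      hc.continuousOn.integrableOn_compact ((isCompact_closedBall _ _).prod isCompact_Icc)
    have h2 : IntegrableOn (fun p : V × ℝ => F (rot J (c * p.2) p.1))
        (univ ×ˢ Icc (0 : ℝ) 1) ((volume : Measure V).prod volume) := by
      refine h1.of_forall_sdiff_eq_zero (MeasurableSet.univ.prod measurableSet_Icc) fun p hp => ?_
      refine hr _ ?_
      rw [norm_rot hJ]
      by_contra hlt
      exact hp.2 ⟨by simpa using not_lt.1 hlt, hp.1.2⟩
    exact h2.mono_set (prod_mono subset_rfl Ioc_subset_Icc_self)
  simp only [intervalIntegral.integral_of_le zero_le_one]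
  rw [integral_integral_swap hI]
  simp [hrot]

/-- The integral over the Liouville flow of a function which depends only on the radius is
preserved by symplectic maps of shells. -/
theorem IsSymplecticOn.integral_fderiv_apply_self [FiniteDimensional ℝ V] [MeasurableSpace V]
    [BorelSpace V] (hJ : IsOrthComplex J) (hd : 2 < Module.finrank ℝ V) {f : V → V} {N S : Set V}
    (h : IsSymplecticOn J f N) (hSN : S ⊆ N) (hS : IsOpen S)
    (hSr : ∀ w ∈ S, ∀ v, ‖v‖ = ‖w‖ → v ∈ S) {χ χ' : ℝ → ℝ} (hχ : ∀ s, HasDerivAt χ (χ' s) s)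
    (hχ' : Continuous χ') {s₁ s₂ : ℝ} (hs : ∀ s, χ' s ≠ 0 → s ∈ Icc s₁ s₂)
    (hsS : ∀ w : V, ‖w‖ ^ 2 ∈ Icc s₁ s₂ → w ∈ S) {u : V → ℝ} (hu : Differentiable ℝ u)
    (hu0 : ∀ z ∉ f '' S, fderiv ℝ u z = 0) (huf : ∀ w ∈ S, u (f w) = χ (‖w‖ ^ 2)) :
    ∫ z, fderiv ℝ u z z = ∫ w : V, fderiv ℝ (fun w => χ (‖w‖ ^ 2)) w w := by
  have hca : ∀ p ∈ S, ContDiffAt ℝ ∞ f p := fun p hp =>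
    h.contDiffOn.contDiffAt (h.isOpen.mem_nhds (hSN hp))
  have hfd : ∀ p ∈ S, HasFDerivAt f (fderiv ℝ f p) p := fun p hp =>
    ((hca p hp).differentiableAt (by simp)).hasFDerivAt
  have hχd : ∀ w : V, HasFDerivAt (fun w => χ (‖w‖ ^ 2)) (χ' (‖w‖ ^ 2) • (2 : ℝ) • innerSL ℝ w) w :=
    fun w => (hχ _).comp_hasFDerivAt w
      ((hasStrictFDerivAt_norm_sq w).hasFDerivAt.congr_fderiv (ofNat_smul_eq_nsmul ℝ 2 _).symm)
  set F : V → ℝ := fun w => 2 * χ' (‖w‖ ^ 2) * inner ℝ (J (f w)) (fderiv ℝ f w (J w)) with hF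
  have h1 : ∀ w ∈ S, fderiv ℝ u (f w) (f w) = F w := fun w hw => by
    have hsurj : Function.Surjective (fderiv ℝ f w : V →ₗ[ℝ] V) :=
      LinearMap.surjective_of_injective (injective_of_symplectic hJ (h.symp w (hSN hw)))
    obtain ⟨y, hy⟩ := hsurj (f w)
    replace hy : fderiv ℝ f w y = f w := hy
    have h2 : HasFDerivAt (fun w => u (f w)) ((fderiv ℝ u (f w)).comp (fderiv ℝ f w)) w :=
      (hu (f w)).hasFDerivAt.comp w (hfd w hw)
    have h3 : HasFDerivAt (fun w => u (f w)) (χ' (‖w‖ ^ 2) • (2 : ℝ) • innerSL ℝ w) w :=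
      (hχd w).congr_of_eventuallyEq (by
        filter_upwards [hS.mem_nhds hw] with v hv using huf v hv)
    have h4 := congrArg (fun L : V →L[ℝ] ℝ => L y) (h2.unique h3)
    simp only [ContinuousLinearMap.comp_apply, hy, smul_apply,
      innerSL_apply_apply, smul_eq_mul] at h4
    have h5 := h.symp w (hSN hw) y (J w)
    rw [hy, hJ.inner_apply_apply, real_inner_comm w y] at h5
    rw [h4, hF]
    simp only [h5]
    ring
  have hF0 : ∀ w ∉ S, F w = 0 := fun w hw => by
    have : χ' (‖w‖ ^ 2) = 0 := by
      by_contra hne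
      exact hw (hsS w (hs _ hne))
    simp [hF, this]
  have hdet : ∀ w ∈ S, |(fderiv ℝ f w).det| • fderiv ℝ u (f w) (f w) = F w := fun w hw => by
    rw [abs_det_of_symplectic hJ (h.symp w (hSN hw)), one_smul, h1 w hw]
  have hsuppF : ∀ w : V, ‖w‖ ^ 2 ∉ Icc s₁ s₂ → F w = 0 := fun w hw => by
    have : χ' (‖w‖ ^ 2) = 0 := by
      by_contra hne
      exact hw (hs _ hne)
    simp [hF, this]
  have hFc : Continuous F := continuous_iff_continuousAt.2 fun w => by
    by_cases hw : w ∈ S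
    · have c1 : ContinuousAt (fderiv ℝ f) w :=
        ((hca w hw).fderiv_right (m := 0) (by simp)).continuousAt
      have c2 : ContinuousAt f w := (hca w hw).continuousAt
      have c3 : ContinuousAt (fun w => fderiv ℝ f w (J w)) w := c1.clm_apply (by fun_prop)
      have c4 : ContinuousAt (fun w : V => χ' (‖w‖ ^ 2)) w := by fun_prop
      have c5 : ContinuousAt (fun w : V => J (f w)) w := by fun_prop
      exact (c4.const_mul 2).mul (c5.inner c3)
    · have hcl : IsClosed {w : V | ‖w‖ ^ 2 ∈ Icc s₁ s₂} :=
        isClosed_Icc.preimage (by fun_prop)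
      refine (continuousAt_const (y := (0 : ℝ))).congr ?_
      filter_upwards [hcl.isOpen_compl.mem_nhds fun hin => hw (hsS w hin)] with v hv
      exact (hsuppF v hv).symm
  rw [← setIntegral_eq_integral_of_forall_compl_eq_zero (s := f '' S) fun z hz => by
      rw [hu0 z hz]; rfl,
    integral_image_eq_integral_abs_det_fderiv_smul volume hS.measurableSet
      (fun w hw => (hfd w hw).hasFDerivWithinAt) (h.injOn.mono hSN),
    setIntegral_congr_fun hS.measurableSet hdet,
    setIntegral_eq_integral_of_forall_compl_eq_zero hF0,
    integral_eq_integral_average_rot hJ hFc (r := √s₂) (fun w hw => hsuppF w fun hin =>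
      (Real.lt_sq_of_sqrt_lt hw).not_ge hin.2) (2 * π * ((1 : ℤ) : ℝ))]
  refine integral_congr_ae (ae_of_all _ fun w => ?_)
  have hval : fderiv ℝ (fun w => χ (‖w‖ ^ 2)) w w = 2 * χ' (‖w‖ ^ 2) * ‖w‖ ^ 2 := by
    rw [(hχd w).fderiv]
    simp only [smul_apply, innerSL_apply_apply, smul_eq_mul,
      real_inner_self_eq_norm_sq]
    ring
  simp only [hval]
  by_cases hw : w ∈ S
  · have hH := integral_action_hopf_circle hJ hd (f := f) (w := w)
      (fun v hv => (hca v (hSr w hw v hv)).of_le (WithTop.coe_le_coe.2 (le_top : (2 : ℕ∞) ≤ ⊤)))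
      (fun v hv => h.symp v (hSN (hSr w hw v hv))) 1
    simp only [map_smul, inner_smul_right, intervalIntegral.integral_const_mul] at hH
    have hH' := mul_left_cancel₀ (by simp [pi_ne_zero]) hH
    simp only [hF, norm_rot hJ, intervalIntegral.integral_const_mul, hH']
  · have : χ' (‖w‖ ^ 2) = 0 := by
      by_contra hne
      exact hw (hsS w (hs _ hne))
    simp [hF, norm_rot hJ, this]

end Volume

section CollarVolume

variable {V : Type*} [NormedAddCommGroup V] [InnerProductSpace ℝ V] {J : V →L[ℝ] V}

/-- The open shell between the spheres of radii `r₁` and `r₂`. -/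
def openShell (V : Type*) [NormedAddCommGroup V] (r₁ r₂ : ℝ) : Set V := {w | r₁ < ‖w‖ ∧ ‖w‖ < r₂}

/-- The closed shell of points of squared norm between `s₁` and `s₂`. -/
def closedShell (V : Type*) [NormedAddCommGroup V] (s₁ s₂ : ℝ) : Set V := {w | ‖w‖ ^ 2 ∈ Icc s₁ s₂}

theorem isOpen_openShell {V : Type*} [NormedAddCommGroup V] (r₁ r₂ : ℝ) :
    IsOpen (openShell V r₁ r₂) :=
  (isOpen_lt continuous_const continuous_norm).inter (isOpen_lt continuous_norm continuous_const)

theorem isPreconnected_setOf_lt {q : V → ℝ} (hd : 1 < Module.rank ℝ V) (hq : Continuous q)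
    (hq0 : ∀ v, v ≠ 0 → 0 < q v) (hqs : ∀ (t : ℝ) v, q (t • v) = t ^ 2 * q v) {I : Set ℝ}
    (hI : I ⊆ Ioi 0) (hIc : IsPreconnected I) : IsPreconnected {v : V | √(q v) ∈ I} := by
  have h1 : IsPreconnected (sphere (0 : V) 1 ×ˢ I) := (isPreconnected_sphere hd 0 1).prod hIc
  have hpos : ∀ v ∈ sphere (0 : V) 1, 0 < √(q v) := fun v hv =>
    Real.sqrt_pos.2 (hq0 v fun h => by simp [h] at hv)
  convert h1.image (fun p : V × ℝ => (p.2 / √(q p.1)) • p.1) ?_ using 1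
  · ext v
    constructor
    · intro hv
      have hv0 : v ≠ 0 := by
        rintro rfl
        have h2 : q 0 = 0 := by simpa using hqs 0 0
        have h3 := hI hv
        simp [h2] at h3
      have hn : 0 < ‖v‖ := norm_pos_iff.2 hv0
      refine ⟨(‖v‖⁻¹ • v, √(q v)), ⟨?_, hv⟩, ?_⟩
      · simp [norm_smul, hn.ne']
      · have h4 : √(q (‖v‖⁻¹ • v)) = ‖v‖⁻¹ * √(q v) := by
          rw [hqs, Real.sqrt_mul (sq_nonneg _), Real.sqrt_sq (inv_nonneg.2 hn.le)]
        have h5 : √(q v) ≠ 0 := (hI hv).ne'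
        simp only [h4, smul_smul]
        field_simp
        simp
    · rintro ⟨⟨w, t⟩, ⟨hw, ht⟩, rfl⟩
      have ht0 : 0 < t := hI ht
      change √(q ((t / √(q w)) • w)) ∈ I
      rw [hqs, Real.sqrt_mul (sq_nonneg _), Real.sqrt_sq (div_pos ht0 (hpos w hw)).le,
        div_mul_cancel₀ _ (hpos w hw).ne']
      exact ht
  · refine ContinuousOn.smul (ContinuousOn.div (by fun_prop) (by fun_prop) ?_) (by fun_prop)
    exact fun p hp => (hpos p.1 hp.1).ne'

theorem isPreconnected_openShell (hd : 1 < Module.rank ℝ V) {r₁ r₂ : ℝ} (hr : 0 ≤ r₁) :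
    IsPreconnected (openShell V r₁ r₂) := by
  have h := isPreconnected_setOf_lt (V := V) (q := fun v => ‖v‖ ^ 2) hd (by fun_prop)
    (fun v hv => by positivity) (fun t v => by rw [norm_smul, mul_pow, norm_eq_abs, sq_abs])
    (I := Ioo r₁ r₂) (fun t ht => hr.trans_lt ht.1) isPreconnected_Ioo
  simp only [Real.sqrt_sq (norm_nonneg _), mem_Ioo] at h
  exact h

theorem isCompact_closedShell [FiniteDimensional ℝ V] (s₁ s₂ : ℝ) :
    IsCompact (closedShell V s₁ s₂) := by
  refine (isCompact_closedBall (0 : V) √s₂).of_isClosed_subset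
    (isClosed_Icc.preimage (by fun_prop)) fun w hw => ?_
  rw [mem_closedBall_zero_iff]
  exact Real.le_sqrt_of_sq_le hw.2

/-- A Hamiltonian which moves the Hopf circles of an embedded shell and which is constant on
both components of the complement of the shell. -/
theorem IsSymplecticOn.exists_collar_of_volume [FiniteDimensional ℝ V] [MeasurableSpace V]
    [BorelSpace V] (hJ : IsOrthComplex J) (hd : 2 < Module.finrank ℝ V) {f : V → V} {N : Set V}
    (h : IsSymplecticOn J f N) {r₁ r₂ s₁ s₂ η : ℝ} (hr₁ : 0 < r₁) (hη : 0 < η) (hs₁ : r₁ ^ 2 < s₁)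
    (hs : s₁ < s₂) (hs₂ : s₂ + η < r₂ ^ 2) (hr₂ : 0 < r₂) (hSN : openShell V r₁ r₂ ⊆ N)
    {O D : Set V} (hO : IsCompact O) (hOc : IsPreconnected Oᶜ)
    (hfO : f '' openShell V r₁ r₂ ⊆ O) (hD : IsOpen D) (hDc : IsPreconnected D)
    (hfD : Disjoint D (f '' openShell V r₁ r₂))
    (hvol : volume (O \ D) < volume (ball (0 : V) √s₁)) :
    ∃ u : V → ℝ, ContDiff ℝ ∞ u ∧ (∀ w ∈ openShell V r₁ r₂, u (f w) = cutoff η s₁ s₂ (‖w‖ ^ 2)) ∧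
      (∀ z ∉ f '' closedShell V s₁ (s₂ + η), fderiv ℝ u z = 0 ∧ (u z = 0 ∨ u z = 1)) ∧
      (∀ z ∈ D, u z = 0) ∧ ∀ z ∉ O, u z = 1 := by
  have hnt : Nontrivial V := Module.nontrivial_of_finrank_pos (R := ℝ) (by omega)
  have hrank : 1 < Module.rank ℝ V := by
    rw [← Module.finrank_eq_rank]
    exact_mod_cast (by omega : 1 < Module.finrank ℝ V)
  have hs₁0 : 0 < s₁ := (pow_pos hr₁ 2).trans hs₁
  set S := openShell V r₁ r₂
  set K := closedShell V s₁ (s₂ + η)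
  have hKS : K ⊆ S := fun w hw =>
    ⟨lt_of_pow_lt_pow_left₀ 2 (norm_nonneg _) (hs₁.trans_le hw.1),
      lt_of_pow_lt_pow_left₀ 2 hr₂.le (hw.2.trans_lt hs₂)⟩
  have hKne : K.Nonempty := by
    obtain ⟨w, hw⟩ := exists_norm_eq V (Real.sqrt_nonneg s₁)
    refine ⟨w, ?_⟩
    change ‖w‖ ^ 2 ∈ Icc s₁ (s₂ + η)
    rw [hw, Real.sq_sqrt hs₁0.le]
    constructor <;> linarith
  set ρ : V → ℝ := fun w => cutoff η s₁ s₂ (‖w‖ ^ 2) with hρ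
  have hρs : ContDiff ℝ ∞ ρ := (contDiff_cutoff).comp (contDiff_norm_sq ℝ)
  have hout : ∀ w ∉ K, ‖w‖ ^ 2 < s₁ ∨ s₂ + η < ‖w‖ ^ 2 := fun w hw => by
    by_contra! hc
    exact hw hc
  have hρv : ∀ w ∉ K, ρ w = 0 ∨ ρ w = 1 := fun w hw => (hout w hw).imp
    (fun h => cutoff_of_le hη hs h.le) fun h => cutoff_of_ge hη hs h.le
  obtain ⟨u, hus, huf, hud, huv⟩ := h.exists_collar hJ hSN (isOpen_openShell _ _)
    (isPreconnected_openShell hrank hr₁.le) (isCompact_closedShell s₁ (s₂ + η)) hKne hKS hρs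
    (fun w hw => hρv w hw.2) fun w hw => by
      have hd := (hasDerivAt_cutoff (s₁ := s₁) (s₂ := s₂) hη (‖w‖ ^ 2)).comp_hasFDerivAt w
        (hasStrictFDerivAt_norm_sq w).hasFDerivAt
      have h0 : cutoffSlope η s₁ s₂ (‖w‖ ^ 2) = 0 := (hout w hw.2).elim
        (fun h => cutoffSlope_of_le hη hs h.le) fun h => cutoffSlope_of_ge hη hs h.le
      rw [h0, zero_smul] at hd
      exact hd.fderiv
  have hKD : ∀ z ∈ D, z ∉ f '' K := fun z hz hK =>
    hfD.notMem_of_mem_left hz (image_mono hKS hK)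
  have hKO : ∀ z ∉ O, z ∉ f '' K := fun z hz hK => hz (hfO (image_mono hKS hK))
  have hu0 : ∀ z, 0 ≤ u z := fun z => by
    by_cases hz : z ∈ f '' K
    · obtain ⟨w, hw, rfl⟩ := hz
      rw [huf w (hKS hw)]
      exact cutoff_nonneg hη hs _
    · rcases huv z hz with h | h <;> simp [h]
  obtain ⟨c, hc⟩ := hO.isClosed.isOpen_compl.exists_is_const_of_fderiv_eq_zero (𝕜 := ℝ) hOc
    (hus.differentiable (by simp)).differentiableOn fun z hz => hud z (hKO z hz)
  obtain ⟨d, hdc⟩ := hD.exists_is_const_of_fderiv_eq_zero (𝕜 := ℝ) hDc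
    (hus.differentiable (by simp)).differentiableOn fun z hz => hud z (hKD z hz)
  have hvs : HasCompactSupport fun z => u z - c :=
    HasCompactSupport.intro hO fun z hz => by rw [hc z hz, sub_self]
  have hρ1 : HasCompactSupport fun w => ρ w - 1 :=
    HasCompactSupport.intro (isCompact_closedBall (0 : V) r₂) fun w hw => by
      have : r₂ ^ 2 ≤ ‖w‖ ^ 2 := by
        rw [mem_closedBall_zero_iff, not_le] at hw
        gcongr
      rw [hρ, sub_eq_zero]
      exact cutoff_of_ge hη hs (by linarith)
  have hInt : ∫ z, (u z - c) = ∫ w, (ρ w - 1) := by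
    have e1 := _root_.integral_fderiv_apply_self (hus.sub (contDiff_const (c := c))) hvs
    have e2 := _root_.integral_fderiv_apply_self (hρs.sub (contDiff_const (c := (1 : ℝ)))) hρ1
    have hcc : Continuous (cutoffSlope η s₁ s₂) :=
      ((contDiff_rampSlope.continuous.comp (continuous_id.sub continuous_const)).sub
        (contDiff_rampSlope.continuous.comp (continuous_id.sub continuous_const))).div_const _
    have e3 := h.integral_fderiv_apply_self hJ hd hSN (isOpen_openShell _ _)
      (fun w hw v hv => by simpa only [S, openShell, mem_ofPred_eq, hv] using hw)
      (hasDerivAt_cutoff hη) hcc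
      (s₁ := s₁) (s₂ := s₂ + η)
      (fun s hs0 => by
        by_contra hc
        rw [mem_Icc, not_and_or, not_le, not_le] at hc
        exact hs0 (hc.elim (fun h => cutoffSlope_of_le hη hs h.le) fun h =>
          cutoffSlope_of_ge hη hs h.le))
      (fun w hw => hKS hw) (hus.differentiable (by simp))
      (fun z hz => hud z fun hK => hz (image_mono hKS hK)) huf
    simp only [fderiv_sub_const] at e1 e2
    rw [e3] at e1
    have e4 := e1.symm.trans e2
    exact mul_left_cancel₀ (by positivity) (neg_injective e4)
  have hBfin : volume (ball (0 : V) √s₁) ≠ ⊤ := measure_ball_lt_top.ne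
  have hB : (volume (ball (0 : V) √s₁)).toReal ≤ ∫ w, (1 - ρ w) := by
    have e1 : ∫ w, (ball (0 : V) √s₁).indicator (fun _ => (1 : ℝ)) w
        = (volume (ball (0 : V) √s₁)).toReal := by
      rw [integral_indicator measurableSet_ball]
      simp [Measure.real]
    rw [← e1]
    refine integral_mono ((integrable_indicator_iff measurableSet_ball).2
      (integrableOn_const hBfin))
      ?_ fun w => ?_
    · have := ((hρs.continuous.sub continuous_const).integrable_of_hasCompactSupport
        (μ := volume) hρ1).neg
      exact this.congr (ae_of_all _ fun w => neg_sub _ _)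
    · by_cases hw : w ∈ ball (0 : V) √s₁
      · rw [indicator_of_mem hw]
        have : ρ w = 0 := cutoff_of_le hη hs (by
          rw [mem_ball_zero_iff] at hw
          exact (Real.lt_sqrt (norm_nonneg _)).1 hw |>.le)
        simp [this]
      · rw [indicator_of_notMem hw]
        exact sub_nonneg.2 (cutoff_le_one hη hs _)
  have hBpos : 0 < (volume (ball (0 : V) √s₁)).toReal :=
    ENNReal.toReal_pos (measure_ball_pos _ _ (Real.sqrt_pos.2 hs₁0)).ne' hBfin
  have hneg : ∫ z, (c - u z) = ∫ w, (1 - ρ w) := by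
    rw [← neg_inj, ← integral_neg, ← integral_neg]
    simpa only [neg_sub] using hInt
  have hc1 : ∀ z ∉ O, u z = 1 := fun z hz => by
    refine (huv z (hKO z hz)).resolve_left fun h0 => ?_
    have hc0 : c = 0 := by rw [← hc z hz, h0]
    have : ∫ z, (c - u z) ≤ 0 := integral_nonpos fun z => by
      change c - u z ≤ 0
      linarith [hu0 z]
    linarith
  refine ⟨u, hus, huf, fun z hz => ⟨hud z hz, huv z hz⟩, fun z hz => ?_, hc1⟩
  refine (huv z (hKD z hz)).resolve_right fun h1 => ?_
  have hc' : c = 1 := by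
    obtain ⟨y, hy⟩ : ∃ y, y ∉ O := by
      by_contra! hall
      exact noncompact_univ V (by rwa [← eq_univ_of_forall hall])
    rw [← hc y hy, hc1 y hy]
  have hd1 : ∀ y ∈ D, u y = 1 := fun y hy => by rw [hdc y hy, ← hdc z hz, h1]
  have hODfin : volume (O \ D) ≠ ⊤ := hvol.ne_top
  have hODm : MeasurableSet (O \ D) := hO.measurableSet.diff hD.measurableSet
  have hle : ∫ y, (c - u y) ≤ (volume (O \ D)).toReal := by
    have e1 : ∫ w, (O \ D).indicator (fun _ => (1 : ℝ)) w = (volume (O \ D)).toReal := by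
      rw [integral_indicator hODm]
      simp [Measure.real]
    rw [← e1]
    refine integral_mono ?_ ((integrable_indicator_iff hODm).2 (integrableOn_const hODfin))
      fun y => ?_
    · have := ((hus.continuous.sub continuous_const).integrable_of_hasCompactSupport
        (μ := volume) hvs).neg
      exact this.congr (ae_of_all _ fun w => neg_sub _ _)
    · change c - u y ≤ _
      by_cases hy : y ∈ O \ D
      · rw [indicator_of_mem hy]
        linarith [hu0 y]
      · rw [indicator_of_notMem hy, hc', sub_nonpos]
        by_cases hyO : y ∈ O
        · exact (hd1 y (by_contra fun hyD => hy ⟨hyO, hyD⟩)).ge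
        · exact (hc1 y hyO).ge
  have := (ENNReal.toReal_lt_toReal hODfin hBfin).2 hvol
  linarith

end CollarVolume

section ShellHamiltonian

variable {V : Type*} [NormedAddCommGroup V] [InnerProductSpace ℝ V]

/-- A smooth function `u` interpolating from `0` inside to `1` outside along a symplectic shell
lying between the ellipsoids `⟨K₁ z, z⟩ < 1` and `⟨K₂ z, z⟩ ≤ 1`. -/
structure IsCollar (J K₁ K₂ : V →L[ℝ] V) (f : V → V) (N : Set V) (r₁ r₂ s₁ s₂ η κ : ℝ)
    (u : V → ℝ) : Prop where
  complex : IsOrthComplex J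
  comm₁ : ∀ v, K₁ (J v) = J (K₁ v)
  comm₂ : ∀ v, K₂ (J v) = J (K₂ v)
  symm₁ : ∀ v w, inner ℝ (K₁ v) w = inner ℝ v (K₁ w)
  symm₂ : ∀ v w, inner ℝ (K₂ v) w = inner ℝ v (K₂ w)
  le : ∀ v, inner ℝ (K₂ v) v ≤ inner ℝ (K₁ v) v
  pos : 0 < κ
  lower : ∀ v, κ * ‖v‖ ^ 2 ≤ inner ℝ (K₂ v) v
  symplectic : IsSymplecticOn J f N
  subset : openShell V r₁ r₂ ⊆ N
  radius₁ : 0 < r₁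
  radius₂ : 0 < r₂
  width_pos : 0 < η
  width_lt : η < 1
  lt₁ : r₁ ^ 2 < s₁
  lt : s₁ < s₂
  lt₂ : s₂ + η < r₂ ^ 2
  one_le : ∀ w ∈ openShell V r₁ r₂, 1 ≤ inner ℝ (K₁ (f w)) (f w)
  le_one : ∀ w ∈ openShell V r₁ r₂, inner ℝ (K₂ (f w)) (f w) ≤ 1
  contDiff : ContDiff ℝ ∞ u
  apply_shell : ∀ w ∈ openShell V r₁ r₂, u (f w) = cutoff η s₁ s₂ (‖w‖ ^ 2)
  off_shell : ∀ z ∉ f '' closedShell V s₁ (s₂ + η), fderiv ℝ u z = 0 ∧ (u z = 0 ∨ u z = 1)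
  inside : ∀ z, inner ℝ (K₁ z) z < 1 → u z = 0
  outside : ∀ z, 1 < inner ℝ (K₂ z) z → u z = 1

theorem hasFDerivAt_inner_apply_self {K : V →L[ℝ] V}
    (hK : ∀ v w, inner ℝ (K v) w = inner ℝ v (K w)) (z : V) :
    HasFDerivAt (fun z => inner ℝ (K z) z) ((2 : ℝ) • innerSL ℝ (K z)) z := by
  refine (K.hasFDerivAt.inner ℝ (hasFDerivAt_id z)).congr_fderiv ?_
  ext v
  simp only [ContinuousLinearMap.comp_apply, ContinuousLinearMap.prod_apply, fderivInnerCLM_apply,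
    _root_.smul_apply, innerSL_apply_apply, smul_eq_mul, id_eq, ContinuousLinearMap.id_apply, hK v]
  rw [real_inner_comm (K z) v]
  ring

theorem contDiff_inner_apply_self (K : V →L[ℝ] V) {n : WithTop ℕ∞} :
    ContDiff ℝ n fun z => inner ℝ (K z) z :=
  K.contDiff.inner ℝ contDiff_id

variable {J K₁ K₂ : V →L[ℝ] V} {f : V → V} {N : Set V} {r₁ r₂ s₁ s₂ η κ w τ α : ℝ} {u : V → ℝ}

theorem IsCollar.closedShell_subset (h : IsCollar J K₁ K₂ f N r₁ r₂ s₁ s₂ η κ u) :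
    closedShell V s₁ (s₂ + η) ⊆ openShell V r₁ r₂ := fun _ hw =>
  ⟨lt_of_pow_lt_pow_left₀ 2 (norm_nonneg _) (h.lt₁.trans_le hw.1),
    lt_of_pow_lt_pow_left₀ 2 h.radius₂.le (hw.2.trans_lt h.lt₂)⟩

theorem IsCollar.fderiv_eq_zero_of_lt (h : IsCollar J K₁ K₂ f N r₁ r₂ s₁ s₂ η κ u) {z : V}
    (hz : inner ℝ (K₁ z) z < 1 ∨ 1 < inner ℝ (K₂ z) z) : fderiv ℝ u z = 0 := by
  refine (h.off_shell z ?_).1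
  rintro ⟨w, hw, rfl⟩
  have hw' := h.closedShell_subset hw
  rcases hz with hz | hz
  · exact (h.one_le w hw').not_gt hz
  · exact (h.le_one w hw').not_gt hz

/-- The Hamiltonian with a well of depth `w` inside, a step of height `τ` along the shell and
quadratic growth with coefficient `α` outside. -/
def shellH (K₁ K₂ : V →L[ℝ] V) (u : V → ℝ) (w τ α η : ℝ) (z : V) : ℝ :=
  -(w * rampScaled η (1 - inner ℝ (K₁ z) z)) + τ * u z + α * rampScaled η (inner ℝ (K₂ z) z - 1)

theorem IsCollar.shellH_zero (h : IsCollar J K₁ K₂ f N r₁ r₂ s₁ s₂ η κ u) :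
    shellH K₁ K₂ u w τ α η 0 = -(w * rampScaled η 1) := by
  have hη := h.width_pos
  rw [shellH, h.inside 0 (by simp)]
  simp [rampScaled_of_nonpos hη]

theorem IsCollar.exists_pos_norm_le (h : IsCollar J K₁ K₂ f N r₁ r₂ s₁ s₂ η κ u) :
    ∃ δ > 0, ∀ z : V, ‖z‖ ≤ δ → inner ℝ (K₁ z) z ≤ 1 - η := by
  have h1 : 0 < (1 - η) / (‖K₁‖ + 1) :=
    div_pos (sub_pos.2 h.width_lt) (by positivity)
  refine ⟨√((1 - η) / (‖K₁‖ + 1)), Real.sqrt_pos.2 h1, fun z hz => ?_⟩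
  rw [Real.le_sqrt (norm_nonneg _) h1.le, le_div_iff₀ (by positivity)] at hz
  calc inner ℝ (K₁ z) z ≤ ‖K₁ z‖ * ‖z‖ := real_inner_le_norm _ _
    _ ≤ ‖K₁‖ * ‖z‖ * ‖z‖ := by gcongr; exact K₁.le_opNorm z
    _ ≤ ‖z‖ ^ 2 * (‖K₁‖ + 1) := by nlinarith [sq_nonneg ‖z‖]
    _ ≤ 1 - η := hz

variable [CompleteSpace V]

/-- The gradient of `shellH`. -/
def shellG (K₁ K₂ : V →L[ℝ] V) (u : V → ℝ) (w τ α η : ℝ) (z : V) : V :=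
  (2 * (w * rampSlope η (1 - inner ℝ (K₁ z) z))) • K₁ z
    + τ • (InnerProductSpace.toDual ℝ V).symm (fderiv ℝ u z)
    + (2 * (α * rampSlope η (inner ℝ (K₂ z) z - 1))) • K₂ z

theorem IsCollar.hasFDerivAt_shellH (h : IsCollar J K₁ K₂ f N r₁ r₂ s₁ s₂ η κ u) (z : V) :
    HasFDerivAt (shellH K₁ K₂ u w τ α η) (innerSL ℝ (shellG K₁ K₂ u w τ α η z)) z := by
  have h1 := (hasFDerivAt_inner_apply_self h.symm₁ z).const_sub 1
  have h2 := (hasFDerivAt_inner_apply_self h.symm₂ z).sub_const 1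
  have hu : HasFDerivAt u (fderiv ℝ u z) z :=
    (h.contDiff.differentiable (by simp) z).hasFDerivAt
  have := (((((hasDerivAt_rampScaled h.width_pos _).comp_hasFDerivAt z h1).const_mul w).neg.add
    (hu.const_mul τ)).add
      (((hasDerivAt_rampScaled h.width_pos _).comp_hasFDerivAt z h2).const_mul α))
  refine this.congr_fderiv ?_
  ext v
  simp only [shellG, innerSL_apply_apply, inner_add_left, real_inner_smul_left,
    InnerProductSpace.toDual_symm_apply, _root_.smul_apply, _root_.add_apply, _root_.neg_apply,
    smul_eq_mul]
  ring

theorem IsCollar.isNonresonant (h : IsCollar J K₁ K₂ f N r₁ r₂ s₁ s₂ η κ u)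
    [FiniteDimensional ℝ V] {c : ℝ} (hc : 0 < c)
    (hres : ∀ (k : ℤ) v, c * (1 + |(k : ℝ)|) * ‖v‖ ≤
      ‖(2 * π * k : ℝ) • v - (2 : ℝ) • (α • K₂) v‖) :
    ∃ Λ B, IsNonresonant J (α • K₂) (shellH K₁ K₂ u w τ α η) (shellG K₁ K₂ u w τ α η) Λ B c := by
  set P : V → V := fun z => shellG K₁ K₂ u w τ α η z - (2 : ℝ) • (α • K₂) z with hP
  have hPe : ∀ z, P z = shellG K₁ K₂ u w τ α η z - (2 : ℝ) • (α • K₂) z := fun z => rfl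
  have hPs : ∀ z ∉ closedBall (0 : V) (√((1 + η) / κ)), P z = 0 := fun z hz => by
    have hz2 : 1 + η < inner ℝ (K₂ z) z := by
      rw [mem_closedBall, dist_zero_right, not_le] at hz
      rw [Real.sqrt_lt' ((Real.sqrt_nonneg _).trans_lt hz), div_lt_iff₀ h.pos] at hz
      linarith [h.lower z]
    have hη := h.width_pos
    have hz1 := h.le z
    rw [hPe, shellG, h.fderiv_eq_zero_of_lt (Or.inr (by linarith)), map_zero,
      rampSlope_of_nonpos hη (by linarith), rampSlope_of_le hη (by linarith), _root_.smul_apply]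
    module
  have hPc : HasCompactSupport P :=
    HasCompactSupport.intro (isCompact_closedBall (0 : V) _) hPs
  have hPd : ContDiff ℝ 1 P := by
    have hu : ContDiff ℝ 1 fun z => (InnerProductSpace.toDual ℝ V).symm (fderiv ℝ u z) :=
      (InnerProductSpace.toDual ℝ V).symm.toContinuousLinearEquiv.contDiff.comp
        (h.contDiff.fderiv_right (by
          rw [one_add_one_eq_two]
          exact WithTop.coe_le_coe.2 (le_top : (2 : ℕ∞) ≤ ⊤)))
    have hs : ContDiff ℝ 1 (rampSlope η) := contDiff_rampSlope.of_le (by simp)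
    have h1 := hs.comp ((contDiff_const (c := (1 : ℝ))).sub (contDiff_inner_apply_self K₁))
    have h2 := hs.comp ((contDiff_inner_apply_self K₂).sub (contDiff_const (c := (1 : ℝ))))
    exact (((contDiff_const.mul (contDiff_const.mul h1)).smul K₁.contDiff).add
      (contDiff_const.smul hu)).add ((contDiff_const.mul (contDiff_const.mul h2)).smul K₂.contDiff)
      |>.sub (contDiff_const.smul (α • K₂).contDiff)
  obtain ⟨Λ, hΛ⟩ := hPd.lipschitzWith_of_hasCompactSupport hPc one_ne_zero
  obtain ⟨B, hB⟩ := hPc.exists_bound_of_continuous hPd.continuous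
  refine ⟨Λ + ‖(2 : ℝ) • (α • K₂)‖, B, h.complex, h.hasFDerivAt_shellH, fun z y => ?_,
    by positivity, fun v => by simp [h.comm₂], hB, hc, hres⟩
  have h3 : shellG K₁ K₂ u w τ α η z - shellG K₁ K₂ u w τ α η y
      = (P z - P y) + ((2 : ℝ) • (α • K₂)) (z - y) := by
    have e : ∀ v, ((2 : ℝ) • (α • K₂)) v = (2 : ℝ) • (α • K₂) v := fun _ => rfl
    rw [hPe, hPe, map_sub, e, e]
    abel
  rw [h3, add_mul]
  exact (norm_add_le _ _).trans (add_le_add (hΛ.norm_sub_le z y)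
    (((2 : ℝ) • (α • K₂)).le_opNorm (z - y)))

theorem IsCollar.shellH_eq_of_norm_le (h : IsCollar J K₁ K₂ f N r₁ r₂ s₁ s₂ η κ u) {z : V}
    (hz : inner ℝ (K₁ z) z ≤ 1 - η) :
    shellH K₁ K₂ u w τ α η z = shellH K₁ K₂ u w τ α η 0 + inner ℝ ((w • K₁) z) z ∧
      shellG K₁ K₂ u w τ α η z = (2 : ℝ) • (w • K₁) z := by
  have hη := h.width_pos
  have h1 := h.le z
  have h2 := rampScaled_sub_of_le (s := 1) hη h.width_lt.le
  have h3 := rampScaled_sub_of_le (s := 1 - inner ℝ (K₁ z) z) hη (by linarith)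
  constructor
  · rw [h.shellH_zero, shellH, h.inside z (by linarith), _root_.smul_apply,
      real_inner_smul_left, rampScaled_of_nonpos hη (s := inner ℝ (K₂ z) z - 1) (by linarith),
      h2, h3]
    ring
  · rw [shellG, h.fderiv_eq_zero_of_lt (Or.inl (by linarith)), map_zero, _root_.smul_apply,
      rampSlope_of_le hη (by linarith), rampSlope_of_nonpos hη (s := inner ℝ (K₂ z) z - 1)
      (by linarith)]
    module

/-- The point `z` does not lie on a nonconstant orbit of period one whose action is in
`Icc A C`. -/
def HasExcludedAction (J : V →L[ℝ] V) (H : V → ℝ) (G : V → V) (A C : ℝ) (z : V) : Prop :=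
  ∃ y : ℝ → V, y 0 = z ∧ (∀ t, HasDerivAt y (J (G (y t))) t) ∧ (y 0 = y 1 → (∀ t, y t = 0) ∨
    ∫ t in (0 : ℝ)..1, (1 / 2 * inner ℝ (G (y t)) (y t) - H (y t)) ∉ Icc A C)

theorem IsCollar.hasExcludedAction_inside (h : IsCollar J K₁ K₂ f N r₁ r₂ s₁ s₂ η κ u)
    (hw : 0 < w) (hres : ∀ (k : ℤ) v, (2 * π * k : ℝ) • v = (2 : ℝ) • (w • K₁) v → v = 0)
    (C : ℝ) {z : V} (hz : inner ℝ (K₁ z) z < 1) :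
    HasExcludedAction J (shellH K₁ K₂ u w τ α η) (shellG K₁ K₂ u w τ α η) (w * rampScaled η 1) C
      z := by
  have hη := h.width_pos
  set s := 1 - inner ℝ (K₁ z) z with hs
  obtain ⟨y, hy0, hy, hyK⟩ := exists_linear_flow h.complex h.symm₁ (w * rampSlope η s) z
  have hG : ∀ t, shellG K₁ K₂ u w τ α η (y t) = (2 * (w * rampSlope η s)) • K₁ (y t) := fun t => by
    have h1 := h.le (y t)
    have h2 := hyK t
    rw [shellG, h.fderiv_eq_zero_of_lt (Or.inl (by linarith)), map_zero, smul_zero,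
      rampSlope_of_nonpos hη (s := inner ℝ (K₂ (y t)) (y t) - 1) (by linarith), h2]
    simp [hs]
  have hH : ∀ t, shellH K₁ K₂ u w τ α η (y t) = -(w * rampScaled η s) := fun t => by
    have h1 := h.le (y t)
    have h2 := hyK t
    rw [shellH, h.inside _ (by linarith),
      rampScaled_of_nonpos hη (s := inner ℝ (K₂ (y t)) (y t) - 1) (by linarith), h2]
    simp [hs]
  refine ⟨y, hy0, fun t => by rw [hG]; exact hy t, fun h01 => ?_⟩
  rcases (rampSlope_le_one (η := η) s).lt_or_eq with hlt | heq
  · right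
    simp only [hG, hH, real_inner_smul_left, hyK, intervalIntegral.integral_const, sub_zero,
      one_smul, mem_Icc, not_and_or, not_le]
    left
    have h1 := mul_lt_mul_of_pos_left (rampSlope_mul_add_lt hη h.width_lt hlt) hw
    have h2 : inner ℝ (K₁ z) z = 1 - s := by rw [hs]; ring
    rw [h2]
    linarith
  · left
    have h1 : z = 0 := by
      rw [← hy0]
      refine eq_zero_of_linear_periodic (K := w • K₁) h.complex (fun v => by simp [h.comm₁]) hres
        (fun t => (hy t).congr_deriv ?_) h01
      rw [heq, _root_.smul_apply, smul_smul, mul_one]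
    intro t
    have h2 := hyK t
    rw [h1, map_zero, inner_zero_left] at h2
    have h3 := h.lower (y t)
    have h4 := h.le (y t)
    have h5 : ‖y t‖ ^ 2 ≤ 0 := by
      by_contra! h6
      have := mul_pos h.pos h6
      linarith
    simpa using le_antisymm h5 (sq_nonneg _)

theorem IsCollar.hasExcludedAction_outside (h : IsCollar J K₁ K₂ f N r₁ r₂ s₁ s₂ η κ u)
    (hα : 0 < α) {A : ℝ} (hA : α * (1 + η) - τ < A) (C : ℝ) {z : V}
    (hz : 1 < inner ℝ (K₂ z) z) :
    HasExcludedAction J (shellH K₁ K₂ u w τ α η) (shellG K₁ K₂ u w τ α η) A C z := by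
  have hη := h.width_pos
  set s := inner ℝ (K₂ z) z - 1 with hs
  obtain ⟨y, hy0, hy, hyK⟩ := exists_linear_flow h.complex h.symm₂ (α * rampSlope η s) z
  have hG : ∀ t, shellG K₁ K₂ u w τ α η (y t) = (2 * (α * rampSlope η s)) • K₂ (y t) := fun t => by
    have h1 := h.le (y t)
    have h2 := hyK t
    rw [shellG, h.fderiv_eq_zero_of_lt (Or.inr (by linarith)), map_zero, smul_zero,
      rampSlope_of_nonpos hη (s := 1 - inner ℝ (K₁ (y t)) (y t)) (by linarith), h2]
    simp [hs]
  have hH : ∀ t, shellH K₁ K₂ u w τ α η (y t) = τ + α * rampScaled η s := fun t => by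
    have h1 := h.le (y t)
    have h2 := hyK t
    rw [shellH, h.outside _ (by linarith),
      rampScaled_of_nonpos hη (s := 1 - inner ℝ (K₁ (y t)) (y t)) (by linarith), h2]
    simp [hs]
  refine ⟨y, hy0, fun t => by rw [hG]; exact hy t, fun _ => Or.inr ?_⟩
  simp only [hG, hH, real_inner_smul_left, hyK, intervalIntegral.integral_const, sub_zero,
    one_smul, mem_Icc, not_and_or, not_le]
  left
  have h1 := mul_le_mul_of_nonneg_left (rampSlope_mul_sub_le hη (by linarith : 0 ≤ s)) hα.le
  have h3 := mul_le_mul_of_nonneg_left (rampSlope_le_one (η := η) s) hα.le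
  have h2 : inner ℝ (K₂ z) z = 1 + s := by rw [hs]; ring
  rw [h2]
  linarith

theorem IsCollar.hasExcludedAction_const (h : IsCollar J K₁ K₂ f N r₁ r₂ s₁ s₂ η κ u)
    (hτ : 0 ≤ τ) {A : ℝ} (hA : 0 < A) (C : ℝ) {z : V} (hz₁ : 1 ≤ inner ℝ (K₁ z) z)
    (hz₂ : inner ℝ (K₂ z) z ≤ 1) (hz : z ∉ f '' openShell V r₁ r₂) :
    HasExcludedAction J (shellH K₁ K₂ u w τ α η) (shellG K₁ K₂ u w τ α η) A C z := by
  have hη := h.width_pos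
  obtain ⟨hu, hu'⟩ := h.off_shell z fun hz' => hz (image_mono h.closedShell_subset hz')
  have hG : shellG K₁ K₂ u w τ α η z = 0 := by
    rw [shellG, hu, rampSlope_of_nonpos hη (s := 1 - inner ℝ (K₁ z) z) (by linarith),
      rampSlope_of_nonpos hη (s := inner ℝ (K₂ z) z - 1) (by linarith)]
    simp
  have hH : shellH K₁ K₂ u w τ α η z = τ * u z := by
    rw [shellH, rampScaled_of_nonpos hη (s := 1 - inner ℝ (K₁ z) z) (by linarith),
      rampScaled_of_nonpos hη (s := inner ℝ (K₂ z) z - 1) (by linarith)]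
    simp
  refine ⟨fun _ => z, rfl, fun t => ?_, fun _ => Or.inr ?_⟩
  · simp only [hG, map_zero]
    exact hasDerivAt_const t z
  · simp only [hG, hH, inner_zero_left, intervalIntegral.integral_const, sub_zero,
      one_smul, mem_Icc, not_and_or, not_le]
    left
    rcases hu' with h0 | h0 <;> rw [h0] <;> linarith

end ShellHamiltonian

section ShellSpectrum

variable {V : Type*} [NormedAddCommGroup V] [InnerProductSpace ℝ V] [FiniteDimensional ℝ V]
  {J K₁ K₂ : V →L[ℝ] V} {f : V → V} {N : Set V} {r₁ r₂ s₁ s₂ η κ w τ α : ℝ} {u : V → ℝ}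

theorem IsCollar.apply_gradient [CompleteSpace V]
    (h : IsCollar J K₁ K₂ f N r₁ r₂ s₁ s₂ η κ u) {v : V}
    (hv : v ∈ openShell V r₁ r₂) :
    J ((InnerProductSpace.toDual ℝ V).symm (fderiv ℝ u (f v)))
      = fderiv ℝ f v ((2 * cutoffSlope η s₁ s₂ (‖v‖ ^ 2)) • J v) := by
  have hJ := h.complex
  have hs := h.symplectic.symp v (h.subset hv)
  have hsurj := LinearMap.injective_iff_surjective.1
    (show Function.Injective (fderiv ℝ f v : V →ₗ[ℝ] V) from injective_of_symplectic hJ hs)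
  have hf : HasFDerivAt f (fderiv ℝ f v) v :=
    ((h.symplectic.contDiffOn.contDiffAt (h.symplectic.isOpen.mem_nhds
      (h.subset hv))).differentiableAt
      (by simp)).hasFDerivAt
  have hu : HasFDerivAt u (fderiv ℝ u (f v)) (f v) :=
    (h.contDiff.differentiable (by simp) _).hasFDerivAt
  have h1 := hu.comp v hf
  have h2 := (hasDerivAt_cutoff (s₁ := s₁) (s₂ := s₂) h.width_pos (‖v‖ ^ 2)).comp_hasFDerivAt v
    ((hasStrictFDerivAt_norm_sq v).hasFDerivAt)
  have h3 : (u ∘ f) =ᶠ[𝓝 v] (cutoff η s₁ s₂ ∘ fun w => ‖w‖ ^ 2) :=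
    Filter.eventually_of_mem ((isOpen_openShell r₁ r₂).mem_nhds hv) fun w hw => h.apply_shell w hw
  have h4 := (h2.congr_of_eventuallyEq h3).unique h1
  have h5 : (InnerProductSpace.toDual ℝ V).symm (fderiv ℝ u (f v))
      = -J (fderiv ℝ f v ((2 * cutoffSlope η s₁ s₂ (‖v‖ ^ 2)) • J v)) := by
    refine ext_inner_right ℝ fun x => ?_
    obtain ⟨c, hc⟩ := hsurj x
    replace hc : fderiv ℝ f v c = x := hc
    rw [← hc, inner_neg_left, hs, map_smul, hJ.sq, InnerProductSpace.toDual_symm_apply]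
    have := DFunLike.congr_fun h4 c
    rw [ContinuousLinearMap.comp_apply] at this
    rw [← this]
    simp only [_root_.smul_apply, innerSL_apply_apply, smul_eq_mul, real_inner_smul_left,
      inner_neg_left, smul_neg, nsmul_eq_mul]
    push_cast
    ring
  rw [h5, map_neg, hJ.sq, neg_neg]

theorem IsCollar.hasExcludedAction_shell [CompleteSpace V]
    (h : IsCollar J K₁ K₂ f N r₁ r₂ s₁ s₂ η κ u)
    (hd : 2 < Module.finrank ℝ V) (hτ : 0 ≤ τ) {A C : ℝ} (hA : 0 < A) (hC : C < 2 * π * s₁ - τ)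
    (hone : ∀ s ∈ Icc s₁ (s₂ + η), τ * cutoffSlope η s₁ s₂ s = π →
      π * s - τ * cutoff η s₁ s₂ s < A ∨ C < π * s - τ * cutoff η s₁ s₂ s)
    {x : V} (hx : x ∈ openShell V r₁ r₂) :
    HasExcludedAction J (shellH K₁ K₂ u w τ α η) (shellG K₁ K₂ u w τ α η) A C (f x) := by
  have hη := h.width_pos
  have hJ := h.complex
  set s := ‖x‖ ^ 2 with hs
  set a := 2 * (τ * cutoffSlope η s₁ s₂ s) with ha
  have hn : ∀ t, ‖rot J (a * t) x‖ = ‖x‖ := fun t => norm_rot hJ _ _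
  have hmem : ∀ t, rot J (a * t) x ∈ openShell V r₁ r₂ := fun t => by
    rw [openShell, mem_ofPred_eq, hn]
    exact hx
  have hG : ∀ t, shellG K₁ K₂ u w τ α η (f (rot J (a * t) x))
      = τ • (InnerProductSpace.toDual ℝ V).symm (fderiv ℝ u (f (rot J (a * t) x))) := fun t => by
    have h1 := h.one_le _ (hmem t)
    have h2 := h.le_one _ (hmem t)
    rw [shellG, rampSlope_of_nonpos hη (by linarith), rampSlope_of_nonpos hη (by linarith)]
    simp
  have hH : ∀ t, shellH K₁ K₂ u w τ α η (f (rot J (a * t) x)) = τ * cutoff η s₁ s₂ s := fun t => by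
    have h1 := h.one_le _ (hmem t)
    have h2 := h.le_one _ (hmem t)
    rw [shellH, rampScaled_of_nonpos hη (by linarith), rampScaled_of_nonpos hη (by linarith),
      h.apply_shell _ (hmem t), hn]
    simp [hs]
  have hJG : ∀ t, J (shellG K₁ K₂ u w τ α η (f (rot J (a * t) x)))
      = fderiv ℝ f (rot J (a * t) x) (a • J (rot J (a * t) x)) := fun t => by
    rw [hG, map_smul, h.apply_gradient (hmem t), hn, ← map_smul, smul_smul, ha]
    congr 2
    ring
  have hdf : ∀ v ∈ openShell V r₁ r₂, ContDiffAt ℝ ∞ f v := fun v hv =>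
    h.symplectic.contDiffOn.contDiffAt (h.symplectic.isOpen.mem_nhds (h.subset hv))
  refine ⟨fun t => f (rot J (a * t) x), by simp [rot_zero], fun t => ?_, fun h01 => Or.inr ?_⟩
  · refine (((hdf _ (hmem t)).differentiableAt (by simp)).hasFDerivAt.comp_hasDerivAt t
      (hasDerivAt_rot hJ a t x)).congr_deriv ?_
    exact (hJG t).symm
  have hper := h.symplectic.injOn (h.subset (hmem 0)) (h.subset (hmem 1)) h01
  rw [mul_zero, rot_zero, mul_one] at hper
  have hs0 : 0 < s := pow_pos (h.radius₁.trans hx.1) 2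
  have hcos : cos a = 1 := by
    have h1 : inner ℝ (rot J a x) x = cos a * s := by
      rw [rot_apply, inner_add_left, real_inner_smul_left, real_inner_smul_left,
        hJ.inner_apply_self, real_inner_self_eq_norm_sq]
      ring
    rw [← hper, real_inner_self_eq_norm_sq] at h1
    exact (mul_right_cancel₀ hs0.ne' (by rw [one_mul]; exact h1)).symm
  obtain ⟨k, hk⟩ := (Real.cos_eq_one_iff a).1 hcos
  have hak : a = 2 * π * k := by rw [← hk]; ring
  have hInt : ∫ t in (0 : ℝ)..1, (1 / 2 * inner ℝ (shellG K₁ K₂ u w τ α η (f (rot J (a * t) x)))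
      (f (rot J (a * t) x)) - shellH K₁ K₂ u w τ α η (f (rot J (a * t) x)))
      = π * k * s - τ * cutoff η s₁ s₂ s := by
    have h1 := integral_action_hopf_circle hJ hd (f := f) (w := x)
      (fun v hv => (hdf v (by rw [openShell, mem_ofPred_eq, hv]; exact hx)).of_le
        (WithTop.coe_le_coe.2 (le_top : (2 : ℕ∞) ≤ ⊤)))
      (fun v hv => h.symplectic.symp v (h.subset (by rw [openShell, mem_ofPred_eq, hv]; exact hx)))
        k
    rw [← hak] at h1
    have h2 : ∀ t, inner ℝ (shellG K₁ K₂ u w τ α η (f (rot J (a * t) x))) (f (rot J (a * t) x))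
        = inner ℝ (J (f (rot J (a * t) x)))
          (fderiv ℝ f (rot J (a * t) x) (a • J (rot J (a * t) x))) := fun t => by
      rw [← hJG, hJ.inner_apply_apply, real_inner_comm]
    have hci : Continuous fun t => inner ℝ (J (f (rot J (a * t) x)))
        (fderiv ℝ f (rot J (a * t) x) (a • J (rot J (a * t) x))) := by
      have hr : Continuous fun t => rot J (a * t) x :=
        continuous_iff_continuousAt.2 fun t => (hasDerivAt_rot hJ a t x).continuousAt
      have hfc : Continuous fun t => f (rot J (a * t) x) := continuous_iff_continuousAt.2 fun t =>
        ContinuousAt.comp (g := f) (hdf _ (hmem t)).continuousAt hr.continuousAt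
      have hfd : Continuous fun t => fderiv ℝ f (rot J (a * t) x) :=
        continuous_iff_continuousAt.2 fun t => ContinuousAt.comp (g := fderiv ℝ f)
          (((hdf _ (hmem t)).fderiv_right (m := 0) (by simp)).continuousAt) hr.continuousAt
      exact (J.continuous.comp hfc).inner (hfd.clm_apply ((J.continuous.comp hr).const_smul a))
    have hI : IntervalIntegrable (fun t => 1 / 2 * inner ℝ (J (f (rot J (a * t) x)))
        (fderiv ℝ f (rot J (a * t) x) (a • J (rot J (a * t) x)))) volume 0 1 :=
      (continuous_const.mul hci).intervalIntegrable _ _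
    simp only [h2, hH]
    rw [intervalIntegral.integral_sub hI intervalIntegrable_const,
      intervalIntegral.integral_const_mul, h1,
      intervalIntegral.integral_const]
    simp only [sub_zero, one_smul, hs]
    rw [hak]
    ring
  rw [hInt, mem_Icc, not_and_or, not_le, not_le]
  have hρ0 := cutoff_nonneg hη h.lt s
  have hρ1 := cutoff_le_one hη h.lt s
  have hρ' := cutoffSlope_nonneg hη h.lt s
  have hk0 : (0 : ℝ) ≤ k := by
    have : 0 ≤ a := by positivity
    rw [hak] at this
    exact nonneg_of_mul_nonneg_right this (by positivity)
  have hk0' : 0 ≤ k := by exact_mod_cast hk0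
  have hτk : τ * cutoffSlope η s₁ s₂ s = π * k := by linarith
  rcases hk0'.eq_or_lt with hk1 | hk1
  · left
    rw [← hk1]
    have := mul_nonneg hτ hρ0
    push_cast
    linarith
  have hsI : s ∈ Icc s₁ (s₂ + η) := by
    have hne : cutoffSlope η s₁ s₂ s ≠ 0 := fun h0 => by
      rw [h0, mul_zero] at hτk
      have : (0 : ℝ) < k := by exact_mod_cast hk1
      have := mul_pos Real.pi_pos this
      linarith
    constructor
    · by_contra! hlt
      exact hne (cutoffSlope_of_le hη h.lt hlt.le)
    · by_contra! hlt
      exact hne (cutoffSlope_of_ge hη h.lt hlt.le)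
  rcases (show (1 : ℤ) ≤ k by omega).eq_or_lt with hk2 | hk2
  · rw [← hk2] at hτk ⊢
    rw [Int.cast_one, mul_one] at hτk ⊢
    exact hone s hsI hτk
  · right
    have hk3 : (2 : ℝ) ≤ k := by exact_mod_cast (show (2 : ℤ) ≤ k by omega)
    have h1 := mul_le_mul_of_nonneg_left hρ1 hτ
    have hs1 : 0 < s₁ := (pow_pos h.radius₁ 2).trans h.lt₁
    have h2 : 2 * s₁ ≤ k * s := mul_le_mul hk3 hsI.1 hs1.le hk0
    have h3 := mul_le_mul_of_nonneg_left h2 Real.pi_pos.le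
    linarith

/-- The shell Hamiltonian has no nonconstant one-periodic orbit in the relevant action window, so
its Galerkin approximations cannot all have critical points there. -/
theorem IsCollar.false_of_galerkin [CompleteSpace V] {Λ B c : ℝ}
    (h : IsCollar J K₁ K₂ f N r₁ r₂ s₁ s₂ η κ u)
    (hd : 2 < Module.finrank ℝ V) (hw : 0 < w) (hτ : 0 ≤ τ) (hα : 0 < α)
    (hnr : IsNonresonant J (α • K₂) (shellH K₁ K₂ u w τ α η) (shellG K₁ K₂ u w τ α η) Λ B c)
    (hres : ∀ (k : ℤ) v, (2 * π * k : ℝ) • v = (2 : ℝ) • (w • K₁) v → v = 0)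
    (hC : α * (1 + η) < 2 * π * s₁ - τ)
    (hone : ∀ s ∈ Icc s₁ (s₂ + η), τ * cutoffSlope η s₁ s₂ s = π →
      π * s - τ * cutoff η s₁ s₂ s < w * rampScaled η 1 ∨
        α * (1 + η) < π * s - τ * cutoff η s₁ s₂ s)
    (hout : α * (1 + η) - τ < w * rampScaled η 1)
    (hcrit : ∀ m : ℕ, ∃ v : FourierLoop V (Finset.Icc (-m : ℤ) (m + 1)),
      galG J (shellG K₁ K₂ u w τ α η) _ v = 0 ∧
      -shellH K₁ K₂ u w τ α η 0 < galA J (shellH K₁ K₂ u w τ α η) _ v ∧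
      galA J (shellH K₁ K₂ u w τ α η) _ v ≤ α * (1 + η)) : False := by
  have hη := h.width_pos
  have hσ : 0 < rampScaled η 1 := by
    have := sub_le_rampScaled hη 1
    linarith [h.width_lt]
  have hA : 0 < w * rampScaled η 1 := mul_pos hw hσ
  obtain ⟨δ, hδ, hδ'⟩ := h.exists_pos_norm_le
  obtain ⟨x, hxc, ⟨t₀, ht₀, hx0⟩, hper, hxe, hlo, hhi⟩ := exists_periodic_orbit_of_galerkin hnr
    (K₀ := w • K₁) (fun v => by simp [h.comm₁]) hδ
    (fun z hz => (h.shellH_eq_of_norm_le (hδ' z hz)).2) hres hcrit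
  rw [h.shellH_zero, neg_neg] at hlo
  obtain ⟨y, hy0, hy, hye⟩ : HasExcludedAction J (shellH K₁ K₂ u w τ α η)
      (shellG K₁ K₂ u w τ α η) (w * rampScaled η 1) (α * (1 + η)) (x 0) := by
    rcases lt_or_ge (inner ℝ (K₁ (x 0)) (x 0)) 1 with h1 | h1
    · exact h.hasExcludedAction_inside hw hres _ h1
    rcases lt_or_ge 1 (inner ℝ (K₂ (x 0)) (x 0)) with h2 | h2
    · exact h.hasExcludedAction_outside hα hout _ h2
    by_cases h3 : x 0 ∈ f '' openShell V r₁ r₂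
    · obtain ⟨p, hp, hpx⟩ := h3
      rw [← hpx]
      exact h.hasExcludedAction_shell hd hτ hA hC hone hp
    · exact h.hasExcludedAction_const hτ hA _ h1 h2 h3
  have hJG : ∀ z p, ‖J (shellG K₁ K₂ u w τ α η z) - J (shellG K₁ K₂ u w τ α η p)‖ ≤ Λ * ‖z - p‖ :=
    fun z p => by
      rw [← map_sub, h.complex.norm_apply]
      exact hnr.lipschitz z p
  have hxy : ∀ t ∈ Icc (0 : ℝ) 1, x t = y t := fun t ht =>
    eqOn_of_integral_eq (F := fun z => J (shellG K₁ K₂ u w τ α η z))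
      hnr.nonneg hJG hxc hxe hy0 hy ht
  rcases hye (by rw [← hxy 0 (by simp), ← hxy 1 (by simp), hper]) with h0 | h0
  · exact hx0 ((hxy _ ht₀).trans (h0 _))
  · refine h0 ?_
    have : ∫ t in (0 : ℝ)..1, (1 / 2 * inner ℝ (shellG K₁ K₂ u w τ α η (y t)) (y t)
        - shellH K₁ K₂ u w τ α η (y t)) = ∫ t in (0 : ℝ)..1,
        (1 / 2 * inner ℝ (shellG K₁ K₂ u w τ α η (x t)) (x t) - shellH K₁ K₂ u w τ α η (x t)) := by
      refine intervalIntegral.integral_congr fun t ht => ?_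
      rw [uIcc_of_le zero_le_one] at ht
      simp only [hxy t ht]
    rw [this]
    exact ⟨hlo, hhi⟩

end ShellSpectrum

section ShellLinking

variable {V : Type*} [NormedAddCommGroup V] [InnerProductSpace ℝ V]
  {J K₁ K₂ : V →L[ℝ] V} {f : V → V} {N : Set V} {r₁ r₂ s₁ s₂ η κ w τ α : ℝ} {u : V → ℝ}

theorem IsCollar.mem_Icc (h : IsCollar J K₁ K₂ f N r₁ r₂ s₁ s₂ η κ u) (z : V) :
    u z ∈ Icc (0 : ℝ) 1 := by
  by_cases hz : z ∈ f '' closedShell V s₁ (s₂ + η)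
  · obtain ⟨v, hv, rfl⟩ := hz
    rw [h.apply_shell v (h.closedShell_subset hv)]
    exact ⟨cutoff_nonneg h.width_pos h.lt _, cutoff_le_one h.width_pos h.lt _⟩
  · rcases (h.off_shell z hz).2 with h0 | h0 <;> rw [h0] <;> simp

theorem IsCollar.inner_nonneg (h : IsCollar J K₁ K₂ f N r₁ r₂ s₁ s₂ η κ u) (z : V) :
    0 ≤ inner ℝ (K₂ z) z :=
  (mul_nonneg h.pos.le (sq_nonneg _)).trans (h.lower z)

theorem IsCollar.shellH_zero_le (h : IsCollar J K₁ K₂ f N r₁ r₂ s₁ s₂ η κ u) (hw : 0 ≤ w)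
    (hτ : 0 ≤ τ) (hα : 0 ≤ α) (z : V) :
    shellH K₁ K₂ u w τ α η 0 ≤ shellH K₁ K₂ u w τ α η z := by
  have hη := h.width_pos
  rw [h.shellH_zero, shellH]
  have h1 := mul_nonneg hτ (h.mem_Icc z).1
  have h2 := mul_nonneg hα (rampScaled_nonneg hη (inner ℝ (K₂ z) z - 1))
  have h3 := mul_le_mul_of_nonneg_left (monotone_rampScaled hη
    (by linarith [h.inner_nonneg z, h.le z] : 1 - inner ℝ (K₁ z) z ≤ 1)) hw
  linarith

theorem IsCollar.le_shellH (h : IsCollar J K₁ K₂ f N r₁ r₂ s₁ s₂ η κ u) (hw : 0 ≤ w) (hwα : w ≤ α)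
    (hτ : 0 ≤ τ) (z : V) :
    inner ℝ ((α • K₂) z) z - α * (1 + η) ≤ shellH K₁ K₂ u w τ α η z := by
  have hη := h.width_pos
  have h1 := mul_nonneg hτ (h.mem_Icc z).1
  have hα := hw.trans hwα
  have hle := h.le z
  rw [shellH, _root_.smul_apply, real_inner_smul_left]
  have hαη := mul_nonneg hα hη.le
  rcases le_total (inner ℝ (K₁ z) z) 1 with h2 | h2
  · rw [rampScaled_of_nonpos hη (s := inner ℝ (K₂ z) z - 1) (by linarith)]
    have h3 := mul_le_mul_of_nonneg_left (rampScaled_le hη (sub_nonneg.2 h2)) hw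
    have h4 := mul_le_mul_of_nonneg_right hwα (sub_nonneg.2 h2)
    have h5 := mul_le_mul_of_nonneg_left hle hα
    linarith
  · rw [rampScaled_of_nonpos hη (s := 1 - inner ℝ (K₁ z) z) (by linarith)]
    have h3 := mul_le_mul_of_nonneg_left (sub_le_rampScaled hη (inner ℝ (K₂ z) z - 1)) hα
    linarith

theorem IsCollar.shellH_le (h : IsCollar J K₁ K₂ f N r₁ r₂ s₁ s₂ η κ u) (hw : 0 ≤ w) (hα : 0 ≤ α)
    (hτ : 0 ≤ τ) (hwτ : α ≤ w + τ) (z : V) :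
    shellH K₁ K₂ u w τ α η z ≤ shellH K₁ K₂ u w τ α η 0 + (w + τ) * inner ℝ (K₁ z) z := by
  have hη := h.width_pos
  have hle := h.le z
  have hnn := h.inner_nonneg z
  obtain ⟨hu0, hu1⟩ := h.mem_Icc z
  rw [h.shellH_zero, shellH]
  have h0 : w * (rampScaled η 1 - rampScaled η (1 - inner ℝ (K₁ z) z)) ≤ w * inner ℝ (K₁ z) z := by
    refine mul_le_mul_of_nonneg_left ?_ hw
    have h1 := rampScaled_sub_le hη (a := 1 - inner ℝ (K₁ z) z) (b := 1) (by linarith)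
    have h2 := mul_le_of_le_one_left (hnn.trans hle) (rampSlope_le_one (η := η) 1)
    linarith
  rcases lt_or_ge (inner ℝ (K₁ z) z) 1 with h1 | h1
  · rw [h.inside z h1, rampScaled_of_nonpos hη (s := inner ℝ (K₂ z) z - 1) (by linarith)]
    have := mul_nonneg hτ (hnn.trans hle)
    linarith
  rcases le_or_gt (inner ℝ (K₂ z) z) 1 with h2 | h2
  · rw [rampScaled_of_nonpos hη (s := inner ℝ (K₂ z) z - 1) (by linarith)]
    have := mul_le_mul_of_nonneg_left (hu1.trans h1) hτ
    linarith
  · rw [h.outside z h2]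
    have h3 := mul_le_mul_of_nonneg_left
      (rampScaled_le hη (s := inner ℝ (K₂ z) z - 1) (by linarith)) hα
    have h4 := mul_nonneg hw (rampScaled_nonneg hη (1 - inner ℝ (K₁ z) z))
    have h5 := mul_le_mul_of_nonneg_left (rampScaled_le hη zero_le_one) hw
    have h6 := mul_le_mul_of_nonneg_right hwτ (sub_nonneg.2 h2.le)
    have h7 := mul_le_mul_of_nonneg_left hle (by linarith : 0 ≤ w + τ)
    linarith

variable [FiniteDimensional ℝ V]

theorem IsCollar.exists_critical_of_direction [CompleteSpace V] {Λ B c : ℝ}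
    (h : IsCollar J K₁ K₂ f N r₁ r₂ s₁ s₂ η κ u) (hw : 0 < w) (hwα : w ≤ α) (hτ : 0 ≤ τ)
    (hnr : IsNonresonant J (α • K₂) (shellH K₁ K₂ u w τ α η) (shellG K₁ K₂ u w τ α η) Λ B c)
    {e : V} (he : ‖e‖ = 1) (hKe : π < α * inner ℝ (K₂ e) e) {μ : ℝ} (hμ : μ < π)
    (hK : ∀ v, w * inner ℝ (K₁ v) v ≤ μ * ‖v‖ ^ 2) (m : ℕ) :
    ∃ v : FourierLoop V (Finset.Icc (-m : ℤ) (m + 1)),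
      galG J (shellG K₁ K₂ u w τ α η) _ v = 0 ∧
      -shellH K₁ K₂ u w τ α η 0 < galA J (shellH K₁ K₂ u w τ α η) _ v ∧
      galA J (shellH K₁ K₂ u w τ α η) _ v ≤ α * (1 + η) := by
  have hα : 0 < α := hw.trans_le hwα
  obtain ⟨δ, hδ, hδ'⟩ := h.exists_pos_norm_le
  refine exists_galG_eq_zero_of_direction hnr (Finset.mem_Icc.2 ⟨by omega, by omega⟩) he
    (mul_pos hα h.pos) (fun v => ?_) (by rwa [_root_.smul_apply, real_inner_smul_left])
    (h.le_shellH hw.le hwα hτ) (h.shellH_zero_le hw.le hτ hα.le) (K₀ := w • K₁)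
    (fun v => by simp [h.comm₁]) hδ (fun z hz => (h.shellH_eq_of_norm_le (hδ' z hz)).1) hμ
    fun v => by rw [_root_.smul_apply, real_inner_smul_left]; exact hK v
  rw [_root_.smul_apply, real_inner_smul_left, mul_assoc]
  exact mul_le_mul_of_nonneg_left (h.lower v) hα.le

theorem IsCollar.exists_critical_of_low [CompleteSpace V] {Λ B c : ℝ}
    (h : IsCollar J K₁ K₂ f N r₁ r₂ s₁ s₂ η κ u) (hw : 0 < w) (hwα : w ≤ α) (hτ : 0 ≤ τ)
    (hwτ : α ≤ w + τ)
    (hnr : IsNonresonant J (α • K₂) (shellH K₁ K₂ u w τ α η) (shellG K₁ K₂ u w τ α η) Λ B c)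
    {e : V} (he : ‖e‖ = 1) (hKe : w * inner ℝ (K₁ e) e < π) (hακ : π < α * κ) {μ : ℝ}
    (hμ : μ < 2 * π) (hK : ∀ v, (w + τ) * inner ℝ (K₁ v) v ≤ μ * ‖v‖ ^ 2) (m : ℕ) :
    ∃ v : FourierLoop V (Finset.Icc (-m : ℤ) (m + 1)),
      galG J (shellG K₁ K₂ u w τ α η) _ v = 0 ∧
      -shellH K₁ K₂ u w τ α η 0 < galA J (shellH K₁ K₂ u w τ α η) _ v ∧
      galA J (shellH K₁ K₂ u w τ α η) _ v ≤ α * (1 + η) := by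
  have hα : 0 < α := hw.trans_le hwα
  obtain ⟨δ, hδ, hδ'⟩ := h.exists_pos_norm_le
  refine exists_galG_eq_zero_of_low hnr (Finset.mem_Icc.2 ⟨by omega, by omega⟩) he hακ
    (fun v => ?_) (h.le_shellH hw.le hwα hτ) (K₀ := w • K₁)
    (fun v => by simp [h.comm₁]) hδ (fun z hz => (h.shellH_eq_of_norm_le (hδ' z hz)).1) hμ
    (fun v => ?_) (by rwa [_root_.smul_apply, real_inner_smul_left]) fun z => ?_
  · rw [_root_.smul_apply, real_inner_smul_left, mul_assoc]
    exact mul_le_mul_of_nonneg_left (h.lower v) hα.le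
  · rw [_root_.smul_apply, real_inner_smul_left]
    have := mul_nonneg hτ ((h.inner_nonneg v).trans (h.le v))
    linarith [hK v]
  · exact (h.shellH_le hw.le hα.le hτ hwτ z).trans (by linarith [hK z])

end ShellLinking

section SymplecticShell

variable {V : Type*} [NormedAddCommGroup V] [InnerProductSpace ℝ V]

/-- A symplectic image of the shell `openShell V r₁ r₂` lying in the compact set `O` and outside
the ellipsoid `⟨K₁ z, z⟩ < 1`. -/
structure IsSymplecticShell (J K₁ K₂ : V →L[ℝ] V) (f : V → V) (N : Set V) (r₁ r₂ κ : ℝ)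
    (O : Set V) : Prop where
  complex : IsOrthComplex J
  comm₁ : ∀ v, K₁ (J v) = J (K₁ v)
  comm₂ : ∀ v, K₂ (J v) = J (K₂ v)
  symm₁ : ∀ v w, inner ℝ (K₁ v) w = inner ℝ v (K₁ w)
  symm₂ : ∀ v w, inner ℝ (K₂ v) w = inner ℝ v (K₂ w)
  le : ∀ v, inner ℝ (K₂ v) v ≤ inner ℝ (K₁ v) v
  pos : 0 < κ
  lower : ∀ v, κ * ‖v‖ ^ 2 ≤ inner ℝ (K₂ v) v
  symplectic : IsSymplecticOn J f N
  subset : openShell V r₁ r₂ ⊆ N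
  radius : 0 < r₁
  isCompact : IsCompact O
  isPreconnected_compl : IsPreconnected Oᶜ
  isPreconnected : IsPreconnected {z : V | inner ℝ (K₁ z) z < 1}
  image_subset : f '' openShell V r₁ r₂ ⊆ O
  one_le : ∀ w ∈ openShell V r₁ r₂, 1 ≤ inner ℝ (K₁ (f w)) (f w)
  le_one : ∀ z ∈ O, inner ℝ (K₂ z) z ≤ 1

variable [FiniteDimensional ℝ V] [MeasurableSpace V] [BorelSpace V]
  {J K₁ K₂ : V →L[ℝ] V} {f : V → V} {N O : Set V} {r₁ r₂ κ r w τ α : ℝ}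

theorem IsSymplecticShell.exists_isCollar (h : IsSymplecticShell J K₁ K₂ f N r₁ r₂ κ O)
    (hd : 2 < Module.finrank ℝ V) (hr₁ : r₁ < r) {t : ℝ} (ht : 0 < t) (ht1 : t < 1) (hr₂ : 0 < r₂)
    (htr : r ^ 2 + t + t ^ 2 < r₂ ^ 2)
    (hvol : volume (O \ {z : V | inner ℝ (K₁ z) z < 1}) < volume (ball (0 : V) r)) :
    ∃ u, IsCollar J K₁ K₂ f N r₁ r₂ (r ^ 2) (r ^ 2 + t) (t ^ 2) κ u := by
  have h0 := h.radius
  have hs₁ : r₁ ^ 2 < r ^ 2 := by gcongr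
  have hη : t ^ 2 < 1 := by nlinarith
  obtain ⟨u, hu, hus, huf, hud, huO⟩ := h.symplectic.exists_collar_of_volume h.complex hd h0
    (pow_pos ht 2) hs₁ (lt_add_of_pos_right _ ht) htr hr₂ h.subset h.isCompact
    h.isPreconnected_compl h.image_subset (D := {z : V | inner ℝ (K₁ z) z < 1})
    (isOpen_lt (contDiff_inner_apply_self K₁ (n := 0)).continuous continuous_const)
    h.isPreconnected (disjoint_left.2 fun z hz ⟨v, hv, hvz⟩ => by
      rw [mem_ofPred_eq, ← hvz] at hz
      exact (h.one_le v hv).not_gt hz)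
    (by rwa [Real.sqrt_sq (h0.trans hr₁).le])
  exact ⟨u, h.complex, h.comm₁, h.comm₂, h.symm₁, h.symm₂, h.le, h.pos, h.lower, h.symplectic,
    h.subset, h0, hr₂, pow_pos ht 2, hη, hs₁, lt_add_of_pos_right _ ht, htr, h.one_le,
    fun v hv => h.le_one _ (h.image_subset (mem_image_of_mem f hv)), hu, hus, huf, hud,
    fun z hz => huO z fun hzO => (h.le_one z hzO).not_gt hz⟩

theorem eventually_pos_nhdsGT {F : ℝ → ℝ} (hF : Continuous F) (h0 : 0 < F 0) :
    ∀ᶠ t in 𝓝[>] (0 : ℝ), 0 < F t :=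
  nhdsWithin_le_nhds (hF.continuousAt.eventually (lt_mem_nhds h0))

/-- A symplectic image of a sphere whose capacity is larger than that of the outer ellipsoid in
some direction cannot enclose the inner ellipsoid. -/
theorem IsSymplecticShell.false_of_direction (h : IsSymplecticShell J K₁ K₂ f N r₁ r₂ κ O)
    (hd : 2 < Module.finrank ℝ V) (hr₁ : r₁ < r) (hr₂ : r < r₂)
    (hvol : volume (O \ {z : V | inner ℝ (K₁ z) z < 1}) < volume (ball (0 : V) r))
    (hw : 0 < w) (hwα : w ≤ α) (hαr : α < π * r ^ 2)
    {c : ℝ} (hc : 0 < c) (hnr : ∀ (k : ℤ) v, c * (1 + |(k : ℝ)|) * ‖v‖ ≤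
      ‖(2 * π * k : ℝ) • v - (2 : ℝ) • (α • K₂) v‖)
    (hres : ∀ (k : ℤ) v, (2 * π * k : ℝ) • v = (2 : ℝ) • (w • K₁) v → v = 0)
    {e : V} (he : ‖e‖ = 1) (hKe : π < α * inner ℝ (K₂ e) e) {μ : ℝ} (hμ : μ < π)
    (hK : ∀ v, w * inner ℝ (K₁ v) v ≤ μ * ‖v‖ ^ 2) : False := by
  have hr0 : 0 < r := h.radius.trans hr₁
  have hrr : r ^ 2 < r₂ ^ 2 := by gcongr
  have hπ := Real.pi_pos
  have hα : 0 < α := hw.trans_le hwα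
  have e1 := eventually_pos_nhdsGT (F := fun t => 1 - t) (by fun_prop) (by simp)
  have e2 := eventually_pos_nhdsGT (F := fun t => r₂ ^ 2 - (r ^ 2 + t + t ^ 2)) (by fun_prop)
    (by simpa using hrr)
  have e3 := eventually_pos_nhdsGT (F := fun t => π * r ^ 2 - π * r ^ 2 * t - α * (1 + t ^ 2))
    (by fun_prop) (by simpa using hαr)
  have e4 := eventually_pos_nhdsGT
    (F := fun t => w * (1 - t ^ 2) - π * (t + t ^ 2) - π * r ^ 2 * t) (by fun_prop)
      (by simpa using hw)
  have e5 := eventually_pos_nhdsGT (F := fun t => r ^ 2 - t) (by fun_prop)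
    (by simpa using pow_pos hr0 2)
  obtain ⟨t, ht, h1, h2, h3, h4, h5⟩ := (eventually_mem_nhdsWithin.and
    (e1.and (e2.and (e3.and (e4.and e5))))).exists
  replace ht : 0 < t := ht
  have hη : 0 < t ^ 2 := pow_pos ht 2
  obtain ⟨u, hu⟩ := h.exists_isCollar hd hr₁ ht (by linarith) (hr0.trans hr₂) (by linarith) hvol
  set τ := π * r ^ 2 with hτ
  have hτ0 : 0 < τ := by positivity
  have : CompleteSpace V := FiniteDimensional.complete ℝ V
  obtain ⟨Λ, B, hn⟩ := hu.isNonresonant (w := w) (τ := τ) hc hnr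
  have hσ := mul_le_mul_of_nonneg_left (sub_le_rampScaled hη 1) hw.le
  have hτt : 0 < τ * t := mul_pos hτ0 ht
  have hw1 : 0 < w * (1 - t ^ 2) := by
    have := mul_pos hπ (add_pos ht hη)
    linarith
  refine hu.false_of_galerkin hd hw hτ0.le hα hn hres (by linarith) (fun s hs hs' => ?_)
    (by linarith) (hu.exists_critical_of_direction hw hwα hτ0.le hn he hKe hμ hK)
  have hθ : t ^ 2 / (r ^ 2 + t - r ^ 2) = t := by
    rw [add_sub_cancel_left]
    field_simp
  rcases cutoff_trichotomy hη hu.lt s with h6 | h6 | h6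
  · right
    rw [hθ] at h6
    have h7 := mul_le_mul_of_nonneg_left h6 hτ0.le
    have h8 := mul_le_mul_of_nonneg_left hs.1 hπ.le
    linarith
  · left
    rw [hθ] at h6
    have h7 := mul_le_mul_of_nonneg_left h6 hτ0.le
    have h8 := mul_le_mul_of_nonneg_left hs.2 hπ.le
    linarith
  · rw [h6, hτ, add_sub_cancel_left, mul_one_div, div_eq_iff ht.ne'] at hs'
    have := mul_left_cancel₀ hπ.ne' hs'
    linarith

/-- A symplectic image of a sphere cannot enclose the inner ellipsoid if its capacity lies strictly
between suitable capacities of the two ellipsoids. -/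
theorem IsSymplecticShell.false_of_low (h : IsSymplecticShell J K₁ K₂ f N r₁ r₂ κ O)
    (hd : 2 < Module.finrank ℝ V) (hr₁ : r₁ < r) (hr₂ : r < r₂)
    (hvol : volume (O \ {z : V | inner ℝ (K₁ z) z < 1}) < volume (ball (0 : V) r))
    (hw : π * r ^ 2 < w) (hwα : w ≤ α) (hwτ : α < w + τ) (hτr : α + τ < 2 * π * r ^ 2)
    {c : ℝ} (hc : 0 < c) (hnr : ∀ (k : ℤ) v, c * (1 + |(k : ℝ)|) * ‖v‖ ≤
      ‖(2 * π * k : ℝ) • v - (2 : ℝ) • (α • K₂) v‖)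
    (hres : ∀ (k : ℤ) v, (2 * π * k : ℝ) • v = (2 : ℝ) • (w • K₁) v → v = 0)
    {e : V} (he : ‖e‖ = 1) (hKe : w * inner ℝ (K₁ e) e < π) (hακ : π < α * κ) {μ : ℝ}
    (hμ : μ < 2 * π) (hK : ∀ v, (w + τ) * inner ℝ (K₁ v) v ≤ μ * ‖v‖ ^ 2) : False := by
  have hr0 : 0 < r := h.radius.trans hr₁
  have hrr : r ^ 2 < r₂ ^ 2 := by gcongr
  have hπ := Real.pi_pos
  have hw0 : 0 < w := lt_trans (by positivity) hw
  have hα : 0 < α := hw0.trans_le hwα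
  have hτ0 : 0 < τ := by linarith
  have e1 := eventually_pos_nhdsGT (F := fun t => 1 - t) (by fun_prop) (by simp)
  have e2 := eventually_pos_nhdsGT (F := fun t => r₂ ^ 2 - (r ^ 2 + t + t ^ 2)) (by fun_prop)
    (by simpa using hrr)
  have e3 := eventually_pos_nhdsGT (F := fun t => 2 * π * r ^ 2 - τ - α * (1 + t ^ 2))
    (by fun_prop) (by simp; linarith)
  have e4 := eventually_pos_nhdsGT
    (F := fun t => w * (1 - t ^ 2) - π * (r ^ 2 + t + t ^ 2)) (by fun_prop) (by simpa using hw)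
  have e5 := eventually_pos_nhdsGT (F := fun t => w * (1 - t ^ 2) - (α * (1 + t ^ 2) - τ))
    (by fun_prop) (by simp; linarith)
  obtain ⟨t, ht, h1, h2, h3, h4, h5⟩ := (eventually_mem_nhdsWithin.and
    (e1.and (e2.and (e3.and (e4.and e5))))).exists
  replace ht : 0 < t := ht
  have hη : 0 < t ^ 2 := pow_pos ht 2
  obtain ⟨u, hu⟩ := h.exists_isCollar hd hr₁ ht (by linarith) (hr0.trans hr₂) (by linarith) hvol
  have : CompleteSpace V := FiniteDimensional.complete ℝ V
  obtain ⟨Λ, B, hn⟩ := hu.isNonresonant (w := w) (τ := τ) hc hnr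
  have hσ := mul_le_mul_of_nonneg_left (sub_le_rampScaled hη 1) hw0.le
  refine hu.false_of_galerkin hd hw0 hτ0.le hα hn hres (by linarith) (fun s hs _ => Or.inl ?_)
    (by linarith) (hu.exists_critical_of_low hw0 hwα hτ0.le hwτ.le hn he hKe hακ hμ hK)
  have h7 := mul_nonneg hτ0.le (cutoff_nonneg hη hu.lt s)
  have h8 := mul_le_mul_of_nonneg_left hs.2 hπ.le
  linarith

end SymplecticShell

section StandardSpace

variable {n : ℕ}

/-- The index of the complex coordinate to which a real coordinate belongs. -/
def pairIndex (j : Fin (2 * n)) : Fin n := ⟨j.1 / 2, by have := j.isLt; omega⟩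

@[to_additive]
theorem prod_eq_prod_pairs {M : Type*} [CommMonoid M] (g : Fin (2 * n) → M) :
    ∏ j, g j = ∏ i : Fin n,
      (g ⟨2 * i.1, by have := i.isLt; omega⟩ * g ⟨2 * i.1 + 1, by have := i.isLt; omega⟩) := by
  rw [← ((finProdFinEquiv (m := n) (n := 2)).trans (finCongr (mul_comm n 2))).prod_comp,
    Fintype.prod_prod_type]
  refine Finset.prod_congr rfl fun i _ => ?_
  rw [Fin.prod_univ_two]
  congr 2 <;> ext <;> simp [finProdFinEquiv, add_comm]

theorem inner_R2n (v w : R2n n) : inner ℝ v w = ∑ j, v j * w j := by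
  rw [PiLp.inner_apply]
  exact Finset.sum_congr rfl fun j _ => mul_comm _ _

variable (n) in
/-- The standard complex structure on `ℝ^{2n}`, for which `ω_st(v, w) = ⟨J v, w⟩`. -/
def stdJ : R2n n →L[ℝ] R2n n := LinearMap.toContinuousLinearMap
  { toFun := fun v => WithLp.toLp 2 fun j => if h : j.1 % 2 = 0 then
      -v ⟨j.1 + 1, by have := j.isLt; omega⟩ else v ⟨j.1 - 1, by have := j.isLt; omega⟩
    map_add' := fun v w => by
      ext j
      simp only [PiLp.add_apply]
      split_ifs <;> ring
    map_smul' := fun c v => by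
      ext j
      simp only [PiLp.smul_apply, smul_eq_mul, RingHom.id_apply]
      split_ifs <;> ring }

theorem stdJ_apply (v : R2n n) (j : Fin (2 * n)) : stdJ n v j = if h : j.1 % 2 = 0 then
    -v ⟨j.1 + 1, by have := j.isLt; omega⟩ else v ⟨j.1 - 1, by have := j.isLt; omega⟩ := rfl

theorem stdJ_even (v : R2n n) (i : Fin n) : stdJ n v ⟨2 * i.1, by have := i.isLt; omega⟩
    = -v ⟨2 * i.1 + 1, by have := i.isLt; omega⟩ := by
  rw [stdJ_apply, dif_pos (by simp)]

theorem stdJ_odd (v : R2n n) (i : Fin n) : stdJ n v ⟨2 * i.1 + 1, by have := i.isLt; omega⟩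
    = v ⟨2 * i.1, by have := i.isLt; omega⟩ := by
  rw [stdJ_apply, dif_neg (by simp [Nat.add_mod])]
  simp

theorem inner_stdJ (v w : R2n n) : inner ℝ (stdJ n v) w = sympForm n v w := by
  rw [inner_R2n, sum_eq_sum_pairs, sympForm]
  simp only [stdJ_even, stdJ_odd]
  exact Finset.sum_congr rfl fun i _ => by ring

theorem sympForm_comm (v w : R2n n) : sympForm n v w = -sympForm n w v := by
  rw [sympForm, sympForm, ← Finset.sum_neg_distrib]
  exact Finset.sum_congr rfl fun i _ => by ring

/-- Two vectors agree when their complex coordinates do. -/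
theorem ext_R2n {v w : R2n n}
    (h₁ : ∀ i : Fin n, v ⟨2 * i.1, by have := i.isLt; omega⟩
      = w ⟨2 * i.1, by have := i.isLt; omega⟩)
    (h₂ : ∀ i : Fin n, v ⟨2 * i.1 + 1, by have := i.isLt; omega⟩
      = w ⟨2 * i.1 + 1, by have := i.isLt; omega⟩) : v = w := by
  ext j
  rcases Nat.even_or_odd' j.1 with ⟨k, hk | hk⟩
  · have := h₁ ⟨k, by have := j.isLt; omega⟩
    simpa only [← hk] using this
  · have := h₂ ⟨k, by have := j.isLt; omega⟩
    simpa only [← hk] using this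

theorem isOrthComplex_stdJ : IsOrthComplex (stdJ n) where
  sq v := ext_R2n (fun i => by simp [stdJ_even, stdJ_odd]) fun i => by simp [stdJ_even, stdJ_odd]
  skew v w := by rw [inner_stdJ, sympForm_comm, ← inner_stdJ, real_inner_comm]

/-- The operator acting on the `i`-th complex coordinate as multiplication by `d i`. -/
def diagOp (d : Fin n → ℝ) : R2n n →L[ℝ] R2n n := LinearMap.toContinuousLinearMap
  { toFun := fun v => WithLp.toLp 2 fun j => d (pairIndex j) * v j
    map_add' := fun v w => by
      ext j
      simp only [PiLp.add_apply]
      ring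
    map_smul' := fun c v => by
      ext j
      simp only [PiLp.smul_apply, smul_eq_mul, RingHom.id_apply]
      ring }

theorem diagOp_apply (d : Fin n → ℝ) (v : R2n n) (j : Fin (2 * n)) :
    diagOp d v j = d (pairIndex j) * v j := rfl

theorem pairIndex_even (i : Fin n) :
    pairIndex ⟨2 * i.1, by have := i.isLt; omega⟩ = i := by
  ext
  simp [pairIndex]

theorem pairIndex_odd (i : Fin n) :
    pairIndex ⟨2 * i.1 + 1, by have := i.isLt; omega⟩ = i := by
  ext
  simp only [pairIndex]
  omega

theorem diagOp_stdJ (d : Fin n → ℝ) (v : R2n n) : diagOp d (stdJ n v) = stdJ n (diagOp d v) :=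
  ext_R2n (fun i => by simp [stdJ_even, diagOp_apply, pairIndex_even, pairIndex_odd])
    fun i => by simp [stdJ_odd, diagOp_apply, pairIndex_even, pairIndex_odd]

theorem inner_diagOp_comm (d : Fin n → ℝ) (v w : R2n n) :
    inner ℝ (diagOp d v) w = inner ℝ v (diagOp d w) := by
  rw [inner_R2n, inner_R2n]
  exact Finset.sum_congr rfl fun j _ => by rw [diagOp_apply, diagOp_apply]; ring

theorem inner_diagOp_self (d : Fin n → ℝ) (v : R2n n) :
    inner ℝ (diagOp d v) v = ∑ j, d (pairIndex j) * v j ^ 2 := by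
  rw [inner_R2n]
  exact Finset.sum_congr rfl fun j _ => by rw [diagOp_apply]; ring

theorem ellQ_eq_inner (a : Fin n → ℝ) (z : R2n n) :
    ellQ n a z = inner ℝ (diagOp (fun i => 1 / a i ^ 2) z) z := by
  rw [inner_diagOp_self, sum_eq_sum_pairs, ellQ]
  refine Finset.sum_congr rfl fun i _ => ?_
  rw [pairIndex_even, pairIndex_odd]
  ring

theorem inner_diagOp_mono {d d' : Fin n → ℝ} (h : ∀ i, d i ≤ d' i) (v : R2n n) :
    inner ℝ (diagOp d v) v ≤ inner ℝ (diagOp d' v) v := by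
  rw [inner_diagOp_self, inner_diagOp_self]
  exact Finset.sum_le_sum fun j _ => mul_le_mul_of_nonneg_right (h _) (sq_nonneg _)

theorem norm_sq_R2n (v : R2n n) : ‖v‖ ^ 2 = ∑ j, v j ^ 2 := by
  rw [EuclideanSpace.norm_sq_eq]
  simp

theorem mul_norm_sq_le_inner_diagOp {d : Fin n → ℝ} {c : ℝ} (h : ∀ i, c ≤ d i) (v : R2n n) :
    c * ‖v‖ ^ 2 ≤ inner ℝ (diagOp d v) v := by
  rw [inner_diagOp_self, norm_sq_R2n, Finset.mul_sum]
  exact Finset.sum_le_sum fun j _ => mul_le_mul_of_nonneg_right (h _) (sq_nonneg _)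

theorem mul_inner_diagOp_le {d : Fin n → ℝ} {w c : ℝ} (h : ∀ i, w * d i ≤ c) (v : R2n n) :
    w * inner ℝ (diagOp d v) v ≤ c * ‖v‖ ^ 2 := by
  rw [inner_diagOp_self, norm_sq_R2n, Finset.mul_sum, Finset.mul_sum]
  refine Finset.sum_le_sum fun j _ => ?_
  rw [← mul_assoc]
  exact mul_le_mul_of_nonneg_right (h _) (sq_nonneg _)

theorem inner_diagOp_single (d : Fin n → ℝ) (j : Fin (2 * n)) :
    inner ℝ (diagOp d (EuclideanSpace.single j 1)) (EuclideanSpace.single j 1)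
      = d (pairIndex j) := by
  rw [inner_diagOp_self, Finset.sum_eq_single j]
  · simp
  · intro k _ hk
    simp [hk]
  · simp

theorem eq_zero_of_smul_eq_diagOp {d : Fin n → ℝ} {w : ℝ} (h : ∀ i (k : ℤ), w * d i ≠ π * k)
    (k : ℤ) (v : R2n n) (hv : (2 * π * k : ℝ) • v = (2 : ℝ) • (w • diagOp d) v) : v = 0 := by
  ext j
  have h1 : (2 * π * k : ℝ) * v j = 2 * (w * (d (pairIndex j) * v j)) :=
    congrArg (fun u : R2n n => u j) hv
  have h2 : (w * d (pairIndex j) - π * k) * v j = 0 := by linarith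
  exact (mul_eq_zero.1 h2).resolve_left (sub_ne_zero.2 (h _ k))

theorem exists_mul_le_abs_sub_intCast {x : ℝ} (h : ∀ k : ℤ, x ≠ k) :
    ∃ c, 0 < c ∧ ∀ k : ℤ, c * (1 + |(k : ℝ)|) ≤ |k - x| := by
  have h0 : 0 < |x - round x| := abs_pos.2 (sub_ne_zero.2 (h _))
  refine ⟨((1 + |x|) / |x - round x| + 1)⁻¹, by positivity, fun k => ?_⟩
  rw [inv_mul_le_iff₀ (by positivity), add_mul, one_mul, div_mul_eq_mul_div]
  have h1 : |x - round x| ≤ |k - x| := by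
    rw [abs_sub_comm (k : ℝ)]
    exact round_le x k
  have h2 : 1 + |x| ≤ (1 + |x|) * |k - x| / |x - round x| := by
    rw [le_div_iff₀ h0]
    exact mul_le_mul_of_nonneg_left h1 (by positivity)
  have h3 : |(k : ℝ)| ≤ |k - x| + |x| := by
    simpa using abs_add_le ((k : ℝ) - x) x
  linarith

theorem exists_mul_norm_le_norm_smul_sub_diagOp {d : Fin n → ℝ} {w : ℝ}
    (h : ∀ i (k : ℤ), w * d i ≠ π * k) : ∃ c, 0 < c ∧ ∀ (k : ℤ) (v : R2n n),
      c * (1 + |(k : ℝ)|) * ‖v‖ ≤ ‖(2 * π * k : ℝ) • v - (2 : ℝ) • (w • diagOp d) v‖ := by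
  have h1 : ∀ i, ∃ c, 0 < c ∧ ∀ k : ℤ, c * (1 + |(k : ℝ)|) ≤ |k - w * d i / π| := fun i =>
    exists_mul_le_abs_sub_intCast fun k hk => h i k (by rw [← hk]; field_simp)
  choose c hc0 hc using h1
  obtain ⟨b, hb0, hb⟩ : ∃ b, 0 < b ∧ ∀ i, b ≤ c i := by
    rcases isEmpty_or_nonempty (Fin n) with hn | hn
    · exact ⟨1, one_pos, fun i => hn.elim i⟩
    · obtain ⟨i, hi⟩ := Finite.exists_min c
      exact ⟨c i, hc0 i, hi⟩
  refine ⟨2 * π * b, by positivity, fun k v => ?_⟩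
  rw [← abs_of_nonneg (norm_nonneg
    ((2 * π * k : ℝ) • v - (2 : ℝ) • (w • diagOp d) v)), ← abs_of_nonneg
    (show 0 ≤ 2 * π * b * (1 + |(k : ℝ)|) * ‖v‖ by positivity), ← sq_le_sq, mul_pow, norm_sq_R2n,
    norm_sq_R2n, Finset.mul_sum]
  refine Finset.sum_le_sum fun j _ => ?_
  have h2 : ((2 * π * k : ℝ) • v - (2 : ℝ) • (w • diagOp d) v) j
      = 2 * π * (k - w * d (pairIndex j) / π) * v j := by
    have : ((2 * π * k : ℝ) • v - (2 : ℝ) • (w • diagOp d) v) j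
      = (2 * π * k : ℝ) * v j - 2 * (w * (d (pairIndex j) * v j)) := rfl
    rw [this]
    field_simp
  rw [h2, mul_pow (2 * π * (k - w * d (pairIndex j) / π))]
  refine mul_le_mul_of_nonneg_right ?_ (sq_nonneg (v j))
  rw [sq_le_sq, abs_of_nonneg (a := 2 * π * b * (1 + |(k : ℝ)|)) (by positivity), abs_mul,
    abs_of_pos (by positivity : (0 : ℝ) < 2 * π), mul_assoc]
  exact mul_le_mul_of_nonneg_left ((mul_le_mul_of_nonneg_right (hb _) (by positivity)).trans
    (hc _ k)) (by positivity)

theorem det_diagOp (d : Fin n → ℝ) :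
    LinearMap.det (diagOp d : R2n n →ₗ[ℝ] R2n n) = ∏ i, d i ^ 2 := by
  have h1 : (diagOp d : R2n n →ₗ[ℝ] R2n n) = Matrix.toLin
      (EuclideanSpace.basisFun (Fin (2 * n)) ℝ).toBasis
      (EuclideanSpace.basisFun (Fin (2 * n)) ℝ).toBasis
      (Matrix.diagonal fun j => d (pairIndex j)) := by
    refine (EuclideanSpace.basisFun (Fin (2 * n)) ℝ).toBasis.ext fun j => ?_
    rw [Matrix.toLin_self]
    ext i
    rw [ContinuousLinearMap.coe_coe, diagOp_apply]
    by_cases hij : i = j <;> simp [Matrix.diagonal_apply, hij]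
  rw [h1, LinearMap.det_toLin, Matrix.det_diagonal, prod_eq_prod_pairs]
  exact Finset.prod_congr rfl fun i _ => by rw [pairIndex_even, pairIndex_odd, sq]

theorem norm_diagOp_sq {a : Fin n → ℝ} (ha : ∀ i, 0 < a i) (v : R2n n) :
    ellQ n a (diagOp a v) = ‖v‖ ^ 2 := by
  rw [ellQ_eq_inner, inner_diagOp_self, norm_sq_R2n]
  refine Finset.sum_congr rfl fun j _ => ?_
  rw [diagOp_apply]
  have := (ha (pairIndex j)).ne'
  field_simp

theorem diagOp_diagOp_inv {a : Fin n → ℝ} (ha : ∀ i, 0 < a i) (v : R2n n) :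
    diagOp a (diagOp (fun i => (a i)⁻¹) v) = v := by
  ext j
  rw [diagOp_apply, diagOp_apply, mul_inv_cancel_left₀ (ha _).ne']

theorem image_diagOp_setOf {a : Fin n → ℝ} (ha : ∀ i, 0 < a i) (I : Set ℝ) :
    diagOp a '' {v | ‖v‖ ^ 2 ∈ I} = {z | ellQ n a z ∈ I} := by
  ext z
  constructor
  · rintro ⟨v, hv, rfl⟩
    rwa [mem_ofPred_eq, norm_diagOp_sq ha]
  · intro hz
    refine ⟨diagOp (fun i => (a i)⁻¹) z, ?_, diagOp_diagOp_inv ha z⟩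
    rwa [mem_ofPred_eq, ← norm_diagOp_sq ha, diagOp_diagOp_inv ha]

theorem volume_setOf_ellQ_le_one {a : Fin n → ℝ} (ha : ∀ i, 0 < a i) :
    volume {z | ellQ n a z ≤ 1} = ENNReal.ofReal (∏ i, a i ^ 2) * volume (ball (0 : R2n n) 1) := by
  have h := image_diagOp_setOf ha (Iic 1)
  simp only [mem_Iic] at h
  rw [← h, Measure.addHaar_image_continuousLinearMap, det_diagOp,
    abs_of_nonneg (Finset.prod_nonneg fun i _ => sq_nonneg _)]
  congr 1
  rw [← Measure.addHaar_unitClosedBall_eq_addHaar_unitBall]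
  congr 1
  ext v
  simp

theorem volume_ellipsoid {a : Fin n → ℝ} (ha : ∀ i, 0 < a i) :
    volume (ellipsoid n a) = ENNReal.ofReal (∏ i, a i ^ 2) * volume (ball (0 : R2n n) 1) := by
  have h := image_diagOp_setOf ha (Iio 1)
  simp only [mem_Iio] at h
  rw [ellipsoid, ← h, Measure.addHaar_image_continuousLinearMap, det_diagOp,
    abs_of_nonneg (Finset.prod_nonneg fun i _ => sq_nonneg _)]
  congr 2
  ext v
  simp

theorem isCompact_setOf_ellQ_le_one {a : Fin n → ℝ} (ha : ∀ i, 0 < a i) :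
    IsCompact {z | ellQ n a z ≤ 1} := by
  have h := image_diagOp_setOf ha (Iic 1)
  simp only [mem_Iic] at h
  rw [← h]
  have h1 : {v : R2n n | ‖v‖ ^ 2 ≤ 1} = closedBall 0 1 := by
    ext v
    simp
  rw [h1]
  exact (isCompact_closedBall _ _).image (diagOp a).continuous

theorem continuous_ellQ (a : Fin n → ℝ) : Continuous (ellQ n a) := by
  have : ellQ n a = fun z => inner ℝ (diagOp (fun i => 1 / a i ^ 2) z) z :=
    funext (ellQ_eq_inner a)
  rw [this]
  fun_prop

theorem ellQ_smul (a : Fin n → ℝ) (t : ℝ) (z : R2n n) : ellQ n a (t • z) = t ^ 2 * ellQ n a z := by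
  rw [ellQ_eq_inner, ellQ_eq_inner, map_smul, real_inner_smul_left, real_inner_smul_right]
  ring

theorem ellQ_nonneg (a : Fin n → ℝ) (z : R2n n) : 0 ≤ ellQ n a z := by
  rw [ellQ]
  positivity

theorem ellQ_const_mul (a : Fin n → ℝ) (t : ℝ) (z : R2n n) :
    ellQ n (fun i => t * a i) z = ellQ n a z / t ^ 2 := by
  rw [ellQ, ellQ, Finset.sum_div]
  refine Finset.sum_congr rfl fun i _ => ?_
  rw [mul_pow, div_div, mul_comm (t ^ 2)]

theorem ellQ_pos {a : Fin n → ℝ} (ha : ∀ i, 0 < a i) {z : R2n n} (hz : z ≠ 0) :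
    0 < ellQ n a z := by
  rw [← diagOp_diagOp_inv ha z, norm_diagOp_sq ha]
  have : diagOp (fun i => (a i)⁻¹) z ≠ 0 := fun h => hz (by
    rw [← diagOp_diagOp_inv ha z, h, map_zero])
  positivity

theorem isOpen_ellipsoid (a : Fin n → ℝ) : IsOpen (ellipsoid n a) :=
  isOpen_lt (continuous_ellQ a) continuous_const

theorem closure_ellipsoid_subset (a : Fin n → ℝ) :
    closure (ellipsoid n a) ⊆ {z | ellQ n a z ≤ 1} :=
  closure_minimal (fun z (hz : ellQ n _ z < 1) => hz.le) (isClosed_le (continuous_ellQ a)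
    continuous_const)

theorem isOpen_ellShell (a : Fin n → ℝ) (ε : ℝ) : IsOpen (ellShell n a ε) :=
  (isOpen_ellipsoid _).sdiff isClosed_closure

theorem isPreconnected_ellipsoid (a : Fin n → ℝ) : IsPreconnected (ellipsoid n a) := by
  have h0 : StarConvex ℝ 0 (ellipsoid n a) := by
    rw [starConvex_zero_iff]
    intro z hz t ht0 ht1
    rw [ellipsoid, mem_ofPred_eq] at hz ⊢
    rw [ellQ_smul]
    nlinarith [ellQ_nonneg a z, pow_le_one₀ (n := 2) ht0 ht1]
  exact (h0.isPathConnected (by simp [ellipsoid, ellQ])).isConnected.isPreconnected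

theorem isPreconnected_compl_setOf_ellQ_le_one (hn : 1 < n) {a : Fin n → ℝ} (ha : ∀ i, 0 < a i) :
    IsPreconnected {z | ellQ n a z ≤ 1}ᶜ := by
  have h := isPreconnected_setOf_lt (V := R2n n) (q := ellQ n a) (by
    rw [← Module.finrank_eq_rank, finrank_euclideanSpace_fin]
    exact_mod_cast (by omega : 1 < 2 * n)) (continuous_ellQ a) (fun v hv => ellQ_pos ha hv)
    (ellQ_smul a) (I := Ioi 1) (Ioi_subset_Ioi zero_le_one) isPreconnected_Ioi
  have h1 : {z | ellQ n a z ≤ 1}ᶜ = {v | √(ellQ n a v) ∈ Ioi 1} := by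
    ext z
    rw [mem_compl_iff, mem_ofPred_eq, mem_ofPred_eq, mem_Ioi, not_le, Real.lt_sqrt zero_le_one,
      one_pow]
  rwa [h1]

theorem IsSympEmbOn.isSymplecticOn {N U : Set (R2n n)} {φ : R2n n → R2n n}
    (h : IsSympEmbOn n N U φ) : IsSymplecticOn (stdJ n) φ N where
  isOpen := h.1
  contDiffOn := h.2.1
  injOn := h.2.2.1
  symp p hp v w := by rw [inner_stdJ, inner_stdJ, h.2.2.2.2 p hp]

theorem exists_openShell_subset {N : Set (R2n n)} {r : ℝ} (hN : IsOpen N) (hr : 0 < r)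
    (hsub : sphere (0 : R2n n) r ⊆ N) :
    ∃ r₁ r₂, 0 < r₁ ∧ r₁ < r ∧ r < r₂ ∧ openShell (R2n n) r₁ r₂ ⊆ N := by
  obtain ⟨δ, hδ, hδN⟩ := (isCompact_sphere (0 : R2n n) r).exists_cthickening_subset_open hN hsub
  refine ⟨r - min δ (r / 2), r + δ, ?_, ?_, by linarith, fun z hz => hδN ?_⟩
  · linarith [min_le_right δ (r / 2)]
  · linarith [lt_min hδ (half_pos hr)]
  · have h1 : 0 < ‖z‖ := lt_of_le_of_lt (by linarith [min_le_right δ (r / 2)]) hz.1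
    refine mem_cthickening_of_dist_le z ((r / ‖z‖) • z) δ _ ?_ ?_
    · rw [mem_sphere_zero_iff_norm, norm_smul, norm_div, norm_norm, Real.norm_of_nonneg hr.le,
        div_mul_cancel₀ _ h1.ne']
    · have h2 : z - (r / ‖z‖) • z = (1 - r / ‖z‖) • z := by rw [sub_smul, one_smul]
      rw [dist_eq_norm, h2, norm_smul, Real.norm_eq_abs, ← abs_of_pos h1, ← abs_mul,
        abs_of_pos h1, sub_mul, div_mul_cancel₀ _ h1.ne', one_mul, abs_le]
      constructor <;> linarith [hz.1, hz.2, min_le_left δ (r / 2)]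

end StandardSpace

section EllipsoidalShell

variable {n : ℕ} {a : Fin n → ℝ} {ε : ℝ}

theorem mem_ellShell {z : R2n n} (hz : z ∈ ellShell n a ε) :
    ellQ n (fun i => (1 + ε) * a i) z < 1 ∧ 1 ≤ ellQ n (fun i => (1 - ε) * a i) z :=
  ⟨hz.1, not_lt.1 fun h => hz.2 (subset_closure h)⟩

theorem setOf_inner_diagOp_lt (a : Fin n → ℝ) :
    {z | inner ℝ (diagOp (fun i => 1 / a i ^ 2) z) z < 1} = ellipsoid n a := by
  ext z
  rw [mem_ofPred_eq, ← ellQ_eq_inner]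
  rfl

theorem IsSympEmbOn.isSymplecticShell {N : Set (R2n n)} {φ : R2n n → R2n n}
    (h : IsSympEmbOn n N (ellShell n a ε) φ) (hn : 1 < n) (ha : ∀ i, 0 < a i) (hε₀ : 0 < ε)
    (hε₁ : ε < 1) {d : Fin n → ℝ} {κ r₁ r₂ : ℝ} (hκ : 0 < κ) (hd : ∀ i, κ ≤ d i)
    (hda : ∀ i, d i ≤ 1 / ((1 + ε) * a i) ^ 2) (hr : 0 < r₁) (hN : openShell (R2n n) r₁ r₂ ⊆ N) :
    IsSymplecticShell (stdJ n) (diagOp fun i => 1 / ((1 - ε) * a i) ^ 2) (diagOp d) φ N r₁ r₂ κ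
      {z | ellQ n (fun i => (1 + ε) * a i) z ≤ 1} where
  complex := isOrthComplex_stdJ
  comm₁ := diagOp_stdJ _
  comm₂ := diagOp_stdJ _
  symm₁ := inner_diagOp_comm _
  symm₂ := inner_diagOp_comm _
  le := inner_diagOp_mono fun i => (hda i).trans <| by
    have h1 : 0 < 1 - ε := by linarith
    have h2 := ha i
    gcongr
    linarith
  pos := hκ
  lower := mul_norm_sq_le_inner_diagOp hd
  symplectic := h.isSymplecticOn
  subset := hN
  radius := hr
  isCompact := isCompact_setOf_ellQ_le_one fun i => mul_pos (by linarith) (ha i)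
  isPreconnected_compl :=
    isPreconnected_compl_setOf_ellQ_le_one hn fun i => mul_pos (by linarith) (ha i)
  isPreconnected := by
    rw [setOf_inner_diagOp_lt fun i => (1 - ε) * a i]
    exact isPreconnected_ellipsoid _
  image_subset := image_subset_iff.2 fun z hz => (mem_ellShell (h.2.2.2.1 (hN hz))).1.le
  one_le z hz := by
    rw [← ellQ_eq_inner fun i => (1 - ε) * a i]
    exact (mem_ellShell (h.2.2.2.1 (hN hz))).2
  le_one z hz := by
    refine (inner_diagOp_mono hda z).trans ?_
    rw [← ellQ_eq_inner fun i => (1 + ε) * a i]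
    exact hz

theorem prod_const_mul_sq (a : Fin n → ℝ) (t : ℝ) :
    ∏ i, (t * a i) ^ 2 = t ^ (2 * n) * ∏ i, a i ^ 2 := by
  simp_rw [mul_pow]
  rw [Finset.prod_mul_distrib, Finset.prod_const, Finset.card_univ, Fintype.card_fin, ← pow_mul]

theorem volume_sdiff_ellipsoid_lt (ha : ∀ i, 0 < a i) (hε₀ : 0 < ε) (hε₁ : ε < 1) {r : ℝ}
    (hr : 0 < r) (h : ((1 + ε) ^ (2 * n) - (1 - ε) ^ (2 * n)) * ∏ i, a i ^ 2 < r ^ (2 * n)) :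
    volume ({z | ellQ n (fun i => (1 + ε) * a i) z ≤ 1} \
      {z | inner ℝ (diagOp (fun i => 1 / ((1 - ε) * a i) ^ 2) z) z < 1}) <
        volume (ball (0 : R2n n) r) := by
  rw [setOf_inner_diagOp_lt fun i => (1 - ε) * a i]
  have h1 : 0 < 1 - ε := by linarith
  have hsub : ellipsoid n (fun i => (1 - ε) * a i) ⊆ {z | ellQ n (fun i => (1 + ε) * a i) z ≤ 1} :=
    fun z (hz : ellQ n _ z < 1) => by
      rw [mem_ofPred_eq]
      refine le_trans ?_ hz.le
      rw [ellQ_const_mul, ellQ_const_mul]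
      have := ellQ_nonneg a z
      gcongr
      linarith
  have h2 := measure_sdiff_add_inter (μ := volume) {z | ellQ n (fun i => (1 + ε) * a i) z ≤ 1}
    (isOpen_ellipsoid fun i => (1 - ε) * a i).measurableSet
  rw [inter_eq_self_of_subset_right hsub,
    volume_ellipsoid fun i => mul_pos h1 (ha i),
    volume_setOf_ellQ_le_one fun i => mul_pos (by linarith) (ha i)] at h2
  by_contra! hc
  rw [Measure.addHaar_ball_of_pos _ _ hr, finrank_euclideanSpace_fin] at hc
  have h3 : ENNReal.ofReal (r ^ (2 * n) + ∏ i, ((1 - ε) * a i) ^ 2) * volume (ball (0 : R2n n) 1)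
      ≤ ENNReal.ofReal (∏ i, ((1 + ε) * a i) ^ 2) * volume (ball (0 : R2n n) 1) := by
    rw [ENNReal.ofReal_add (by positivity) (Finset.prod_nonneg fun i _ => sq_nonneg _), add_mul,
      ← h2]
    gcongr
  rw [ENNReal.mul_le_mul_iff_left (measure_ball_pos _ _ one_pos).ne' measure_ball_lt_top.ne,
    ENNReal.ofReal_le_ofReal_iff (Finset.prod_nonneg fun i _ => sq_nonneg _),
    prod_const_mul_sq, prod_const_mul_sq] at h3
  linarith

/-- A sphere that is too large to be filled inside the outer ellipsoid does not embed. -/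
theorem IsSympEmbOn.false_of_outer_lt {N : Set (R2n n)} {φ : R2n n → R2n n} {r : ℝ}
    (h : IsSympEmbOn n N (ellShell n a ε) φ) (hN : sphere (0 : R2n n) r ⊆ N) (hn : 1 < n)
    (ha : ∀ i, 1 ≤ a i) {i₀ : Fin n} (hi₀ : a i₀ = 1) {R : ℝ} (hR : ∀ i, a i ≤ R)
    (hε₀ : 0 < ε) (hε₁ : ε < 1) (hr : 1 + ε < r)
    (hvol : ((1 + ε) ^ (2 * n) - (1 - ε) ^ (2 * n)) * ∏ i, a i ^ 2 < r ^ (2 * n)) : False := by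
  have ha0 : ∀ i, 0 < a i := fun i => one_pos.trans_le (ha i)
  have hr0 : 0 < r := by linarith
  have hR1 : 1 ≤ R := hi₀ ▸ hR i₀
  obtain ⟨r₁, r₂, hr₁, hr₁r, hr₂, hsub⟩ := exists_openShell_subset h.1 hr0 hN
  have hπ := Real.pi_pos
  let d : Fin n → ℝ := fun i => if i = i₀ then 1 / (1 + ε) ^ 2 else 1 / (8 * R ^ 2)
  have hd₀ : d i₀ = 1 / (1 + ε) ^ 2 := if_pos rfl
  have hd₁ : ∀ i, i ≠ i₀ → d i = 1 / (8 * R ^ 2) := fun i hi => if_neg hi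
  have hε2 : (1 + ε) ^ 2 < 4 := by nlinarith
  have hκ : ∀ i, 1 / (8 * R ^ 2) ≤ d i := fun i => by
    by_cases hi : i = i₀
    · rw [hi, hd₀]
      gcongr
      nlinarith
    · rw [hd₁ i hi]
  have hda : ∀ i, d i ≤ 1 / ((1 + ε) * a i) ^ 2 := fun i => by
    by_cases hi : i = i₀
    · rw [hi, hd₀, hi₀, mul_one]
    · rw [hd₁ i hi]
      have h1 := ha0 i
      have h2 : a i ^ 2 ≤ R ^ 2 := by gcongr; exact hR i
      gcongr
      rw [mul_pow]
      nlinarith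
  obtain ⟨α, hα₁, hα₂⟩ : ∃ α, π * (1 + ε) ^ 2 < α ∧ α < min (π * r ^ 2) (2 * π * (1 + ε) ^ 2) := by
    refine exists_between (lt_min ?_ ?_)
    · gcongr
    · nlinarith [mul_pos hπ (pow_pos (by linarith : 0 < 1 + ε) 2)]
  rw [lt_min_iff] at hα₂
  have hε1 : 0 < (1 + ε) ^ 2 := by positivity
  have hαd₀ : π < α * d i₀ := by
    rw [hd₀, mul_one_div, lt_div_iff₀ hε1]
    exact hα₁
  have hαd₁ : α * d i₀ < 2 * π := by
    rw [hd₀, mul_one_div, div_lt_iff₀ hε1]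
    exact hα₂.2
  have hα0 : 0 < α := (by positivity : 0 < π * (1 + ε) ^ 2).trans hα₁
  obtain ⟨c, hc, hnr⟩ := exists_mul_norm_le_norm_smul_sub_diagOp (d := d) (w := α)
    fun i k hk => by
      by_cases hi : i = i₀
      · rw [hi] at hk
        rw [hk] at hαd₀ hαd₁
        have h1 : (1 : ℝ) < k := by nlinarith
        have h2 : (k : ℝ) < 2 := by nlinarith
        norm_cast at h1 h2
        omega
      · rw [hd₁ i hi] at hk
        have h0 : 0 < α * (1 / (8 * R ^ 2)) := by positivity
        have h3 : α * (1 / (8 * R ^ 2)) < π := by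
          rw [mul_one_div, div_lt_iff₀ (by positivity)]
          nlinarith [hα₂.2, mul_lt_mul_of_pos_left hε2 hπ,
            mul_le_mul_of_nonneg_left (one_le_pow₀ hR1 : 1 ≤ R ^ 2) hπ.le]
        rw [hk] at h0 h3
        have h1 : (0 : ℝ) < k := pos_of_mul_pos_right h0 hπ.le
        have h2 : (k : ℝ) < 1 := by nlinarith
        norm_cast at h1 h2
        omega
  have hw : ∀ i, π * (1 - ε) ^ 2 / 2 * (1 / ((1 - ε) * a i) ^ 2) = π / 2 * (1 / a i ^ 2) :=
    fun i => by
      have h1 : 1 - ε ≠ 0 := by linarith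
      have h2 := (ha0 i).ne'
      field_simp
  have hai : ∀ i, 1 / a i ^ 2 ≤ 1 := fun i => by
    rw [div_le_one (by have := ha0 i; positivity)]
    exact one_le_pow₀ (ha i)
  have hs := h.isSymplecticShell hn ha0 hε₀ hε₁ (by positivity) hκ hda hr₁ hsub
  refine hs.false_of_direction (r := r) (w := π * (1 - ε) ^ 2 / 2) (α := α) (c := c)
    (μ := π / 2) (e := EuclideanSpace.single ⟨2 * i₀.1, by have := i₀.isLt; omega⟩ 1)
    (by rw [finrank_euclideanSpace_fin]; omega) hr₁r hr₂
    (volume_sdiff_ellipsoid_lt ha0 hε₀ hε₁ hr0 hvol)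
    (by have : 0 < 1 - ε := by linarith
        positivity)
    (le_trans (by nlinarith) hα₁.le) hα₂.1 hc hnr
    (eq_zero_of_smul_eq_diagOp fun i k hk => ?_) (by simp) ?_ (by linarith)
    (mul_inner_diagOp_le fun i => ?_)
  · rw [hw] at hk
    have h0 : 0 < π / 2 * (1 / a i ^ 2) := by have := ha0 i; positivity
    have h3 : π / 2 * (1 / a i ^ 2) < π := by nlinarith [hai i]
    rw [hk] at h0 h3
    have h1 : (0 : ℝ) < k := pos_of_mul_pos_right h0 hπ.le
    have h2 : (k : ℝ) < 1 := by nlinarith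
    norm_cast at h1 h2
    omega
  · rw [inner_diagOp_single, pairIndex_even]
    exact hαd₀
  · rw [hw]
    nlinarith [hai i]

/-- A sphere that is too small to enclose the inner ellipsoid does not embed. -/
theorem IsSympEmbOn.false_of_lt_inner {N : Set (R2n n)} {φ : R2n n → R2n n} {r : ℝ}
    (h : IsSympEmbOn n N (ellShell n a ε) φ) (hN : sphere (0 : R2n n) r ⊆ N) (hn : 1 < n)
    (ha : ∀ i, 1 ≤ a i) {i₁ : Fin n} {R : ℝ} (hi₁ : a i₁ = R) (hR : ∀ i, a i ≤ R)
    (hε₀ : 0 < ε) (hε₁ : ε < 1) (hr0 : 0 < r) (hr : r < (1 - ε) * R)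
    (hεR : (1 + ε) ^ 2 * R ^ 2 < 2 * (1 - ε) ^ 2) (hrR : 2 * ((1 + ε) ^ 2 * R ^ 2) < 3 * r ^ 2)
    (hvol : ((1 + ε) ^ (2 * n) - (1 - ε) ^ (2 * n)) * ∏ i, a i ^ 2 < r ^ (2 * n)) : False := by
  have ha0 : ∀ i, 0 < a i := fun i => one_pos.trans_le (ha i)
  have hR1 : 1 ≤ R := hi₁ ▸ ha i₁
  have hR0 : 0 < R := one_pos.trans_le hR1
  obtain ⟨r₁, r₂, hr₁, hr₁r, hr₂, hsub⟩ := exists_openShell_subset h.1 hr0 hN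
  have hπ := Real.pi_pos
  have h1ε : 0 < 1 - ε := by linarith
  have hda : ∀ i, 1 / ((1 + ε) * R) ^ 2 ≤ 1 / ((1 + ε) * a i) ^ 2 := fun i => by
    have := ha0 i
    gcongr
    exact hR i
  obtain ⟨σ, hσ₁, hσ₂⟩ : ∃ σ, π * ((1 + ε) ^ 2 * R ^ 2) < σ ∧
      σ < min (π * (2 * (1 - ε) ^ 2)) (π * (3 * r ^ 2 / 2)) := by
    refine exists_between (lt_min ?_ ?_)
    · gcongr
    · gcongr
      linarith
  rw [lt_min_iff] at hσ₂
  obtain ⟨α, hα₁, hα₂⟩ := exists_between hσ₁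
  have hα0 : 0 < α := (by positivity : 0 < π * ((1 + ε) ^ 2 * R ^ 2)).trans hα₁
  obtain ⟨w, hwS, hw₁, hw₂⟩ : ∃ w ∈ (⋃ i, range fun k : ℤ => π * k * ((1 - ε) * a i) ^ 2)ᶜ,
      π * r ^ 2 < w ∧ w < π * ((1 - ε) * R) ^ 2 :=
    ((countable_iUnion fun i => countable_range _).dense_compl ℝ).exists_between (by gcongr)
  have hwα : w < α := hw₂.trans (lt_of_le_of_lt (by rw [mul_pow]; gcongr; linarith) hα₁)
  obtain ⟨c, hc, hnr⟩ := exists_mul_norm_le_norm_smul_sub_diagOp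
    (d := fun i => 1 / ((1 + ε) * a i) ^ 2) (w := α) fun i k hk => by
      have h0 := ha0 i
      rw [mul_one_div, div_eq_iff (by positivity)] at hk
      have h3 : ((1 + ε) * a i) ^ 2 ≤ (1 + ε) ^ 2 * R ^ 2 := by
        rw [mul_pow]
        gcongr
        exact hR i
      have h4 : (1 - ε) ^ 2 ≤ ((1 + ε) * a i) ^ 2 := by
        gcongr
        nlinarith [ha i]
      have h5 : 0 < π * ((1 + ε) * a i) ^ 2 := by positivity
      have h1 : (1 : ℝ) < k := by
        refine lt_of_mul_lt_mul_left ?_ h5.le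
        nlinarith
      have h2 : (k : ℝ) < 2 := by
        refine lt_of_mul_lt_mul_left ?_ h5.le
        nlinarith [hσ₂.1]
      norm_cast at h1 h2
      omega
  have hs := h.isSymplecticShell hn ha0 hε₀ hε₁ (by positivity) hda (fun i => le_rfl) hr₁ hsub
  refine hs.false_of_low (r := r) (w := w) (α := α) (τ := σ - w) (c := c) (μ := σ / (1 - ε) ^ 2)
    (e := EuclideanSpace.single ⟨2 * i₁.1, by have := i₁.isLt; omega⟩ 1)
    (by rw [finrank_euclideanSpace_fin]; omega) hr₁r hr₂
    (volume_sdiff_ellipsoid_lt ha0 hε₀ hε₁ hr0 hvol) hw₁ hwα.le (by linarith)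
    (by linarith [hσ₂.2]) hc hnr (eq_zero_of_smul_eq_diagOp fun i k hk => ?_) (by simp) ?_ ?_ ?_
    (mul_inner_diagOp_le fun i => ?_)
  · refine hwS (mem_iUnion.2 ⟨i, k, ?_⟩)
    have := ha0 i
    rw [mul_one_div, div_eq_iff (by positivity)] at hk
    exact hk.symm
  · rw [inner_diagOp_single, pairIndex_even, hi₁, mul_one_div, div_lt_iff₀ (by positivity)]
    exact hw₂
  · rw [mul_one_div, lt_div_iff₀ (by positivity), mul_pow]
    exact hα₁
  · rw [div_lt_iff₀ (by positivity)]
    linarith [hσ₂.1]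
  · rw [add_sub_cancel, mul_one_div]
    have := hα0.trans hα₂
    gcongr
    exact le_mul_of_one_le_right h1ε.le (ha i)

end EllipsoidalShell

section SphericalCapacity

variable {n : ℕ} {a : Fin n → ℝ}

theorem ellQ_le_norm_sq (ha : ∀ i, 1 ≤ a i) (z : R2n n) : ellQ n a z ≤ ‖z‖ ^ 2 := by
  rw [ellQ_eq_inner, ← one_mul (inner ℝ _ _), ← one_mul (‖z‖ ^ 2)]
  refine mul_inner_diagOp_le (fun i => ?_) z
  rw [one_mul]
  exact div_le_one_of_le₀ (one_le_pow₀ (ha i)) (sq_nonneg _)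

theorem norm_sq_div_le_ellQ (ha : ∀ i, 0 < a i) {R : ℝ} (hR : ∀ i, a i ≤ R) (z : R2n n) :
    1 / R ^ 2 * ‖z‖ ^ 2 ≤ ellQ n a z := by
  rw [ellQ_eq_inner]
  refine mul_norm_sq_le_inner_diagOp (fun i => ?_) z
  have := ha i
  gcongr
  exact hR i

theorem sympEmbNbhd_of_subset {A U : Set (R2n n)} (hU : IsOpen U) (h : A ⊆ U) :
    SympEmbNbhd n A U :=
  ⟨U, id, h, hU, contDiffOn_id, injOn_id _, mapsTo_id _, fun p _ v w => by
    rw [fderiv_id]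
    rfl⟩

theorem sphere_subset_ellShell (ha : ∀ i, 1 ≤ a i) {R : ℝ} (hR0 : 0 < R) (hR : ∀ i, a i ≤ R)
    {ε ρ : ℝ} (hε₁ : ε < 1) (hρ0 : 0 < ρ) (hρ : ρ < 1 + ε) (hρR : (1 - ε) * R < ρ) :
    sphere (0 : R2n n) ρ ⊆ ellShell n a ε := by
  intro z hz
  rw [mem_sphere_zero_iff_norm] at hz
  have h1 : 0 < 1 - ε := by linarith
  have h2 := ellQ_le_norm_sq ha z
  have h3 := norm_sq_div_le_ellQ (fun i => one_pos.trans_le (ha i)) hR z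
  rw [hz] at h2 h3
  refine ⟨?_, fun hzc => ?_⟩
  · rw [ellipsoid, mem_ofPred_eq, ellQ_const_mul, div_lt_one (by nlinarith)]
    exact h2.trans_lt (by gcongr)
  · have h4 : ellQ n (fun i => (1 - ε) * a i) z ≤ 1 := closure_ellipsoid_subset _ hzc
    rw [ellQ_const_mul, div_le_one (by positivity)] at h4
    have h5 := h3.trans h4
    rw [one_div_mul_eq_div, div_le_iff₀ (by positivity), ← mul_pow] at h5
    have h6 : ((1 - ε) * R) ^ 2 < ρ ^ 2 := by gcongr
    linarith

theorem le_sphericalCap {U : Set (R2n n)} {r : ℝ} (hr : 0 < r)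
    (h : SympEmbNbhd n (sphere (0 : R2n n) r) U) :
    ENNReal.ofReal (π * r ^ 2) ≤ sphericalCap n U :=
  le_sSup ⟨r, hr, rfl, h⟩

theorem exists_sympEmbNbhd_of_lt_sphericalCap {U : Set (R2n n)} {r₀ : ℝ}
    (h : ENNReal.ofReal (π * r₀ ^ 2) < sphericalCap n U) :
    ∃ r, r₀ < r ∧ SympEmbNbhd n (sphere (0 : R2n n) r) U := by
  obtain ⟨c, ⟨r, hr, rfl, hrU⟩, hc⟩ := lt_sSup_iff.1 h
  refine ⟨r, ?_, hrU⟩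
  rw [ENNReal.ofReal_lt_ofReal_iff (by positivity), mul_lt_mul_iff_right₀ Real.pi_pos] at hc
  exact lt_of_pow_lt_pow_left₀ 2 hr.le hc

theorem volume_bound {ε R ρ : ℝ} (ha : ∀ i, 1 ≤ a i) (hR1 : 1 < R) (hR : ∀ i, a i ≤ R)
    (hε₀ : 0 < ε) (hρ : 1 + ε ≤ ρ) (hρR : ρ ≤ (1 - ε) * R) :
    ((1 + ε) ^ (2 * n) - (1 - ε) ^ (2 * n)) * ∏ i, a i ^ 2
      ≤ ρ ^ (2 * n) * (R ^ (2 * n) - 1) := by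
  have hP : ∏ i, a i ^ 2 ≤ R ^ (2 * n) := by
    have h := Finset.prod_le_prod (s := Finset.univ) (f := fun i => a i ^ 2)
      (g := fun _ => R ^ 2) (fun i _ => sq_nonneg _) fun i _ => by
        have := ha i
        gcongr
        exact hR i
    simpa [← pow_mul] using h
  have hP0 : 0 ≤ ∏ i, a i ^ 2 := Finset.prod_nonneg fun i _ => sq_nonneg _
  have h1 : (1 + ε) ^ (2 * n) ≤ ρ ^ (2 * n) := by gcongr
  have h2 : ρ ^ (2 * n) ≤ (1 - ε) ^ (2 * n) * R ^ (2 * n) := by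
    rw [← mul_pow]
    gcongr
    linarith
  have h3 : 0 ≤ (1 - ε) ^ (2 * n) := by rw [pow_mul]; positivity
  have h4 : (1 : ℝ) ≤ R ^ (2 * n) := one_le_pow₀ hR1.le
  have h5 : 0 ≤ ρ ^ (2 * n) := by rw [pow_mul]; positivity
  rcases le_total ((1 + ε) ^ (2 * n)) ((1 - ε) ^ (2 * n)) with h6 | h6
  · exact (mul_nonpos_of_nonpos_of_nonneg (by linarith) hP0).trans
      (mul_nonneg h5 (by linarith))
  · calc _ ≤ ((1 + ε) ^ (2 * n) - (1 - ε) ^ (2 * n)) * R ^ (2 * n) :=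
          mul_le_mul_of_nonneg_left hP (by linarith)
      _ ≤ ρ ^ (2 * n) * R ^ (2 * n) - ρ ^ (2 * n) := by
          rw [sub_mul]
          linarith [mul_le_mul_of_nonneg_right h1 (zero_le_one.trans h4)]
      _ = _ := by ring

end SphericalCapacity

/-- Theorem 1 (main theorem): the spherical capacity is discontinuous on the family of
ellipsoidal shells `U_ε = (1+ε)E \ closure((1-ε)E)` at `ε₀ = (R-1)/(R+1)`, where `E` is an
open ellipsoid with symplectic half axes `1 = r_1 ≤ … ≤ r_n = R`, `1 < R < 2^(1/(2n))`. -/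
theorem spherical_capacity_discontinuous_on_ellipsoidal_shells
    (n : ℕ) (hn : 2 ≤ n) (a : Fin n → ℝ) (R : ℝ)
    (hmono : Monotone a) (hfirst : a ⟨0, by omega⟩ = 1) (hlast : a ⟨n - 1, by omega⟩ = R)
    (hR1 : 1 < R) (hR2 : R < (2 : ℝ) ^ ((1 : ℝ) / (2 * (n : ℝ)))) :
    ¬ ContinuousWithinAt (fun ε : ℝ => sphericalCap n (ellShell n a ε))
      (Ioo (0 : ℝ) 1) ((R - 1) / (R + 1)) := by
  have h2n : R ^ (2 * n) < 2 := by
    have h1 : (1 : ℝ) / (2 * n) = ((2 * n : ℕ) : ℝ)⁻¹ := by push_cast; rw [one_div]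
    rw [h1] at hR2
    calc R ^ (2 * n) < ((2 : ℝ) ^ (((2 * n : ℕ) : ℝ)⁻¹)) ^ (2 * n) := by gcongr
      _ = 2 := Real.rpow_inv_natCast_pow zero_le_two (by omega)
  have hR4 : R ^ 4 < 2 := (pow_le_pow_right₀ hR1.le (by omega)).trans_lt h2n
  have hR32 : 2 * R ^ 2 < 3 := by nlinarith [sq_nonneg (R ^ 2)]
  have hR0 : 0 < R := by linarith
  have ha : ∀ i, 1 ≤ a i := fun i => hfirst ▸ hmono (Fin.mk_le_of_le_val (Nat.zero_le _))
  have haR : ∀ i, a i ≤ R := fun i => hlast ▸ hmono (Fin.le_def.2 (Nat.le_sub_one_of_lt i.isLt))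
  set ε₀ := (R - 1) / (R + 1) with hε₀
  set ρ := 1 + ε₀ with hρ
  have hρR : ρ = (1 - ε₀) * R := by
    rw [hρ, hε₀]
    field_simp
    ring
  have hε₀0 : 0 < ε₀ := div_pos (by linarith) (by linarith)
  have hε₀1 : ε₀ < 1 := (div_lt_one (by linarith)).2 (by linarith)
  have hρ0 : 0 < ρ := by linarith
  intro hcont
  have hlow : ENNReal.ofReal (π * ρ ^ 2) ≤ sphericalCap n (ellShell n a ε₀) := by
    have h1 : Tendsto (fun ε => sphericalCap n (ellShell n a ε)) (𝓝[Ioo ε₀ 1] ε₀)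
        (𝓝 (sphericalCap n (ellShell n a ε₀))) :=
      hcont.mono (Ioo_subset_Ioo_left hε₀0.le)
    have h2 : (𝓝[Ioo ε₀ 1] ε₀).NeBot := by
      rw [nhdsWithin_Ioo_eq_nhdsGT hε₀1]
      infer_instance
    refine ge_of_tendsto h1 (eventually_mem_nhdsWithin.mono fun ε hε => ?_)
    refine le_sphericalCap hρ0 (sympEmbNbhd_of_subset (isOpen_ellShell a ε)
      (sphere_subset_ellShell ha hR0 haR hε.2 hρ0 (by linarith [hε.1]) ?_))
    rw [hρR]
    gcongr
    exact hε.1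
  obtain ⟨r₀, ⟨⟨hr₀1, hr₀2⟩, hr₀0⟩, hr₀ρ⟩ : ∃ r₀, ((2 * (ρ ^ 2 * R ^ 2) < 3 * r₀ ^ 2 ∧
      ρ ^ (2 * n) * (R ^ (2 * n) - 1) < r₀ ^ (2 * n)) ∧ 0 < r₀) ∧ r₀ < ρ := by
    have h1 : ∀ᶠ r₀ in 𝓝 ρ, 2 * (ρ ^ 2 * R ^ 2) < 3 * r₀ ^ 2 :=
      (by fun_prop : ContinuousAt (fun r₀ : ℝ => 3 * r₀ ^ 2) ρ).eventually
        (lt_mem_nhds (by nlinarith [pow_pos hρ0 2]))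
    have h2 : ∀ᶠ r₀ in 𝓝 ρ, ρ ^ (2 * n) * (R ^ (2 * n) - 1) < r₀ ^ (2 * n) :=
      (by fun_prop : ContinuousAt (fun r₀ : ℝ => r₀ ^ (2 * n)) ρ).eventually
        (lt_mem_nhds (by nlinarith [pow_pos hρ0 (2 * n)]))
    exact ((((h1.and h2).and (lt_mem_nhds hρ0)).filter_mono nhdsWithin_le_nhds).and
      (self_mem_nhdsWithin (s := Iio ρ))).exists
  have hcap : ∀ᶠ ε in 𝓝[Ioo 0 1] ε₀,
      ENNReal.ofReal (π * r₀ ^ 2) < sphericalCap n (ellShell n a ε) := by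
    refine hcont.eventually (lt_mem_nhds (lt_of_lt_of_le ?_ hlow))
    rw [ENNReal.ofReal_lt_ofReal_iff (by positivity)]
    gcongr
  have hsq : ∀ᶠ ε in 𝓝 ε₀, 0 < 2 * (1 - ε) ^ 2 - (1 + ε) ^ 2 * R ^ 2 := by
    refine (by fun_prop : ContinuousAt (fun ε : ℝ => 2 * (1 - ε) ^ 2 - (1 + ε) ^ 2 * R ^ 2)
      ε₀).eventually (lt_mem_nhds ?_)
    change 0 < 2 * (1 - ε₀) ^ 2 - ρ ^ 2 * R ^ 2
    rw [hρR]
    nlinarith [mul_lt_mul_of_pos_right hR4 (pow_pos (sub_pos.2 hε₀1) 2)]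
  have hne : (𝓝[Ioo 0 ε₀] ε₀).NeBot := by
    rw [nhdsWithin_Ioo_eq_nhdsLT hε₀0]
    infer_instance
  obtain ⟨ε, ⟨hεcap, hεsq⟩, hε0, hεε₀⟩ :=
    (((hcap.filter_mono (nhdsWithin_mono _ (Ioo_subset_Ioo_right hε₀1.le))).and
      (hsq.filter_mono nhdsWithin_le_nhds)).and self_mem_nhdsWithin).exists
  obtain ⟨r, hr, N, φ, hN, hφ⟩ := exists_sympEmbNbhd_of_lt_sphericalCap hεcap
  have hε1 : ε < 1 := hεε₀.trans hε₀1
  have hρε : ρ ≤ (1 - ε) * R := by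
    rw [hρR]
    gcongr
  have hvol := ((volume_bound ha hR1 haR hε0 (by linarith) hρε).trans_lt hr₀2).trans
    (pow_lt_pow_left₀ hr hr₀0.le (by omega))
  rcases lt_or_ge (1 + ε) r with hrε | hrε
  · exact hφ.false_of_outer_lt hN hn ha hfirst haR hε0 hε1 hrε hvol
  · refine hφ.false_of_lt_inner hN hn ha hlast haR hε0 hε1 (hr₀0.trans hr) (by linarith)
      (by linarith) ?_ hvol
    calc 2 * ((1 + ε) ^ 2 * R ^ 2) ≤ 2 * (ρ ^ 2 * R ^ 2) := by gcongr; linarith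
      _ < 3 * r₀ ^ 2 := hr₀1
      _ ≤ 3 * r ^ 2 := by gcongr
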